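/- Let p ≥ 2 be an integer and let μ be a Borel probability measure on the circle 𝕋 = ℝ/ℤ which is invariant and ergodic under T_p and satisfies dim μ > 0. Let m > n > 1 be integers with m ≁ p and n ≁ p. Then for μ-almost every x, the sequence (1/N)∑_{i=0}^{N-1} δ_{(T_m^i x, T_n^i x)} converges in the weak-* topology to λ × λ on 𝕋². -/

import Mathlib

open MeasureTheory Filter Set Topology
open scoped ENNReal

/-- The (lower) Hausdorff dimension of a measure:
`dim μ = inf { dim_H A : A Borel, μ(A) > 0 }`. -/
noncomputable def measureDim {X : Type*} [EMetricSpace X] [MeasurableSpace X]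
    (μ : Measure X) : ℝ≥0∞ :=
  ⨅ (A : Set X) (_ : MeasurableSet A) (_ : 0 < μ A), dimH A

namespace TPE

set_option linter.unusedSectionVars false

section avg

variable {X : Type*} [MeasurableSpace X] {μ : Measure X} {𝕜 : Type*} [RCLike 𝕜]

/-- Average of `f` over the cell of `x` in the partition given by the fibres of `d`. -/
noncomputable def avg (μ : Measure X) (d : X → ℕ) (f : X → 𝕜) (x : X) : 𝕜 :=
  ((μ.real (d ⁻¹' {d x}))⁻¹ : ℝ) • ∫ y in d ⁻¹' {d x}, f y ∂μ

lemma avg_factor (d : X → ℕ) (f : X → 𝕜) : ∃ v : ℕ → 𝕜, ∀ x, avg μ d f x = v (d x) :=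
  ⟨fun j => ((μ.real (d ⁻¹' {j}))⁻¹ : ℝ) • ∫ y in d ⁻¹' {j}, f y ∂μ, fun _ => rfl⟩

lemma measurable_avg {d : X → ℕ} (hd : Measurable d) (f : X → 𝕜) : Measurable (avg μ d f) := by
  obtain ⟨v, hv⟩ := avg_factor (μ := μ) d f
  have : avg μ d f = v ∘ d := funext hv
  rw [this]
  exact (measurable_of_countable v).comp hd

lemma norm_avg_le [IsFiniteMeasure μ] (d : X → ℕ) {f : X → 𝕜} {C : ℝ} (hC : 0 ≤ C)
    (hf : ∀ x, ‖f x‖ ≤ C) (x : X) : ‖avg μ d f x‖ ≤ C := by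
  unfold avg
  rw [norm_smul, Real.norm_of_nonneg (by positivity)]
  have h := norm_setIntegral_le_of_norm_le_const (μ := μ) (s := d ⁻¹' {d x}) (f := f) (C := C)
    (measure_lt_top _ _) (fun y _ => hf y)
  rcases eq_or_lt_of_le (measureReal_nonneg (μ := μ) (s := d ⁻¹' {d x})) with h0 | h0
  · rw [← h0]; simpa using hC
  · rw [inv_mul_le_iff₀ h0]
    linarith [h]

lemma integrable_of_bdd [IsFiniteMeasure μ] {E : Type*} [NormedAddCommGroup E] {f : X → E}
    (hf : AEStronglyMeasurable f μ)
    {C : ℝ} (hC : ∀ x, ‖f x‖ ≤ C) : Integrable f μ :=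
  Integrable.of_bound hf C (ae_of_all _ hC)

/-- Pull-out property. -/
lemma integral_avg_mul [IsFiniteMeasure μ] {d : X → ℕ} (hd : Measurable d) {f : X → 𝕜}
    (hfm : Measurable f) {C : ℝ} (hf : ∀ x, ‖f x‖ ≤ C) {g : ℕ → 𝕜} {C' : ℝ}
    (hg : ∀ j, ‖g j‖ ≤ C') :
    ∫ x, avg μ d f x * g (d x) ∂μ = ∫ x, f x * g (d x) ∂μ := by
  rcases isEmpty_or_nonempty X with hX | ⟨⟨x0⟩⟩
  · simp [Measure.eq_zero_of_isEmpty μ]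
  have hC : 0 ≤ C := (norm_nonneg _).trans (hf x0)
  have hC' : 0 ≤ C' := (norm_nonneg _).trans (hg 0)
  have hgm : Measurable fun x => g (d x) := (measurable_of_countable g).comp hd
  have key : ∀ F : X → 𝕜, Integrable F μ → ∫ x, F x ∂μ = ∑' j, ∫ x in d ⁻¹' {j}, F x ∂μ := by
    intro F hF
    rw [← integral_iUnion (fun j => hd (measurableSet_singleton j)) _ hF.integrableOn]
    · have : ⋃ j, d ⁻¹' {j} = univ := by ext x; simp
      rw [this, setIntegral_univ]
    · intro i j hij
      refine Set.disjoint_left.2 fun x hx hx' => hij ?_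
      simp at hx hx'
      exact hx.symm.trans hx'
  rw [key, key]
  · refine tsum_congr fun j => ?_
    have h1 : ∫ x in d ⁻¹' {j}, avg μ d f x * g (d x) ∂μ
        = ∫ x in d ⁻¹' {j}, (((μ.real (d ⁻¹' {j}))⁻¹ : ℝ) • ∫ y in d ⁻¹' {j}, f y ∂μ) * g j ∂μ := by
      refine setIntegral_congr_fun (hd (measurableSet_singleton j)) fun x hx => ?_
      have : d x = j := hx
      simp only [avg, this]
    have h2 : ∫ x in d ⁻¹' {j}, f x * g (d x) ∂μ = ∫ x in d ⁻¹' {j}, f x * g j ∂μ := by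
      refine setIntegral_congr_fun (hd (measurableSet_singleton j)) fun x hx => ?_
      have : d x = j := hx
      simp only [this]
    rw [h1, h2, setIntegral_const, integral_mul_const]
    rcases eq_or_ne (μ.real (d ⁻¹' {j})) 0 with h0 | h0
    · have : μ (d ⁻¹' {j}) = 0 := by
        rwa [measureReal_eq_zero_iff] at h0
      rw [h0, setIntegral_measure_zero _ this]; simp
    · rw [smul_mul_assoc, smul_smul, mul_inv_cancel₀ h0, one_smul]
  · refine integrable_of_bdd (hfm.mul hgm).aestronglyMeasurable (C := C * C') fun x => ?_
    rw [norm_mul]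
    exact mul_le_mul (hf x) (hg _) (norm_nonneg _) hC
  · refine integrable_of_bdd ((measurable_avg hd f).mul hgm).aestronglyMeasurable (C := C * C') fun x => ?_
    rw [norm_mul]
    exact mul_le_mul (norm_avg_le d hC hf x) (hg _) (norm_nonneg _) hC

lemma avg_comp {S : X → X} (hS : MeasurePreserving S μ μ) {d : X → ℕ} (hd : Measurable d)
    {f : X → 𝕜} (hf : Measurable f) (x : X) :
    avg μ (fun y => d (S y)) (fun y => f (S y)) x = avg μ d f (S x) := by
  unfold avg
  have hE : MeasurableSet (d ⁻¹' {d (S x)}) := hd (measurableSet_singleton _)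
  have h1 : (fun y => d (S y)) ⁻¹' {d (S x)} = S ⁻¹' (d ⁻¹' {d (S x)}) := rfl
  rw [h1]
  congr 1
  · rw [measureReal_def, measureReal_def, hS.measure_preimage hE.nullMeasurableSet]
  · conv_rhs => rw [← hS.map_eq]
    rw [setIntegral_map hE hf.aestronglyMeasurable hS.measurable.aemeasurable]

/-- Orthogonality of martingale differences. -/
lemma integral_avg_sub_avg_mul [IsFiniteMeasure μ] {d d' : X → ℕ} (hd : Measurable d)
    (hd' : Measurable d') {φ : ℕ → ℕ} (hφ : ∀ x, d' x = φ (d x)) {f : X → 𝕜}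
    (hfm : Measurable f) {C : ℝ} (hf : ∀ x, ‖f x‖ ≤ C) {g : ℕ → 𝕜} {C' : ℝ}
    (hg : ∀ j, ‖g j‖ ≤ C') :
    ∫ x, avg μ d f x * g (d' x) ∂μ = ∫ x, avg μ d' f x * g (d' x) ∂μ := by
  rw [integral_avg_mul hd' hfm hf hg]
  simp only [hφ]
  exact integral_avg_mul hd hfm hf (g := fun j => g (φ j)) (fun j => hg _)

/-- Pythagoras, localized to a set measurable for the coarse partition. `N` is any function
measurable for the coarse partition. -/
lemma pyth [IsFiniteMeasure μ] {d d' : X → ℕ} (hd : Measurable d)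
    (hd' : Measurable d') {φ : ℕ → ℕ} (hφ : ∀ x, d' x = φ (d x)) {f : X → 𝕜}
    (hfm : Measurable f) {C : ℝ} (hf : ∀ x, ‖f x‖ ≤ C) {v : ℕ → 𝕜} {C' : ℝ}
    (hv : ∀ x, ‖v (d' x)‖ ≤ C') (B : Set ℕ) :
    ∫ x in d' ⁻¹' B, ‖avg μ d f x - v (d' x)‖ ^ 2 ∂μ
      = ∫ x in d' ⁻¹' B, ‖avg μ d f x - avg μ d' f x‖ ^ 2 ∂μ
        + ∫ x in d' ⁻¹' B, ‖avg μ d' f x - v (d' x)‖ ^ 2 ∂μ := by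
  classical
  rcases isEmpty_or_nonempty X with hX | ⟨⟨x0⟩⟩
  · simp [Measure.eq_zero_of_isEmpty μ]
  have hC : 0 ≤ C := (norm_nonneg _).trans (hf x0)
  have hC' : 0 ≤ C' := (norm_nonneg _).trans (hv x0)
  have hB : MeasurableSet (d' ⁻¹' B) := hd' (MeasurableSet.of_discrete)
  have hvm : Measurable fun x => v (d' x) := (measurable_of_countable v).comp hd'
  have hm := measurable_avg (μ := μ) hd f
  have hm' := measurable_avg (μ := μ) hd' f
  have hb := norm_avg_le (μ := μ) d hC hf
  have hb' := norm_avg_le (μ := μ) d' hC hf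
  obtain ⟨w, hw⟩ := avg_factor (μ := μ) d' f
  -- the cross term
  let g : ℕ → 𝕜 := fun j => if j ∈ B ∧ ‖w j‖ ≤ C ∧ ‖v j‖ ≤ C' then star (w j - v j) else 0
  have hgb : ∀ j, ‖g j‖ ≤ C + C' := by
    intro j
    simp only [g]
    split_ifs with h
    · rw [norm_star]
      exact (norm_sub_le _ _).trans (add_le_add h.2.1 h.2.2)
    · simp; positivity
  have hcross := integral_avg_sub_avg_mul hd hd' hφ hfm hf hgb (μ := μ)
  have hgm : Measurable fun x => g (d' x) := (measurable_of_countable g).comp hd'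
  have hi1 : Integrable (fun x => avg μ d f x * g (d' x)) μ := by
    refine integrable_of_bdd (hm.mul hgm).aestronglyMeasurable (C := C * (C + C')) fun x => ?_
    rw [norm_mul]; exact mul_le_mul (hb x) (hgb _) (norm_nonneg _) hC
  have hi2 : Integrable (fun x => avg μ d' f x * g (d' x)) μ := by
    refine integrable_of_bdd (hm'.mul hgm).aestronglyMeasurable (C := C * (C + C')) fun x => ?_
    rw [norm_mul]; exact mul_le_mul (hb' x) (hgb _) (norm_nonneg _) hC
  have h0 : ∫ x, (avg μ d f x - avg μ d' f x) * g (d' x) ∂μ = 0 := by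
    simp only [sub_mul]
    rw [integral_sub hi1 hi2, hcross, sub_self]
  have h0' : ∫ x, RCLike.re ((avg μ d f x - avg μ d' f x) * g (d' x)) ∂μ = 0 := by
    have := integral_re (𝕜 := 𝕜) (f := fun x => (avg μ d f x - avg μ d' f x) * g (d' x)) (μ := μ)
      (by simp only [sub_mul]; exact hi1.sub hi2)
    rw [this, h0]; simp
  have hI1 : Integrable (fun x => ‖avg μ d f x - avg μ d' f x‖ ^ 2) μ := by
    refine integrable_of_bdd ((hm.sub hm').norm.pow_const 2).aestronglyMeasurable
      (C := (C + C) ^ 2) fun x => ?_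
    rw [norm_pow, norm_norm]
    gcongr
    exact (norm_sub_le _ _).trans (add_le_add (hb x) (hb' x))
  have hI2 : Integrable (fun x => ‖avg μ d' f x - v (d' x)‖ ^ 2) μ := by
    refine integrable_of_bdd ((hm'.sub hvm).norm.pow_const 2).aestronglyMeasurable
      (C := (C + C') ^ 2) fun x => ?_
    rw [norm_pow, norm_norm]
    gcongr
    exact (norm_sub_le _ _).trans (add_le_add (hb' x) (hv x))
  have hI3 : Integrable (fun x => RCLike.re ((avg μ d f x - avg μ d' f x) * g (d' x))) μ :=
    (by simp only [sub_mul]; exact hi1.sub hi2 : Integrable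
      (fun x => (avg μ d f x - avg μ d' f x) * g (d' x)) μ).re
  have hI3' : ∫ x in d' ⁻¹' B, RCLike.re ((avg μ d f x - avg μ d' f x) * g (d' x)) ∂μ = 0 := by
    rw [← h0', setIntegral_eq_integral_of_forall_compl_eq_zero]
    intro x hx
    have : d' x ∉ B := hx
    simp [g, this]
  rw [← integral_add hI1.integrableOn hI2.integrableOn]
  have : ∫ x in d' ⁻¹' B, ‖avg μ d f x - v (d' x)‖ ^ 2 ∂μ
      = ∫ x in d' ⁻¹' B, ((‖avg μ d f x - avg μ d' f x‖ ^ 2 + ‖avg μ d' f x - v (d' x)‖ ^ 2)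
        + 2 * RCLike.re ((avg μ d f x - avg μ d' f x) * g (d' x))) ∂μ := by
    refine setIntegral_congr_fun hB fun x hx => ?_
    have hx' : d' x ∈ B := hx
    have hwx : ‖w (d' x)‖ ≤ C := by rw [← hw]; exact hb' x
    simp only [g, hx', hwx, hv x, and_self, if_true]
    rw [← hw x]
    have e : avg μ d f x - v (d' x)
      = (avg μ d f x - avg μ d' f x) + (avg μ d' f x - v (d' x)) := by ring
    rw [e]
    simp only [RCLike.norm_sq_eq_def, RCLike.star_def, map_add, map_sub, RCLike.mul_re,
      RCLike.conj_re, RCLike.conj_im]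
    ring
  have hI12 : Integrable (fun x => ‖avg μ d f x - avg μ d' f x‖ ^ 2
    + ‖avg μ d' f x - v (d' x)‖ ^ 2) μ := hI1.add hI2
  rw [this, integral_add hI12.integrableOn (hI3.const_mul 2).integrableOn,
    integral_const_mul, hI3', mul_zero, add_zero]

/-- Global Pythagoras. -/
lemma integral_norm_sub_sq [IsFiniteMeasure μ] {d d' : X → ℕ} (hd : Measurable d)
    (hd' : Measurable d') {φ : ℕ → ℕ} (hφ : ∀ x, d' x = φ (d x)) {f : X → 𝕜}
    (hfm : Measurable f) {C : ℝ} (hf : ∀ x, ‖f x‖ ≤ C) :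
    ∫ x, ‖avg μ d f x - avg μ d' f x‖ ^ 2 ∂μ
      = ∫ x, ‖avg μ d f x‖ ^ 2 ∂μ - ∫ x, ‖avg μ d' f x‖ ^ 2 ∂μ := by
  have := pyth hd hd' hφ hfm hf (μ := μ) (v := fun _ => 0) (C' := 0) (by simp) univ
  simp at this
  linarith

lemma integral_norm_avg_sq_mono [IsFiniteMeasure μ] {d d' : X → ℕ} (hd : Measurable d)
    (hd' : Measurable d') {φ : ℕ → ℕ} (hφ : ∀ x, d' x = φ (d x)) {f : X → 𝕜}
    (hfm : Measurable f) {C : ℝ} (hf : ∀ x, ‖f x‖ ≤ C) :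
    ∫ x, ‖avg μ d' f x‖ ^ 2 ∂μ ≤ ∫ x, ‖avg μ d f x‖ ^ 2 ∂μ := by
  have := integral_norm_sub_sq hd hd' hφ hfm hf (μ := μ)
  have h2 : 0 ≤ ∫ x, ‖avg μ d f x - avg μ d' f x‖ ^ 2 ∂μ := integral_nonneg fun x => by positivity
  linarith

/-- Kolmogorov's maximal inequality for a finite filtration of countable partitions. -/
lemma kolmogorov [IsFiniteMeasure μ] {d : ℕ → X → ℕ} (hd : ∀ l, Measurable (d l)) {K : ℕ}
    (hφ : ∀ j l, j ≤ l → l ≤ K → ∃ φ : ℕ → ℕ, ∀ x, d j x = φ (d l x)) {f : X → 𝕜}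
    (hfm : Measurable f) {C : ℝ} (hf : ∀ x, ‖f x‖ ≤ C) {r : ℕ} (hr : r ≤ K) {c : ℝ} (hc : 0 ≤ c) :
    c ^ 2 * μ.real {x | ∃ l, r ≤ l ∧ l ≤ K ∧ c ≤ ‖avg μ (d l) f x - avg μ (d r) f x‖}
      ≤ ∫ x, ‖avg μ (d K) f x‖ ^ 2 ∂μ - ∫ x, ‖avg μ (d r) f x‖ ^ 2 ∂μ := by
  rcases isEmpty_or_nonempty X with hX | ⟨⟨x0⟩⟩
  · simp [Measure.eq_zero_of_isEmpty μ]
  have hC : 0 ≤ C := (norm_nonneg _).trans (hf x0)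
  obtain ⟨φ, hφr⟩ := hφ r K hr le_rfl
  rw [← integral_norm_sub_sq (hd K) (hd r) hφr hfm hf]
  have hm := fun l => measurable_avg (μ := μ) (hd l) f
  have hb := fun l => norm_avg_le (μ := μ) (d l) hC hf
  have hI : ∀ l, Integrable (fun x => ‖avg μ (d l) f x - avg μ (d r) f x‖ ^ 2) μ := by
    intro l
    refine integrable_of_bdd (((hm l).sub (hm r)).norm.pow_const 2).aestronglyMeasurable
      (C := (C + C) ^ 2) fun x => ?_
    rw [norm_pow, norm_norm]
    gcongr
    exact (norm_sub_le _ _).trans (add_le_add (hb l x) (hb r x))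
  have main : ∀ i j, j + i = K → r ≤ j → ∀ B : Set ℕ,
      c ^ 2 * μ.real (d j ⁻¹' B ∩
        {x | ∃ l, j ≤ l ∧ l ≤ K ∧ c ≤ ‖avg μ (d l) f x - avg μ (d r) f x‖})
      ≤ ∫ x in d j ⁻¹' B, ‖avg μ (d K) f x - avg μ (d r) f x‖ ^ 2 ∂μ := by
    intro i
    induction i with
    | zero =>
      intro j hj hrj B
      have : j = K := by omega
      subst this
      have hset : MeasurableSet (d j ⁻¹' B ∩ {x | c ≤ ‖avg μ (d j) f x - avg μ (d r) f x‖}) :=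
        ((hd j) MeasurableSet.of_discrete).inter
          (measurableSet_le measurable_const ((hm j).sub (hm r)).norm)
      calc _ = c ^ 2 * μ.real (d j ⁻¹' B ∩ {x | c ≤ ‖avg μ (d j) f x - avg μ (d r) f x‖}) := by
            congr 3; ext x; simp only [mem_setOf_eq]; constructor
            · rintro ⟨l, h1, h2, h3⟩
              rwa [le_antisymm h2 h1] at h3
            · exact fun h => ⟨j, le_rfl, le_rfl, h⟩
        _ = ∫ x in d j ⁻¹' B ∩ {x | c ≤ ‖avg μ (d j) f x - avg μ (d r) f x‖}, c ^ 2 ∂μ := by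
            rw [setIntegral_const, smul_eq_mul, mul_comm]
        _ ≤ ∫ x in d j ⁻¹' B ∩ {x | c ≤ ‖avg μ (d j) f x - avg μ (d r) f x‖},
              ‖avg μ (d j) f x - avg μ (d r) f x‖ ^ 2 ∂μ := by
            refine setIntegral_mono_on (integrable_const _).integrableOn (hI j).integrableOn hset ?_
            intro x hx
            exact pow_le_pow_left₀ hc hx.2 2
        _ ≤ _ := setIntegral_mono_set (hI j).integrableOn (ae_of_all _ fun x => by positivity)
            (HasSubset.Subset.eventuallyLE inter_subset_left)
    | succ i ih =>
      intro j hj hrj B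
      obtain ⟨φ1, hφ1⟩ := hφ j (j + 1) (by omega) (by omega)
      obtain ⟨φ2, hφ2⟩ := hφ r j hrj (by omega)
      obtain ⟨φ3, hφ3⟩ := hφ j K (by omega) le_rfl
      obtain ⟨wj, hwj⟩ := avg_factor (μ := μ) (d j) f
      obtain ⟨wr, hwr⟩ := avg_factor (μ := μ) (d r) f
      let G : Set ℕ := {a | c ≤ ‖wj a - wr (φ2 a)‖}
      have hG : ∀ x, d j x ∈ G ↔ c ≤ ‖avg μ (d j) f x - avg μ (d r) f x‖ := by
        intro x; simp only [G, mem_setOf_eq, hwj, hwr, hφ2]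
      have hms : ∀ B : Set ℕ, MeasurableSet (d j ⁻¹' B) := fun B => (hd j) MeasurableSet.of_discrete
      have hA1 : c ^ 2 * μ.real (d j ⁻¹' (B ∩ G)) ≤
          ∫ x in d j ⁻¹' (B ∩ G), ‖avg μ (d K) f x - avg μ (d r) f x‖ ^ 2 ∂μ := by
        have hp := pyth (hd K) (hd j) hφ3 hfm hf (μ := μ) (v := fun a => wr (φ2 a)) (C' := C)
          (by intro x; rw [← hφ2, ← hwr]; exact hb r x) (B ∩ G)
        simp only [← hφ2, ← hwr] at hp
        rw [hp]
        have h1 : 0 ≤ ∫ x in d j ⁻¹' (B ∩ G), ‖avg μ (d K) f x - avg μ (d j) f x‖ ^ 2 ∂μ :=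
          integral_nonneg fun x => by positivity
        have h2 : c ^ 2 * μ.real (d j ⁻¹' (B ∩ G)) ≤
          ∫ x in d j ⁻¹' (B ∩ G), ‖avg μ (d j) f x - avg μ (d r) f x‖ ^ 2 ∂μ := by
          calc _ = ∫ x in d j ⁻¹' (B ∩ G), c ^ 2 ∂μ := by
                rw [setIntegral_const, smul_eq_mul, mul_comm]
            _ ≤ _ := by
              refine setIntegral_mono_on (integrable_const _).integrableOn (hI j).integrableOn
                (hms _) ?_
              intro x hx
              exact pow_le_pow_left₀ hc ((hG x).1 hx.2) 2
        linarith
      have hA2 := ih (j + 1) (by omega) (by omega) (φ1 ⁻¹' (B \ G))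
      have hpre : d (j + 1) ⁻¹' (φ1 ⁻¹' (B \ G)) = d j ⁻¹' (B \ G) := by
        ext x; simp only [mem_preimage, hφ1]
      rw [hpre] at hA2
      have hsub : d j ⁻¹' B ∩
          {x | ∃ l, j ≤ l ∧ l ≤ K ∧ c ≤ ‖avg μ (d l) f x - avg μ (d r) f x‖} ⊆
          d j ⁻¹' (B ∩ G) ∪ (d j ⁻¹' (B \ G) ∩
            {x | ∃ l, j + 1 ≤ l ∧ l ≤ K ∧ c ≤ ‖avg μ (d l) f x - avg μ (d r) f x‖}) := by
        rintro x ⟨hxB, l, hjl, hlK, hl⟩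
        by_cases hxG : d j x ∈ G
        · exact Or.inl ⟨hxB, hxG⟩
        · refine Or.inr ⟨⟨hxB, hxG⟩, l, ?_, hlK, hl⟩
          rcases eq_or_lt_of_le hjl with h | h
          · subst h; exact absurd ((hG x).2 hl) hxG
          · exact h
      have hmeas := (measureReal_mono (μ := μ) hsub (measure_ne_top _ _)).trans (measureReal_union_le _ _)
      have hsplit : ∫ x in d j ⁻¹' B, ‖avg μ (d K) f x - avg μ (d r) f x‖ ^ 2 ∂μ =
          ∫ x in d j ⁻¹' (B ∩ G), ‖avg μ (d K) f x - avg μ (d r) f x‖ ^ 2 ∂μ +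
          ∫ x in d j ⁻¹' (B \ G), ‖avg μ (d K) f x - avg μ (d r) f x‖ ^ 2 ∂μ := by
        rw [← setIntegral_union _ (hms _) (hI K).integrableOn (hI K).integrableOn]
        · rw [← preimage_union, inter_union_diff]
        · exact Disjoint.preimage _ disjoint_inf_sdiff
      rw [hsplit]
      have := mul_le_mul_of_nonneg_left hmeas (sq_nonneg c)
      linarith
  have := main (K - r) r (by omega) le_rfl univ
  simpa using this

end avg

end TPE

namespace TPE

section birkhoff

variable {Y : Type*} [MeasurableSpace Y] {ν : Measure Y}

lemma integral_comp_mp {Y Y' E : Type*} [MeasurableSpace Y] [MeasurableSpace Y'] {ν : Measure Y}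
    {ν' : Measure Y'} [NormedAddCommGroup E] [NormedSpace ℝ E] {T : Y → Y'}
    (hT : MeasurePreserving T ν ν') {F : Y' → E} (hF : AEStronglyMeasurable F ν') :
    ∫ x, F (T x) ∂ν = ∫ x, F x ∂ν' := by
  conv_rhs => rw [← hT.map_eq]
  rw [integral_map hT.measurable.aemeasurable (by rw [hT.map_eq]; exact hF)]

/-- The Garsia maximal function `max_{n ≤ N} S_n f`. -/
noncomputable def gmax (T : Y → Y) (f : Y → ℝ) : ℕ → Y → ℝ
  | 0 => fun _ => 0
  | N + 1 => fun x => max 0 (f x + gmax T f N (T x))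

lemma gmax_nonneg (T : Y → Y) (f : Y → ℝ) (N : ℕ) (x : Y) : 0 ≤ gmax T f N x := by
  cases N with
  | zero => simp [gmax]
  | succ N => simp [gmax]

lemma gmax_mono (T : Y → Y) (f : Y → ℝ) (N : ℕ) : ∀ x, gmax T f N x ≤ gmax T f (N + 1) x := by
  induction N with
  | zero => intro x; simp [gmax]
  | succ N ih =>
    intro x
    show max 0 (f x + gmax T f N (T x)) ≤ max 0 (f x + gmax T f (N + 1) (T x))
    exact max_le_max le_rfl (by linarith [ih (T x)])

lemma birkhoffSum_le_gmax (T : Y → Y) (f : Y → ℝ) (N : ℕ) :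
    ∀ n ≤ N, ∀ x, birkhoffSum T f n x ≤ gmax T f N x := by
  induction N with
  | zero => intro n hn x; simp [Nat.le_zero.1 hn, gmax]
  | succ N ih =>
    intro n hn x
    cases n with
    | zero => simpa using gmax_nonneg T f (N + 1) x
    | succ n =>
      rw [birkhoffSum_succ']
      exact (by linarith [ih n (by omega) (T x)] :
        f x + birkhoffSum T f n (T x) ≤ f x + gmax T f N (T x)).trans (le_max_right _ _)

lemma measurable_gmax {T : Y → Y} (hT : Measurable T) {f : Y → ℝ} (hf : Measurable f) (N : ℕ) :
    Measurable (gmax T f N) := by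
  induction N with
  | zero => exact measurable_const
  | succ N ih => exact measurable_const.max (hf.add (ih.comp hT))

lemma integrable_gmax {T : Y → Y} (hT : MeasurePreserving T ν ν) {f : Y → ℝ}
    (hi : Integrable f ν) (N : ℕ) : Integrable (gmax T f N) ν := by
  induction N with
  | zero => exact integrable_zero _ _ _
  | succ N ih =>
    have : Integrable (fun x => f x + gmax T f N (T x)) ν :=
      hi.add (hT.integrable_comp_of_integrable ih)
    exact (integrable_zero _ _ _).sup this

/-- Maximal ergodic theorem. -/
lemma maximal_ergodic {T : Y → Y} (hT : MeasurePreserving T ν ν) {f : Y → ℝ} (hf : Measurable f)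
    (hi : Integrable f ν) (N : ℕ) : 0 ≤ ∫ x in {x | 0 < gmax T f N x}, f x ∂ν := by
  have hE : MeasurableSet {x | 0 < gmax T f N x} :=
    measurableSet_lt measurable_const (measurable_gmax hT.measurable hf N)
  have hM := integrable_gmax hT hi N
  have hMT : Integrable (fun x => gmax T f N (T x)) ν := hT.integrable_comp_of_integrable hM
  have h1 : ∫ x in {x | 0 < gmax T f N x}, (gmax T f N x - gmax T f N (T x)) ∂ν
      ≤ ∫ x in {x | 0 < gmax T f N x}, f x ∂ν := by
    refine setIntegral_mono_on (hM.sub hMT).integrableOn hi.integrableOn hE ?_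
    intro x hx
    cases N with
    | zero => simp [gmax] at hx
    | succ N =>
      have hx' : 0 < max 0 (f x + gmax T f N (T x)) := hx
      have h2 : gmax T f (N + 1) x = f x + gmax T f N (T x) := by
        show max 0 (f x + gmax T f N (T x)) = _
        refine max_eq_right ?_
        by_contra h
        rw [max_eq_left (not_le.1 h).le] at hx'
        exact lt_irrefl _ hx'
      have := gmax_mono T f N (T x)
      linarith
  have h2 : ∫ x, (gmax T f N x - gmax T f N (T x)) ∂ν = 0 := by
    rw [integral_sub hM hMT, integral_comp_mp hT hM.aestronglyMeasurable, sub_self]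
  have h3 : ∫ x, (gmax T f N x - gmax T f N (T x)) ∂ν
      ≤ ∫ x in {x | 0 < gmax T f N x}, (gmax T f N x - gmax T f N (T x)) ∂ν := by
    rw [← integral_indicator hE]
    refine integral_mono (hM.sub hMT) ((hM.sub hMT).indicator hE) fun x => ?_
    by_cases hx : x ∈ {x | 0 < gmax T f N x}
    · simp only [indicator_of_mem hx]; exact le_rfl
    · simp only [indicator_of_notMem hx]
      have h5 : gmax T f N x ≤ 0 := not_lt.1 hx
      have := gmax_nonneg T f N (T x)
      linarith
  linarith

/-- Weak type maximal inequality for indicators. -/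
lemma maximal_weak [IsFiniteMeasure ν] {T : Y → Y} (hT : MeasurePreserving T ν ν) {B : Set Y}
    (hB : MeasurableSet B) (lam : ℝ) (N : ℕ) :
    lam * ν.real {x | ∃ n ≤ N, lam * n < birkhoffSum T (B.indicator 1) n x} ≤ ν.real B := by
  rcases lt_or_ge lam 0 with hl | hl
  · exact (mul_nonpos_of_nonpos_of_nonneg hl.le measureReal_nonneg).trans measureReal_nonneg
  have hfm : Measurable (B.indicator (1 : Y → ℝ)) := measurable_one.indicator hB
  have hfi : Integrable (B.indicator (1 : Y → ℝ)) ν := (integrable_const (1 : ℝ)).indicator hB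
  have hgm : Measurable (fun x => B.indicator (1 : Y → ℝ) x - lam) := hfm.sub_const _
  have hgi : Integrable (fun x => B.indicator (1 : Y → ℝ) x - lam) ν :=
    hfi.sub (integrable_const _)
  have h := maximal_ergodic hT hgm hgi N
  set E := {x | 0 < gmax T (fun x => B.indicator (1 : Y → ℝ) x - lam) N x} with hEdef
  rw [integral_sub hfi.integrableOn (integrable_const _), setIntegral_const, smul_eq_mul] at h
  have h1 : ∫ x in E, B.indicator (1 : Y → ℝ) x ∂ν ≤ ν.real B := by
    rw [setIntegral_indicator hB]
    simp only [Pi.one_apply, setIntegral_const, smul_eq_mul, mul_one]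
    exact measureReal_mono inter_subset_right (measure_ne_top _ _)
  have h2 : {x | ∃ n ≤ N, lam * n < birkhoffSum T (B.indicator 1) n x} ⊆ E := by
    rintro x ⟨n, hn, hx⟩
    have := birkhoffSum_le_gmax T (fun x => B.indicator (1 : Y → ℝ) x - lam) N n hn x
    refine lt_of_lt_of_le ?_ this
    have e : birkhoffSum T (fun x => B.indicator (1 : Y → ℝ) x - lam) n x
        = birkhoffSum T (B.indicator 1) n x - lam * n := by
      simp [birkhoffSum, Finset.sum_sub_distrib, mul_comm]
    rw [e]; linarith
  have h3 := measureReal_mono (μ := ν) h2 (measure_ne_top _ _)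
  have := mul_le_mul_of_nonneg_left h3 hl
  linarith

/-- Upper half of Birkhoff's theorem. -/
lemma birkhoff_upper [IsProbabilityMeasure ν] {T : Y → Y} (hT : MeasurePreserving T ν ν)
    {f Γ : Y → ℝ} (hf : Measurable f) (hfi : Integrable f ν) (hΓ : Measurable Γ)
    (hΓi : Integrable Γ ν) (hinv : ∀ x, Γ (T x) = Γ x)
    (hcond : ∀ A, MeasurableSet A → T ⁻¹' A = A → ∫ x in A, f x ∂ν = ∫ x in A, Γ x ∂ν)
    {ε : ℝ} (hε : 0 < ε) :
    ∀ᵐ x ∂ν, ∀ᶠ n : ℕ in atTop, birkhoffSum T f n x ≤ (Γ x + ε) * n := by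
  set h : Y → ℝ := fun x => f x - Γ x with hh
  have hhm : Measurable h := hf.sub hΓ
  have hhi : Integrable h ν := hfi.sub hΓi
  have hSh : ∀ n x, birkhoffSum T h n x = birkhoffSum T f n x - n * Γ x := by
    intro n x
    have : ∀ k, Γ (T^[k] x) = Γ x := by
      intro k
      induction k with
      | zero => rfl
      | succ k ih => rw [Function.iterate_succ_apply', hinv, ih]
    simp [birkhoffSum, hh, this]
  have hSm : ∀ n, Measurable (fun x => birkhoffSum T h n x) := by
    intro n
    unfold birkhoffSum
    exact Finset.measurable_sum _ fun k _ => hhm.comp (hT.measurable.iterate k)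
  -- the bad invariant set
  let A : Set Y := {x | ∃ j : ℕ, ∃ᶠ n : ℕ in atTop, (ε / 2 + ε / (j + 3)) * n < birkhoffSum T h n x}
  have hAm : MeasurableSet A := by
    have : A = ⋃ j : ℕ, limsup (fun n : ℕ =>
        {x | (ε / 2 + ε / (j + 3)) * n < birkhoffSum T h n x}) atTop := by
      ext x
      simp only [A, mem_setOf_eq, mem_iUnion, mem_limsup_iff_frequently_mem]
    rw [this]
    refine MeasurableSet.iUnion fun j => MeasurableSet.measurableSet_limsup fun n => ?_
    exact measurableSet_lt measurable_const (hSm n)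
  have hlim : ∀ (a b : ℝ), b < a → ∀ C : ℝ, ∀ᶠ n : ℕ in atTop, b * n + C < a * n := by
    intro a b hab C
    have : Tendsto (fun n : ℕ => (a - b) * (n : ℝ)) atTop atTop :=
      (tendsto_natCast_atTop_atTop).const_mul_atTop (by linarith)
    filter_upwards [this.eventually_gt_atTop C] with n hn
    linarith [sub_mul a b (n : ℝ)]
  have hgap : ∀ j : ℕ, ε / 2 + ε / ((j + 1 : ℕ) + 3) < ε / 2 + ε / (j + 3) := by
    intro j
    have : ε / ((j + 1 : ℕ) + 3) < ε / (j + 3) := by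
      apply div_lt_div_of_pos_left hε (by positivity)
      push_cast; linarith
    linarith
  have hAinv : T ⁻¹' A = A := by
    ext x
    simp only [mem_preimage, A, mem_setOf_eq]
    constructor
    · rintro ⟨j, hj⟩
      refine ⟨j + 1, ?_⟩
      have h1 := hlim _ _ (hgap j) (ε / 2 + ε / ((j + 1 : ℕ) + 3) - h x)
      have h2 := (hj.and_eventually h1)
      have h3 : ∃ᶠ n : ℕ in atTop,
          (ε / 2 + ε / ((j + 1 : ℕ) + 3)) * ((n + 1 : ℕ) : ℝ) < birkhoffSum T h (n + 1) x := by
        refine h2.mono fun n hn => ?_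
        rw [birkhoffSum_succ']
        push_cast at hn ⊢
        linarith [hn.1, hn.2]
      exact (tendsto_add_atTop_nat 1).frequently h3
    · rintro ⟨j, hj⟩
      refine ⟨j + 1, ?_⟩
      have h1 := hlim _ _ (hgap j) (h x)
      have h2 := (hj.and_eventually h1)
      rw [Filter.frequently_atTop] at h2 ⊢
      intro n0
      obtain ⟨n, hn, hn1, hn2⟩ := h2 (n0 + 1)
      obtain ⟨n', rfl⟩ : ∃ n', n = n' + 1 := ⟨n - 1, by omega⟩
      refine ⟨n', by omega, ?_⟩
      rw [birkhoffSum_succ'] at hn1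
      have : 0 ≤ ε / 2 + ε / ((j + 1 : ℕ) + 3) := by positivity
      push_cast at *
      nlinarith
  have hA0 : ν A = 0 := by
    let g : Y → ℝ := A.indicator (fun x => h x - ε / 2)
    have hgm : Measurable g := (hhm.sub_const _).indicator hAm
    have hgi : Integrable g ν := (hhi.sub (integrable_const _)).indicator hAm
    have hSg : ∀ x ∈ A, ∀ n, birkhoffSum T g n x = birkhoffSum T h n x - ε / 2 * n := by
      intro x hx n
      have : ∀ k, T^[k] x ∈ A := by
        intro k
        induction k with
        | zero => exact hx
        | succ k ih =>
          rw [Function.iterate_succ_apply']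
          have : T^[k] x ∈ T ⁻¹' A := by rw [hAinv]; exact ih
          exact this
      simp [birkhoffSum, g, indicator_of_mem (this _), mul_comm]
    let E : ℕ → Set Y := fun N => {x | 0 < gmax T g N x}
    have hEm : ∀ N, MeasurableSet (E N) := fun N =>
      measurableSet_lt measurable_const (measurable_gmax hT.measurable hgm N)
    have hEmono : Monotone E := monotone_nat_of_le_succ fun N x hx =>
      lt_of_lt_of_le hx (gmax_mono T g N x)
    have hAE : A ⊆ ⋃ N, E N := by
      rintro x hx
      obtain ⟨j, hj⟩ := id hx
      obtain ⟨n, hn1, hn2⟩ := (hj.and_eventually (eventually_gt_atTop 0)).exists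
      refine mem_iUnion.2 ⟨n, ?_⟩
      refine lt_of_lt_of_le ?_ (birkhoffSum_le_gmax T g n n le_rfl x)
      rw [hSg x hx]
      have h1 : 0 < ε / (j + 3) := by positivity
      have h2 : (0 : ℝ) < n := by exact_mod_cast hn2
      nlinarith [mul_pos h1 h2]
    have hlimE : Tendsto (fun N => ∫ x in E N, g x ∂ν) atTop (𝓝 (∫ x in ⋃ N, E N, g x ∂ν)) :=
      tendsto_setIntegral_of_monotone hEm hEmono hgi.integrableOn
    have h1 : 0 ≤ ∫ x in ⋃ N, E N, g x ∂ν :=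
      ge_of_tendsto' hlimE fun N => maximal_ergodic hT hgm hgi N
    have h2 : ∫ x in ⋃ N, E N, g x ∂ν = ∫ x in A, (h x - ε / 2) ∂ν := by
      rw [setIntegral_indicator hAm, inter_eq_right.2 hAE]
    rw [h2, integral_sub hhi.integrableOn (integrable_const _), setIntegral_const,
      integral_sub hfi.integrableOn hΓi.integrableOn, hcond A hAm hAinv, sub_self, smul_eq_mul] at h1
    have h3 : ν.real A ≤ 0 := by nlinarith
    have h4 : ν.real A = 0 := le_antisymm h3 measureReal_nonneg
    rwa [measureReal_eq_zero_iff] at h4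
  have hae : ∀ᵐ x ∂ν, x ∉ A := by rw [ae_iff]; simpa using hA0
  filter_upwards [hae] with x hx
  simp only [A, mem_setOf_eq, not_exists, not_frequently] at hx
  filter_upwards [hx 0] with n hn
  rw [hSh] at hn
  have : ε / 2 + ε / ((0 : ℕ) + 3) ≤ ε := by push_cast; linarith
  have h3 := mul_le_mul_of_nonneg_right this (Nat.cast_nonneg (α := ℝ) n)
  linarith [not_lt.1 hn]

/-- Birkhoff's pointwise ergodic theorem. -/
theorem birkhoff [IsProbabilityMeasure ν] {T : Y → Y} (hT : MeasurePreserving T ν ν)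
    {f : Y → ℝ} (hf : Measurable f) (hfi : Integrable f ν) :
    ∃ Γ : Y → ℝ, Measurable Γ ∧ Integrable Γ ν ∧ (∀ x, Γ (T x) = Γ x) ∧
      ∫ x, Γ x ∂ν = ∫ x, f x ∂ν ∧
      ∀ᵐ x ∂ν, Tendsto (fun n : ℕ => birkhoffSum T f n x / n) atTop (𝓝 (Γ x)) := by
  have hle := MeasurableSpace.invariants_le T
  have hsm : StronglyMeasurable[MeasurableSpace.invariants T]
    (ν[f | MeasurableSpace.invariants T]) := stronglyMeasurable_condExp
  set Γ := ν[f | MeasurableSpace.invariants T] with hΓ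
  have hΓm : Measurable Γ := (hsm.mono hle).measurable
  have hinv : ∀ x, Γ (T x) = Γ x := fun x => congrFun
    (MeasurableSpace.comp_eq_of_measurable_invariants hsm.measurable) x
  have hΓi : Integrable Γ ν := integrable_condExp
  have hc : ∀ A, MeasurableSet A → T ⁻¹' A = A → ∫ x in A, f x ∂ν = ∫ x in A, Γ x ∂ν := by
    intro A hA hA'
    exact (setIntegral_condExp hle hfi (MeasurableSpace.measurableSet_invariants.2 ⟨hA, hA'⟩)).symm
  refine ⟨Γ, hΓm, hΓi, hinv, integral_condExp hle, ?_⟩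
  have hup : ∀ k : ℕ, ∀ᵐ x ∂ν, ∀ᶠ n : ℕ in atTop,
      birkhoffSum T f n x ≤ (Γ x + 1 / (k + 1)) * n := fun k =>
    birkhoff_upper hT hf hfi hΓm hΓi hinv hc (by positivity)
  have hlo : ∀ k : ℕ, ∀ᵐ x ∂ν, ∀ᶠ n : ℕ in atTop,
      birkhoffSum T (fun x => - f x) n x ≤ (- Γ x + 1 / (k + 1)) * n := fun k =>
    birkhoff_upper hT hf.neg hfi.neg hΓm.neg hΓi.neg (fun x => by simp [hinv])
      (fun A hA hA' => by
        show ∫ x in A, -f x ∂ν = ∫ x in A, -Γ x ∂ν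
        rw [integral_neg, integral_neg, hc A hA hA']) (by positivity)
  filter_upwards [ae_all_iff.2 hup, ae_all_iff.2 hlo] with x h1 h2
  rw [Metric.tendsto_atTop']
  intro ε hε
  obtain ⟨k, hk⟩ := exists_nat_one_div_lt hε
  have := ((h1 k).and (h2 k)).and (eventually_gt_atTop 0)
  obtain ⟨N, hN⟩ := eventually_atTop.1 this
  refine ⟨N, fun n hn => ?_⟩
  obtain ⟨⟨ha, hb⟩, h0⟩ := hN n hn.le
  have h0' : (0 : ℝ) < n := by exact_mod_cast h0
  have e : birkhoffSum T (fun x => - f x) n x = - birkhoffSum T f n x := by simp [birkhoffSum]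
  rw [e] at hb
  rw [Real.dist_eq, abs_lt]
  constructor
  · have : Γ x - 1 / (k + 1) ≤ birkhoffSum T f n x / n := by
      rw [le_div_iff₀ h0']; linarith
    linarith
  · have : birkhoffSum T f n x / n ≤ Γ x + 1 / (k + 1) := by
      rw [div_le_iff₀ h0']; linarith
    linarith

end birkhoff

end TPE

namespace TPE

section sys

variable {X : Type*} [MeasurableSpace X] {μ : Measure X} {p : ℕ} {T : X → X} {ρ : X → ℝ}

/-- A measure preserving system with base `p` digits. -/
structure Sys (μ : Measure X) (p : ℕ) (T : X → X) (ρ : X → ℝ) : Prop where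
  hp : 2 ≤ p
  mp : MeasurePreserving T μ μ
  meas : Measurable ρ
  nonneg : ∀ x, 0 ≤ ρ x
  lt_one : ∀ x, ρ x < 1
  step : ∀ x, ∃ d : ℕ, (p : ℝ) * ρ x = d + ρ (T x)

/-- The first `k` base-`p` digits, as a natural number. -/
noncomputable def D (p : ℕ) (ρ : X → ℝ) (k : ℕ) (x : X) : ℕ := ⌊(p : ℝ) ^ k * ρ x⌋₊

namespace Sys


lemma pos (h : Sys μ p T ρ) : (0 : ℝ) < p := by have := h.hp; positivity

lemma mpi (h : Sys μ p T ρ) (k : ℕ) : MeasurePreserving (T^[k]) μ μ := h.mp.iterate k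

lemma floor_eq (h : Sys μ p T ρ) {t : ℝ} {d : ℕ} {x : X} (hd : t = d + ρ x) : ⌊t⌋₊ = d := by
  rw [hd, Nat.floor_eq_iff (by have := h.nonneg x; positivity)]
  exact ⟨by linarith [h.nonneg x], by linarith [h.lt_one x]⟩

lemma D_eq (h : Sys μ p T ρ) (k : ℕ) (x : X) : (p : ℝ) ^ k * ρ x = D p ρ k x + ρ (T^[k] x) := by
  have : ∃ d : ℕ, (p : ℝ) ^ k * ρ x = d + ρ (T^[k] x) := by
    induction k with
    | zero => exact ⟨0, by simp⟩
    | succ k ih =>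
      obtain ⟨d, hd⟩ := ih
      obtain ⟨e, he⟩ := h.step (T^[k] x)
      refine ⟨p * d + e, ?_⟩
      rw [Function.iterate_succ_apply', pow_succ', mul_assoc, hd, mul_add, he]
      push_cast; ring
  obtain ⟨d, hd⟩ := this
  rw [hd]
  unfold D
  rw [h.floor_eq hd]

lemma D_add (h : Sys μ p T ρ) (k l : ℕ) (x : X) : D p ρ (k + l) x = D p ρ k x * p ^ l + D p ρ l (T^[k] x) := by
  have h1 := h.D_eq k x
  have h2 := h.D_eq l (T^[k] x)
  rw [← Function.iterate_add_apply] at h2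
  apply h.floor_eq (x := T^[l + k] x)
  rw [pow_add]
  push_cast
  linear_combination (p : ℝ) ^ l * h1 + h2

lemma D_lt (h : Sys μ p T ρ) (k : ℕ) (x : X) : D p ρ k x < p ^ k := by
  unfold D
  rw [Nat.floor_lt (by have := h.nonneg x; positivity)]
  push_cast
  have := h.lt_one x
  have h2 : (0 : ℝ) < (p : ℝ) ^ k := pow_pos h.pos k
  nlinarith

lemma D_meas (h : Sys μ p T ρ) (k : ℕ) : Measurable (D p ρ k) :=
  Nat.measurable_floor.comp (h.meas.const_mul _)

lemma DT_meas (h : Sys μ p T ρ) (k j : ℕ) : Measurable (fun x => D p ρ k (T^[j] x)) :=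
  (h.D_meas k).comp (h.mpi j).measurable

lemma D_zero (h : Sys μ p T ρ) (x : X) : D p ρ 0 x = 0 := by have := h.D_lt 0 x; simpa using this

lemma D_div (h : Sys μ p T ρ) (k l : ℕ) (x : X) : D p ρ k x = D p ρ (k + l) x / p ^ l := by
  have hpp : 0 < p ^ l := by have := h.hp; positivity
  rw [h.D_add, mul_comm, Nat.mul_add_div hpp, Nat.div_eq_of_lt (h.D_lt l _), add_zero]

lemma D_mod (h : Sys μ p T ρ) (k l : ℕ) (x : X) : D p ρ l (T^[k] x) = D p ρ (k + l) x % p ^ l := by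
  rw [h.D_add, Nat.add_mod, Nat.mul_mod_left, zero_add, Nat.mod_mod, Nat.mod_eq_of_lt (h.D_lt l _)]

lemma D_factor (h : Sys μ p T ρ) {j l K : ℕ} (hj : j ≤ l) (hl : l ≤ K) :
    ∃ φ : ℕ → ℕ, ∀ x, D p ρ j (T^[K - j] x) = φ (D p ρ l (T^[K - l] x)) := by
  refine ⟨fun n => n % p ^ j, fun x => ?_⟩
  have := h.D_mod (l - j) j (T^[K - l] x)
  rw [← Function.iterate_add_apply] at this
  rw [show l - j + (K - l) = K - j by omega, show l - j + j = l by omega] at this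
  exact this

lemma rho_close (h : Sys μ p T ρ) {k : ℕ} {x y : X} (hxy : D p ρ k x = D p ρ k y) :
    |ρ x - ρ y| ≤ ((p : ℝ) ^ k)⁻¹ := by
  have h1 := h.D_eq k x
  have h2 := h.D_eq k y
  rw [hxy] at h1
  have hpk : (0 : ℝ) < (p : ℝ) ^ k := pow_pos h.pos k
  rw [← one_div, le_div_iff₀ hpk]
  have h3 : (ρ x - ρ y) * (p : ℝ) ^ k = ρ (T^[k] x) - ρ (T^[k] y) := by linear_combination h1 - h2
  rw [← abs_of_pos hpk, ← abs_mul, h3, abs_le]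
  have := h.nonneg (T^[k] x); have := h.nonneg (T^[k] y)
  have := h.lt_one (T^[k] x); have := h.lt_one (T^[k] y)
  constructor <;> linarith

end Sys

end sys

/-- cell weights -/
noncomputable def w {X : Type*} [MeasurableSpace X] (μ : Measure X) (p : ℕ) (ρ : X → ℝ)
    (k j : ℕ) : ℝ := μ.real (D p ρ k ⁻¹' {j})

/-- ratio of weights of cells -/
noncomputable def ra {X : Type*} [MeasurableSpace X] (μ : Measure X) (p : ℕ) (ρ : X → ℝ)
    (k l : ℕ) (x : X) : ℝ := w μ p ρ (k + l) (D p ρ (k + l) x) / w μ p ρ k (D p ρ k x)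

/-- indicator of a digit block -/
noncomputable def fd {X : Type*} (p : ℕ) (ρ : X → ℝ) (T : X → X)
    (k l d : ℕ) (x : X) : ℝ := if D p ρ l (T^[k] x) = d then 1 else 0

section sys2
variable {X : Type*} [MeasurableSpace X] {μ : Measure X} [IsProbabilityMeasure μ]
  {p : ℕ} {T : X → X} {ρ : X → ℝ}

namespace Sys


lemma w_nonneg (k j : ℕ) : 0 ≤ w μ p ρ k j := measureReal_nonneg


lemma w_pos (h : Sys μ p T ρ) (k : ℕ) : ∀ᵐ x ∂μ, 0 < w μ p ρ k (D p ρ k x) := by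
  have : ∀ᵐ x ∂μ, ∀ j : ℕ, w μ p ρ k j = 0 → D p ρ k x ≠ j := by
    rw [ae_all_iff]
    intro j
    by_cases hj : w μ p ρ k j = 0
    · have h0 : μ (D p ρ k ⁻¹' {j}) = 0 := by
        unfold w at hj
        rwa [measureReal_eq_zero_iff] at hj
      rw [ae_iff]
      refine measure_mono_null (fun x hx => ?_) h0
      simp only [mem_setOf_eq, ne_eq, Classical.not_imp, not_not] at hx
      exact hx.2
    · simp [hj]
  filter_upwards [this] with x hx
  rcases (w_nonneg (μ := μ) (p := p) (ρ := ρ) k (D p ρ k x)).lt_or_eq with h1 | h1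
  · exact h1
  · exact absurd rfl (hx _ h1.symm)

lemma w_mono (h : Sys μ p T ρ) (k l : ℕ) (x : X) :
    w μ p ρ (k + l) (D p ρ (k + l) x) ≤ w μ p ρ k (D p ρ k x) := by
  unfold w
  refine measureReal_mono fun y hy => ?_
  have hy' : D p ρ (k + l) y = D p ρ (k + l) x := hy
  show D p ρ k y = D p ρ k x
  rw [h.D_div k l y, h.D_div k l x, hy']

lemma ra_nonneg (k l : ℕ) (x : X) : 0 ≤ ra μ p ρ k l x :=
  div_nonneg (w_nonneg _ _) (w_nonneg _ _)

lemma ra_le_one (h : Sys μ p T ρ) (k l : ℕ) (x : X) : ra μ p ρ k l x ≤ 1 :=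
  div_le_one_of_le₀ (h.w_mono k l x) (w_nonneg _ _)

lemma ra_meas (h : Sys μ p T ρ) (k l : ℕ) : Measurable (ra μ p ρ k l) :=
  ((measurable_of_countable (w μ p ρ (k + l))).comp (h.D_meas _)).div
    ((measurable_of_countable (w μ p ρ k)).comp (h.D_meas _))

lemma ra_int (h : Sys μ p T ρ) (k l : ℕ) : Integrable (ra μ p ρ k l) μ :=
  integrable_of_bdd (h.ra_meas k l).aestronglyMeasurable (C := 1) fun x => by
    rw [Real.norm_of_nonneg (ra_nonneg k l x)]; exact h.ra_le_one k l x

lemma ra_succ (h : Sys μ p T ρ) (k l : ℕ) : ∀ᵐ x ∂μ, ra μ p ρ k (l + 1) x = ra μ p ρ k l x * ra μ p ρ (k + l) 1 x := by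
  filter_upwards [h.w_pos (k + l)] with x hx
  unfold ra
  rw [← add_assoc]
  field_simp

lemma ra_prod (h : Sys μ p T ρ) (k : ℕ) : ∀ᵐ x ∂μ, ∀ l, ra μ p ρ k l x = ∏ j ∈ Finset.range l, ra μ p ρ (k + j) 1 x := by
  filter_upwards [ae_all_iff.2 (h.ra_succ k), h.w_pos k] with x hx hx0 l
  induction l with
  | zero => simp [ra, hx0.ne']
  | succ l ih => rw [hx, ih, Finset.prod_range_succ]

lemma fd_meas (h : Sys μ p T ρ) (k l d : ℕ) : Measurable (fd p ρ T k l d) :=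
  (measurable_of_countable (fun j : ℕ => if j = d then (1 : ℝ) else 0)).comp (h.DT_meas l k)

lemma fd_bd (k l d : ℕ) (x : X) : ‖fd p ρ T k l d x‖ ≤ 1 := by
  unfold fd; split_ifs <;> simp

lemma fd_nonneg (k l d : ℕ) (x : X) : 0 ≤ fd p ρ T k l d x := by
  unfold fd; split_ifs <;> simp

/-- The ratio is an average of an indicator. -/
lemma avg_fd (h : Sys μ p T ρ) (k l : ℕ) (x : X) :
    avg μ (D p ρ k) (fd p ρ T k l (D p ρ l (T^[k] x))) x = ra μ p ρ k l x := by
  unfold avg ra w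
  rw [div_eq_inv_mul, smul_eq_mul]
  congr 1
  have h1 : ∀ y, fd p ρ T k l (D p ρ l (T^[k] x)) y =
      ((fun y => D p ρ l (T^[k] y)) ⁻¹' {D p ρ l (T^[k] x)}).indicator (fun _ => (1 : ℝ)) y := by
    intro y
    unfold fd indicator
    simp
  simp_rw [h1]
  have hm := h.DT_meas l k (measurableSet_singleton (D p ρ l (T^[k] x)))
  rw [integral_indicator hm, Measure.restrict_restrict hm, setIntegral_const, smul_eq_mul, mul_one]
  congr 1
  ext y
  simp only [mem_inter_iff, mem_preimage, mem_singleton_iff]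
  constructor
  · rintro ⟨h1, h2⟩
    rw [h.D_add, h.D_add, h1, h2]
  · intro h1
    rw [h.D_mod, h.D_mod, h.D_div k l y, h.D_div k l x, h1]
    exact ⟨rfl, rfl⟩

/-- `fd` sums to select one term. -/
lemma sum_fd_mul (h : Sys μ p T ρ) (k l : ℕ) (g : ℕ → ℝ) (x : X) :
    ∑ d ∈ Finset.range (p ^ l), fd p ρ T k l d x * g d = g (D p ρ l (T^[k] x)) := by
  unfold fd
  simp only [ite_mul, one_mul, zero_mul]
  rw [Finset.sum_ite_eq, if_pos (Finset.mem_range.2 (h.D_lt l _))]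

lemma DT_comp (h : Sys μ p T ρ) (k r : ℕ) (hrk : r ≤ k) (x : X) : T^[r] (T^[k - r] x) = T^[k] x := by
  rw [← Function.iterate_add_apply, show r + (k - r) = k by omega]

/-- E a = sum of squared norms of averages. -/
lemma integral_ra (h : Sys μ p T ρ) (k l : ℕ) : ∫ x, ra μ p ρ k l x ∂μ =
    ∑ d ∈ Finset.range (p ^ l), ∫ x, ‖avg μ (D p ρ k) (fd p ρ T k l d) x‖ ^ 2 ∂μ := by
  classical
  have h1 : ∀ x, ra μ p ρ k l x = ∑ d ∈ Finset.range (p ^ l),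
      fd p ρ T k l d x * avg μ (D p ρ k) (fd p ρ T k l d) x := by
    intro x
    rw [h.sum_fd_mul k l (fun d => avg μ (D p ρ k) (fd p ρ T k l d) x) x, h.avg_fd]
  simp_rw [h1]
  have hb : ∀ d x, ‖avg μ (D p ρ k) (fd p ρ T k l d) x‖ ≤ 1 := fun d x =>
    norm_avg_le _ zero_le_one (fd_bd k l d) x
  rw [integral_finsetSum]
  · refine Finset.sum_congr rfl fun d _ => ?_
    have h2 := integral_avg_mul (μ := μ) (h.D_meas k) (h.fd_meas k l d) (fd_bd k l d)
      (g := fun j => if j ∈ range (D p ρ k) then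
        ((μ.real (D p ρ k ⁻¹' {j}))⁻¹ : ℝ) • ∫ y in D p ρ k ⁻¹' {j}, fd p ρ T k l d y ∂μ else 0)
      (C' := 1) (by
        intro j
        split_ifs with hj
        · obtain ⟨x, rfl⟩ := hj
          exact hb d x
        · simp)
    simp only [mem_range_self, if_true] at h2
    have h3 : ∫ x, fd p ρ T k l d x * avg μ (D p ρ k) (fd p ρ T k l d) x ∂μ =
      ∫ x, avg μ (D p ρ k) (fd p ρ T k l d) x * avg μ (D p ρ k) (fd p ρ T k l d) x ∂μ := h2.symm
    rw [h3]
    congr 1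
    ext x
    rw [Real.norm_eq_abs, sq_abs, sq]
  · intro d _
    refine integrable_of_bdd (C := 1 * 1) ((h.fd_meas k l d).mul
      (measurable_avg (h.D_meas k) _)).aestronglyMeasurable fun x => ?_
    rw [norm_mul]
    exact mul_le_mul (fd_bd k l d x) (hb d x) (norm_nonneg _) zero_le_one

lemma fd_comp (h : Sys μ p T ρ) {r k : ℕ} (hrk : r ≤ k) (l d : ℕ) (y : X) :
    fd p ρ T r l d (T^[k - r] y) = fd p ρ T k l d y := by
  unfold fd
  rw [h.DT_comp k r hrk]

lemma avg_fd_shift (h : Sys μ p T ρ) {r k : ℕ} (hrk : r ≤ k) (l d : ℕ) (x : X) :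
    avg μ (D p ρ r) (fd p ρ T r l d) (T^[k - r] x) =
      avg μ (fun y => D p ρ r (T^[k - r] y)) (fd p ρ T k l d) x := by
  rw [← avg_comp (h.mpi (k - r)) (h.D_meas r) (h.fd_meas r l d)]
  simp_rw [h.fd_comp hrk]

/-- L2 comparison -/
lemma integral_ra_sub_sq (h : Sys μ p T ρ) {r k : ℕ} (hrk : r ≤ k) (l : ℕ) :
    ∫ x, (ra μ p ρ k l x - ra μ p ρ r l (T^[k - r] x)) ^ 2 ∂μ ≤
      ∫ x, ra μ p ρ k l x ∂μ - ∫ x, ra μ p ρ r l x ∂μ := by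
  obtain ⟨φ, hφ⟩ := h.D_factor (j := r) (l := k) (K := k) hrk le_rfl
  simp only [Nat.sub_self, Function.iterate_zero, id_eq] at hφ
  have hdm := h.DT_meas r (k - r)
  have key : ∀ d, ∫ x, ‖avg μ (D p ρ k) (fd p ρ T k l d) x
      - avg μ (fun y => D p ρ r (T^[k - r] y)) (fd p ρ T k l d) x‖ ^ 2 ∂μ =
      ∫ x, ‖avg μ (D p ρ k) (fd p ρ T k l d) x‖ ^ 2 ∂μ
      - ∫ x, ‖avg μ (D p ρ r) (fd p ρ T r l d) x‖ ^ 2 ∂μ := by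
    intro d
    rw [integral_norm_sub_sq (h.D_meas k) hdm hφ (h.fd_meas k l d) (fd_bd k l d)]
    congr 1
    simp_rw [← h.avg_fd_shift hrk]
    exact integral_comp_mp (h.mpi (k - r)) (F := fun x => ‖avg μ (D p ρ r) (fd p ρ T r l d) x‖ ^ 2)
      ((measurable_avg (h.D_meas r) _).norm.pow_const 2).aestronglyMeasurable
  rw [h.integral_ra, h.integral_ra, ← Finset.sum_sub_distrib]
  simp_rw [← key]
  rw [← integral_finsetSum]
  · refine integral_mono_of_nonneg (ae_of_all _ fun x => sq_nonneg _) ?_ (ae_of_all _ fun x => ?_)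
    · refine integrable_finsetSum _ fun d _ => ?_
      refine integrable_of_bdd (C := 2 ^ 2) (((measurable_avg (h.D_meas k) _).sub
        (measurable_avg hdm _)).norm.pow_const 2).aestronglyMeasurable fun x => ?_
      rw [norm_pow, norm_norm]
      refine pow_le_pow_left₀ (norm_nonneg _) ?_ 2
      refine (norm_sub_le _ _).trans ?_
      have := norm_avg_le (μ := μ) (D p ρ k) zero_le_one (fd_bd (T := T) (p := p) (ρ := ρ) k l d) x
      have := norm_avg_le (μ := μ) (fun y => D p ρ r (T^[k - r] y)) zero_le_one
        (fd_bd (T := T) (p := p) (ρ := ρ) k l d) x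
      linarith
    · have e1 : ra μ p ρ r l (T^[k - r] x) = avg μ (fun y => D p ρ r (T^[k - r] y))
          (fd p ρ T k l (D p ρ l (T^[k] x))) x := by
        rw [← h.avg_fd, h.DT_comp k r hrk, h.avg_fd_shift hrk]
      beta_reduce
      rw [← h.avg_fd, e1]
      have := Finset.single_le_sum (f := fun d => ‖avg μ (D p ρ k) (fd p ρ T k l d) x
        - avg μ (fun y => D p ρ r (T^[k - r] y)) (fd p ρ T k l d) x‖ ^ 2)
        (s := Finset.range (p ^ l)) (fun d _ => by positivity)
        (Finset.mem_range.2 (h.D_lt l (T^[k] x)))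
      refine le_trans ?_ this
      beta_reduce
      rw [Real.norm_eq_abs, sq_abs]
  · intro d _
    refine integrable_of_bdd (C := 2 ^ 2) (((measurable_avg (h.D_meas k) _).sub
        (measurable_avg hdm _)).norm.pow_const 2).aestronglyMeasurable fun x => ?_
    rw [norm_pow, norm_norm]
    refine pow_le_pow_left₀ (norm_nonneg _) ?_ 2
    refine (norm_sub_le _ _).trans ?_
    have := norm_avg_le (μ := μ) (D p ρ k) zero_le_one (fd_bd (T := T) (p := p) (ρ := ρ) k l d) x
    have := norm_avg_le (μ := μ) (fun y => D p ρ r (T^[k - r] y)) zero_le_one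
        (fd_bd (T := T) (p := p) (ρ := ρ) k l d) x
    linarith

lemma integral_ra_mono (h : Sys μ p T ρ) {r k : ℕ} (hrk : r ≤ k) (l : ℕ) :
    ∫ x, ra μ p ρ r l x ∂μ ≤ ∫ x, ra μ p ρ k l x ∂μ := by
  have := h.integral_ra_sub_sq hrk l
  have h2 : 0 ≤ ∫ x, (ra μ p ρ k l x - ra μ p ρ r l (T^[k - r] x)) ^ 2 ∂μ :=
    integral_nonneg fun x => sq_nonneg _
  linarith

lemma integral_ra_le_one (h : Sys μ p T ρ) (k l : ℕ) : ∫ x, ra μ p ρ k l x ∂μ ≤ 1 := by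
  have := integral_mono (h.ra_int k l) (integrable_const (1 : ℝ)) (h.ra_le_one k l)
  simpa using this

end Sys
end sys2
end TPE

namespace TPE

lemma sum_div_range (p : ℕ) (hp : 0 < p) (F : ℕ → ℝ) (n : ℕ) :
    ∑ j ∈ Finset.range (n * p), F (j / p) = p * ∑ i ∈ Finset.range n, F i := by
  induction n with
  | zero => simp
  | succ n ih =>
    rw [Nat.succ_mul, Finset.sum_range_add, ih, Finset.sum_range_succ, mul_add]
    congr 1
    rw [Finset.sum_congr rfl (g := fun _ => F n)]
    · simp
    · intro x hx
      rw [mul_comm, Nat.mul_add_div hp, Nat.div_eq_of_lt (Finset.mem_range.1 hx), add_zero]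

lemma neg_log_le {x η : ℝ} (hx : 0 < x) (hx1 : x ≤ 1) (hη : 0 < η) :
    - Real.log x ≤ (1 - x) / η + η * x⁻¹ := by
  obtain ⟨s, hs, rfl⟩ : ∃ s, 0 < s ∧ x = s ^ 2 :=
    ⟨√x, Real.sqrt_pos.2 hx, (Real.sq_sqrt hx.le).symm⟩
  have hs1 : s ≤ 1 := by nlinarith
  have h1 : - Real.log (s ^ 2) = 2 * Real.log s⁻¹ := by
    rw [Real.log_pow, Real.log_inv]; push_cast; ring
  have h2 : Real.log s⁻¹ ≤ s⁻¹ - 1 := Real.log_le_sub_one_of_pos (by positivity)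
  have h3 : (1 - s) ^ 2 / η ≤ (1 - s ^ 2) / η := by
    gcongr; nlinarith
  have h4 : 0 ≤ ((1 - s) - η * s⁻¹) ^ 2 / η := by positivity
  have h5 : ((1 - s) - η * s⁻¹) ^ 2 / η = (1 - s) ^ 2 / η - 2 * (s⁻¹ - 1) + η * (s ^ 2)⁻¹ := by
    field_simp
    ring
  rw [h1]
  linarith

section sys2
variable {X : Type*} [MeasurableSpace X] {μ : Measure X} [IsProbabilityMeasure μ]
  {p : ℕ} {T : X → X} {ρ : X → ℝ}

namespace Sys


lemma integrable_D (h : Sys μ p T ρ) (k : ℕ) (g : ℕ → ℝ) : Integrable (fun x => g (D p ρ k x)) μ :=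
  integrable_of_bdd (C := ∑ j ∈ Finset.range (p ^ k), ‖g j‖)
    ((measurable_of_countable g).comp (h.D_meas k)).aestronglyMeasurable fun x =>
    Finset.single_le_sum (f := fun j => ‖g j‖) (fun j _ => norm_nonneg _)
      (Finset.mem_range.2 (h.D_lt k x))

lemma integral_D (h : Sys μ p T ρ) (k : ℕ) (g : ℕ → ℝ) :
    ∫ x, g (D p ρ k x) ∂μ = ∑ j ∈ Finset.range (p ^ k), w μ p ρ k j * g j := by
  have h1 : ∀ x, g (D p ρ k x) = ∑ j ∈ Finset.range (p ^ k),
      (D p ρ k ⁻¹' {j}).indicator (fun _ => g j) x := by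
    intro x
    simp only [indicator, mem_preimage, mem_singleton_iff]
    rw [Finset.sum_ite_eq, if_pos (Finset.mem_range.2 (h.D_lt k x))]
  simp_rw [h1]
  have hm : ∀ j, MeasurableSet (D p ρ k ⁻¹' {j}) := fun j => h.D_meas k (measurableSet_singleton j)
  rw [integral_finsetSum _ fun j _ => (integrable_const _).indicator (hm j)]
  refine Finset.sum_congr rfl fun j _ => ?_
  rw [integral_indicator_const _ (hm j)]
  rfl

lemma sum_w (h : Sys μ p T ρ) (k : ℕ) : ∑ j ∈ Finset.range (p ^ k), w μ p ρ k j = 1 := by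
  have := h.integral_D k (fun _ => 1)
  simpa using this.symm

lemma inv_ra (h : Sys μ p T ρ) (k : ℕ) : Integrable (fun x => (ra μ p ρ k 1 x)⁻¹) μ ∧
    ∫ x, (ra μ p ρ k 1 x)⁻¹ ∂μ ≤ p := by
  have hp0 : 0 < p := by have := h.hp; omega
  have h1 : ∀ x, (ra μ p ρ k 1 x)⁻¹ =
      (fun j => w μ p ρ k (j / p) / w μ p ρ (k + 1) j) (D p ρ (k + 1) x) := by
    intro x
    unfold ra
    have := h.D_div k 1 x
    rw [pow_one] at this
    rw [inv_div, this]
  simp_rw [h1]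
  refine ⟨h.integrable_D (k + 1) (fun j => w μ p ρ k (j / p) / w μ p ρ (k + 1) j), ?_⟩
  rw [h.integral_D (k + 1) (fun j => w μ p ρ k (j / p) / w μ p ρ (k + 1) j)]
  calc ∑ j ∈ Finset.range (p ^ (k + 1)), w μ p ρ (k + 1) j * (w μ p ρ k (j / p) / w μ p ρ (k + 1) j)
      ≤ ∑ j ∈ Finset.range (p ^ (k + 1)), w μ p ρ k (j / p) := by
        refine Finset.sum_le_sum fun j _ => ?_
        rcases eq_or_ne (w μ p ρ (k + 1) j) 0 with h0 | h0
        · rw [h0, zero_mul]; exact w_nonneg _ _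
        · rw [mul_div_cancel₀ _ h0]
    _ = p := by
        rw [pow_succ, sum_div_range p hp0, h.sum_w, mul_one]

lemma exists_q (h : Sys μ p T ρ) {c : ℝ} (hc : 0 < c)
    (hd : ∀ᵐ x ∂μ, ∀ᶠ n : ℕ in atTop, w μ p ρ n (D p ρ n x) ≤ Real.exp (-c * n)) :
    ∃ q < 1, ∀ k, ∫ x, ra μ p ρ k 1 x ∂μ ≤ q := by
  by_contra hcon
  push Not at hcon
  have hp0 := h.pos
  set η : ℝ := c / (8 * p) with hη
  have hη0 : 0 < η := by positivity
  obtain ⟨k0, hk0⟩ := hcon (1 - η * c / 8) (by have : 0 < η * c / 8 := by positivity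
                                               linarith)
  set Z : ℕ → X → ℝ := fun k x => (1 - ra μ p ρ k 1 x) / η + η * (ra μ p ρ k 1 x)⁻¹ with hZ
  have hZ0 : ∀ k x, 0 ≤ Z k x := fun k x => by
    have h1 := h.ra_le_one k 1 x
    have h2 := ra_nonneg (μ := μ) (p := p) (ρ := ρ) k 1 x
    have : 0 ≤ 1 - ra μ p ρ k 1 x := by linarith
    simp only [hZ]; positivity
  have i1 : ∀ k, Integrable (fun x => (1 - ra μ p ρ k 1 x) / η) μ := fun k =>
    ((integrable_const _).sub (h.ra_int k 1)).div_const _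
  have hZi : ∀ k, Integrable (Z k) μ := fun k => (i1 k).add ((h.inv_ra k).1.const_mul _)
  have hZE : ∀ k, ∫ x, Z k x ∂μ ≤ (1 - ∫ x, ra μ p ρ k 1 x ∂μ) / η + η * p := by
    intro k
    simp only [hZ]
    rw [integral_add (i1 k) ((h.inv_ra k).1.const_mul _), integral_div, integral_const_mul,
      integral_sub (integrable_const _) (h.ra_int k 1)]
    simp only [integral_const, probReal_univ, smul_eq_mul, mul_one]
    have := (h.inv_ra k).2
    gcongr
  have hηp : η * p = c / 8 := by rw [hη]; field_simp
  have hZ1 : ∀ k, k0 ≤ k → ∫ x, Z k x ∂μ ≤ c / 4 := by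
    intro k hk
    refine (hZE k).trans ?_
    have := h.integral_ra_mono hk 1
    have h2 : (1 - ∫ x, ra μ p ρ k 1 x ∂μ) / η ≤ c / 8 := by
      rw [div_le_iff₀ hη0]; linarith
    linarith
  set B : ℝ := 1 / η + c / 8 with hB
  have hB0 : 0 < B := by positivity
  have hZ2 : ∀ k, ∫ x, Z k x ∂μ ≤ B := by
    intro k
    refine (hZE k).trans ?_
    have : 0 ≤ ∫ x, ra μ p ρ k 1 x ∂μ := integral_nonneg fun x => ra_nonneg _ _ _
    rw [hηp, hB]
    gcongr
    linarith
  have hsum : ∀ n : ℕ, ∑ k ∈ Finset.range n, ∫ x, Z k x ∂μ ≤ k0 * B + n * (c / 4) := by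
    intro n
    calc ∑ k ∈ Finset.range n, ∫ x, Z k x ∂μ
        ≤ ∑ k ∈ Finset.range n, ((if k ∈ Finset.range k0 then B else 0) + c / 4) := by
          refine Finset.sum_le_sum fun k _ => ?_
          split_ifs with hk
          · have := hZ2 k; linarith
          · have := hZ1 k (by simpa using hk); linarith
      _ ≤ _ := by
          rw [Finset.sum_add_distrib, Finset.sum_ite_mem, Finset.sum_const, Finset.sum_const,
            Finset.card_range, nsmul_eq_mul, nsmul_eq_mul]
          have : (Finset.range n ∩ Finset.range k0).card ≤ k0 :=
            (Finset.card_le_card Finset.inter_subset_right).trans (by simp)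
          gcongr
  -- indicators
  set I : ℕ → X → ℝ := fun n x => if w μ p ρ n (D p ρ n x) ≤ Real.exp (-c * n) then 1 else 0 with hI
  have hIm : ∀ n, Measurable (I n) := fun n =>
    (measurable_of_countable (fun j => if w μ p ρ n j ≤ Real.exp (-c * n) then (1 : ℝ) else 0)).comp
      (h.D_meas n)
  have hIb : ∀ n x, ‖I n x‖ ≤ 1 := fun n x => by simp only [hI]; split_ifs <;> simp
  have hlim : Tendsto (fun n => ∫ x, I n x ∂μ) atTop (𝓝 (∫ _, (1 : ℝ) ∂μ)) := by
    refine tendsto_integral_of_dominated_convergence (fun _ => (1 : ℝ))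
      (fun n => (hIm n).aestronglyMeasurable) (integrable_const _) (fun n => ae_of_all _ (hIb n)) ?_
    filter_upwards [hd] with x hx
    refine tendsto_const_nhds.congr' ?_
    filter_upwards [hx] with n hn
    simp only [hI]
    rw [if_pos hn]
  simp only [integral_const, probReal_univ, smul_eq_mul, mul_one] at hlim
  have hkey : ∀ n : ℕ, c * n * ∫ x, I n x ∂μ ≤ k0 * B + n * (c / 4) := by
    intro n
    refine le_trans ?_ (hsum n)
    rw [← integral_finsetSum _ fun k _ => hZi k, ← integral_const_mul]
    refine integral_mono_ae ((integrable_of_bdd (hIm n).aestronglyMeasurable (hIb n)).const_mul _)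
      (integrable_finsetSum _ fun k _ => hZi k) ?_
    filter_upwards [h.ra_prod 0, ae_all_iff.2 h.w_pos] with x hx hx0
    by_cases hn : w μ p ρ n (D p ρ n x) ≤ Real.exp (-c * n)
    · simp only [hI]
      rw [if_pos hn, mul_one]
      have e1 : ra μ p ρ 0 n x = w μ p ρ n (D p ρ n x) := by
        unfold ra
        have : w μ p ρ 0 (D p ρ 0 x) = 1 := by
          rw [h.D_zero]
          unfold w
          have : D p ρ 0 ⁻¹' {0} = univ := by
            ext y; simp [h.D_zero]
          rw [this, probReal_univ]
        rw [this, div_one, zero_add]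
      have hap : ∀ k, 0 < ra μ p ρ k 1 x := fun k => div_pos (hx0 _) (hx0 _)
      have e2 : Real.log (w μ p ρ n (D p ρ n x)) ≤ -c * n := by
        rw [← Real.log_exp (-c * n)]
        exact Real.log_le_log (hx0 n) hn
      rw [← e1, hx n, Real.log_prod (fun k _ => (hap _).ne')] at e2
      have e3 : ∑ k ∈ Finset.range n, - Real.log (ra μ p ρ (0 + k) 1 x)
          ≤ ∑ k ∈ Finset.range n, Z k x := by
        refine Finset.sum_le_sum fun k _ => ?_
        rw [zero_add]
        exact neg_log_le (hap k) (h.ra_le_one k 1 x) hη0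
      rw [Finset.sum_neg_distrib] at e3
      linarith
    · simp only [hI]
      rw [if_neg hn, mul_zero]
      exact Finset.sum_nonneg fun k _ => hZ0 k x
  have h1 : ∀ᶠ n : ℕ in atTop, (3 / 4 : ℝ) < ∫ x, I n x ∂μ :=
    hlim.eventually (lt_mem_nhds (by norm_num))
  have h2 : ∀ᶠ n : ℕ in atTop, k0 * B / (c / 2) < (n : ℝ) :=
    tendsto_natCast_atTop_atTop.eventually (eventually_gt_atTop _)
  obtain ⟨n, hn1, hn2⟩ := (h1.and h2).exists
  have h3 := hkey n
  rw [div_lt_iff₀ (by positivity)] at hn2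
  have hn0 : (0 : ℝ) ≤ n := by positivity
  have : c * n * (3 / 4) ≤ c * n * ∫ x, I n x ∂μ := by gcongr
  nlinarith

end Sys
end sys2
end TPE

namespace TPE

lemma measurable_birkhoffSum {Y : Type*} [MeasurableSpace Y] {T : Y → Y} (hT : Measurable T)
    {f : Y → ℝ} (hf : Measurable f) (n : ℕ) : Measurable (birkhoffSum T f n) := by
  unfold birkhoffSum
  exact Finset.measurable_sum _ fun i _ => hf.comp (hT.iterate i)

lemma norm_birkhoffSum_le {Y : Type*} {T : Y → Y}
    {f : Y → ℝ} {C : ℝ} (hf : ∀ x, ‖f x‖ ≤ C) (n : ℕ) (x : Y) : ‖birkhoffSum T f n x‖ ≤ n * C := by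
  unfold birkhoffSum
  refine (norm_sum_le_of_le _ (fun i _ => hf _)).trans ?_
  simp

/-- `L¹` mean ergodic theorem for bounded functions. -/
lemma mean_ergodic {X : Type*} [MeasurableSpace X] {μ : Measure X} [IsProbabilityMeasure μ]
    {T : X → X} (hT : Ergodic T μ) {f : X → ℝ} (hf : Measurable f) {C : ℝ} (hC : ∀ x, ‖f x‖ ≤ C) :
    Tendsto (fun n : ℕ => ∫ x, |birkhoffSum T f n x / n - ∫ y, f y ∂μ| ∂μ) atTop (𝓝 0) := by
  obtain ⟨Γ, hΓm, hΓi, hinv, hintg, hlim⟩ := birkhoff hT.toMeasurePreserving hf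
    (integrable_of_bdd hf.aestronglyMeasurable hC)
  obtain ⟨c, hc⟩ := hT.toPreErgodic.ae_eq_const_of_ae_eq_comp hΓm (funext hinv)
  have hc2 : c = ∫ y, f y ∂μ := by
    rw [← hintg, integral_congr_ae hc]; simp
  have := tendsto_integral_of_dominated_convergence (μ := μ)
    (F := fun (n : ℕ) x => |birkhoffSum T f n x / n - ∫ y, f y ∂μ|) (f := fun _ => (0 : ℝ))
    (fun _ => C + |∫ y, f y ∂μ|) ?_ (integrable_const _) ?_ ?_
  · simpa using this
  · intro n
    exact ((((measurable_birkhoffSum hT.measurable hf n).div_const _).sub_const _).norm).aestronglyMeasurable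
  · intro n
    refine ae_of_all _ fun x => ?_
    rw [Real.norm_eq_abs, abs_abs]
    refine (abs_sub _ _).trans ?_
    gcongr
    rw [abs_div, Nat.abs_cast]
    have hC0 : 0 ≤ C := (norm_nonneg _).trans (hC x)
    refine div_le_of_le_mul₀ (by positivity) hC0 ?_
    rw [mul_comm]
    exact norm_birkhoffSum_le hC n x
  · filter_upwards [hlim, hc] with x hx hcx
    rw [hcx] at hx
    have h2 := (hx.sub_const (∫ y, f y ∂μ)).abs
    simp only [Function.const_apply, hc2, sub_self, abs_zero] at h2
    exact h2

section sys2
variable {X : Type*} [MeasurableSpace X] {μ : Measure X} [IsProbabilityMeasure μ]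
  {p : ℕ} {T : X → X} {ρ : X → ℝ}

lemma exp_bound {l : ℕ} (hl : 0 < l) {a : ℕ → ℝ} (ha1 : ∀ j, a j ≤ 1) (ha0 : ∀ j, 0 ≤ a j)
    {q m : ℝ} (hq : q < 1) (hm : m ≤ q) :
    ∏ j ∈ Finset.range l, a j ≤ Real.exp (-(l * ((1 - q) / 2))) +
      2 / (l * (1 - q)) * |∑ j ∈ Finset.range l, a j - l * m| := by
  have hl' : (0 : ℝ) < l := by exact_mod_cast hl
  have hδ : 0 < 1 - q := by linarith
  have h1 : ∏ j ∈ Finset.range l, a j ≤ Real.exp (∑ j ∈ Finset.range l, (a j - 1)) := by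
    rw [Real.exp_sum]
    refine Finset.prod_le_prod (fun j _ => ha0 j) fun j _ => ?_
    have := Real.add_one_le_exp (a j - 1)
    linarith
  rw [Finset.sum_sub_distrib] at h1
  simp only [Finset.sum_const, Finset.card_range, nsmul_eq_mul, mul_one] at h1
  set S := ∑ j ∈ Finset.range l, a j with hS
  by_cases hc : S - l ≤ -(l * ((1 - q) / 2))
  · have := Real.exp_le_exp.2 hc
    have h2 : 0 ≤ 2 / (l * (1 - q)) * |S - l * m| := by positivity
    linarith
  · push Not at hc
    have h3 : l * (1 - q) / 2 ≤ |S - l * m| := by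
      refine le_trans ?_ (le_abs_self _)
      nlinarith
    have h4 : 1 ≤ 2 / (l * (1 - q)) * |S - l * m| := by
      rw [div_mul_eq_mul_div, le_div_iff₀ (by positivity)]
      linarith
    have h5 : ∏ j ∈ Finset.range l, a j ≤ 1 := Finset.prod_le_one (fun j _ => ha0 j) fun j _ => ha1 j
    have := Real.exp_pos (-(l * ((1 - q) / 2)))
    linarith

namespace Sys


lemma coll (h : Sys μ p T ρ) (herg : Ergodic T μ) {q : ℝ} (hq : q < 1) (hq' : ∀ k, ∫ x, ra μ p ρ k 1 x ∂μ ≤ q)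
    {ε : ℝ} (hε : 0 < ε) : ∃ l, ∀ k, ∫ x, ra μ p ρ k l x ∂μ ≤ ε := by
  have hδ : 0 < 1 - q := by linarith
  set t : ℝ := ε * (1 - q) / 16 with ht
  have ht0 : 0 < t := by positivity
  -- choose r
  obtain ⟨r, hr⟩ : ∃ r, ∀ k, r ≤ k → ∫ x, ra μ p ρ k 1 x ∂μ - ∫ x, ra μ p ρ r 1 x ∂μ ≤ t ^ 2 := by
    have hbdd : BddAbove (range fun k => ∫ x, ra μ p ρ k 1 x ∂μ) := ⟨q, by
      rintro _ ⟨k, rfl⟩; exact hq' k⟩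
    obtain ⟨r, hr⟩ := exists_lt_of_lt_ciSup (f := fun k => ∫ x, ra μ p ρ k 1 x ∂μ)
      (b := (⨆ k, ∫ x, ra μ p ρ k 1 x ∂μ) - t ^ 2) (by have := sq_pos_of_pos ht0; linarith)
    refine ⟨r, fun k _ => ?_⟩
    have : ∫ x, ra μ p ρ k 1 x ∂μ ≤ _ := le_ciSup hbdd k
    linarith
  set f := ra μ p ρ r 1 with hf
  have hfb : ∀ x, ‖f x‖ ≤ 1 := fun x => by
    rw [Real.norm_of_nonneg (ra_nonneg _ _ _)]; exact h.ra_le_one _ _ _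
  set m := ∫ x, f x ∂μ with hm
  have e1 : ∀ᶠ l : ℕ in atTop, ∫ x, |birkhoffSum T f l x / l - m| ∂μ < ε * (1 - q) / 8 :=
    (mean_ergodic herg (h.ra_meas r 1) hfb).eventually (gt_mem_nhds (by positivity))
  have e2 : ∀ᶠ l : ℕ in atTop, Real.exp (-(l * ((1 - q) / 2))) < ε / 2 := by
    have : Tendsto (fun l : ℕ => Real.exp (-(l * ((1 - q) / 2)))) atTop (𝓝 0) :=
      Real.tendsto_exp_neg_atTop_nhds_zero.comp
        (tendsto_natCast_atTop_atTop.atTop_mul_const (by positivity))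
    exact this.eventually (gt_mem_nhds (by positivity))
  obtain ⟨l, ⟨hl1, hl2⟩, hl0⟩ := ((e1.and e2).and (eventually_gt_atTop 0)).exists
  have hl0' : (0 : ℝ) < l := by exact_mod_cast hl0
  refine ⟨l, ?_⟩
  suffices H : ∀ k, r ≤ k → ∫ x, ra μ p ρ k l x ∂μ ≤ ε by
    intro k
    rcases le_total r k with hk | hk
    · exact H k hk
    · exact (h.integral_ra_mono hk l).trans (H r le_rfl)
  intro k hk
  have hmeas1 : ∀ j, Measurable fun x => ra μ p ρ (k + j) 1 x - f (T^[k + j - r] x) := fun j =>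
    (h.ra_meas (k + j) 1).sub ((h.ra_meas r 1).comp (h.mpi _).measurable)
  have hb1 : ∀ j x, |ra μ p ρ (k + j) 1 x - f (T^[k + j - r] x)| ≤ 2 := by
    intro j x
    refine (abs_sub _ _).trans ?_
    have h1 := hfb (T^[k + j - r] x)
    rw [Real.norm_eq_abs] at h1
    rw [abs_of_nonneg (ra_nonneg (k + j) 1 x)]
    linarith [h.ra_le_one (k + j) 1 x]
  have hi1 : ∀ j, Integrable (fun x => |ra μ p ρ (k + j) 1 x - f (T^[k + j - r] x)|) μ := fun j =>
    integrable_of_bdd (C := 2) (hmeas1 j).norm.aestronglyMeasurable fun x => by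
      rw [Real.norm_eq_abs, abs_abs]; exact hb1 j x
  have hi2 : ∀ j, Integrable (fun x => (ra μ p ρ (k + j) 1 x - f (T^[k + j - r] x)) ^ 2) μ := fun j =>
    integrable_of_bdd (C := 2 ^ 2) ((hmeas1 j).pow_const 2).aestronglyMeasurable fun x => by
      rw [norm_pow, Real.norm_eq_abs]; exact pow_le_pow_left₀ (abs_nonneg _) (hb1 j x) 2
  have hE1 : ∀ j, ∫ x, |ra μ p ρ (k + j) 1 x - f (T^[k + j - r] x)| ∂μ ≤ 2 * t := by
    intro j
    have h1 := h.integral_ra_sub_sq (r := r) (k := k + j) (by omega) 1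
    have h2 := hr (k + j) (by omega)
    calc ∫ x, |ra μ p ρ (k + j) 1 x - f (T^[k + j - r] x)| ∂μ
        ≤ ∫ x, (t + (ra μ p ρ (k + j) 1 x - f (T^[k + j - r] x)) ^ 2 / t) ∂μ := by
          refine integral_mono (hi1 j) ((integrable_const _).add ((hi2 j).div_const _)) fun x => ?_
          set z := ra μ p ρ (k + j) 1 x - f (T^[k + j - r] x)
          show |z| ≤ t + z ^ 2 / t
          rw [← sq_abs z, ← sub_nonneg]
          have : t + |z| ^ 2 / t - |z| = ((t - |z|) ^ 2 + t * |z|) / t := by field_simp; ring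
          rw [this]; positivity
      _ ≤ 2 * t := by
          rw [integral_add (integrable_const _) ((hi2 j).div_const _), integral_const, integral_div,
            probReal_univ, one_smul]
          have : (∫ x, (ra μ p ρ (k + j) 1 x - f (T^[k + j - r] x)) ^ 2 ∂μ) / t ≤ t := by
            rw [div_le_iff₀ ht0]; nlinarith
          linarith
  have hbm := measurable_birkhoffSum herg.measurable (h.ra_meas r 1) l
  have hi3 : Integrable (fun x => |birkhoffSum T f l x / l - m|) μ :=
    integrable_of_bdd (C := 1 + |m|) ((hbm.div_const _).sub_const _).norm.aestronglyMeasurable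
      fun x => by
        rw [Real.norm_eq_abs, abs_abs]
        refine (abs_sub _ _).trans ?_
        gcongr
        rw [abs_div, Nat.abs_cast, div_le_one hl0']
        have := norm_birkhoffSum_le (T := T) hfb l x
        simpa using this
  have hi3' : Integrable (fun x => |birkhoffSum T f l (T^[k - r] x) / l - m|) μ :=
    (h.mpi (k - r)).integrable_comp_of_integrable hi3
  have hE3 : ∫ x, |birkhoffSum T f l (T^[k - r] x) / l - m| ∂μ < ε * (1 - q) / 8 := by
    rw [integral_comp_mp (h.mpi (k - r)) (F := fun x => |birkhoffSum T f l x / l - m|)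
      hi3.aestronglyMeasurable]
    exact hl1
  have hmain : ∀ᵐ x ∂μ, ra μ p ρ k l x ≤ Real.exp (-(l * ((1 - q) / 2))) +
      2 / (l * (1 - q)) * (∑ j ∈ Finset.range l, |ra μ p ρ (k + j) 1 x - f (T^[k + j - r] x)| +
        l * |birkhoffSum T f l (T^[k - r] x) / l - m|) := by
    filter_upwards [h.ra_prod k] with x hx
    rw [hx l]
    refine (exp_bound hl0 (fun j => h.ra_le_one (k + j) 1 x) (fun j => ra_nonneg (k + j) 1 x) hq
      (hq' r)).trans ?_
    gcongr
    have : ∑ j ∈ Finset.range l, ra μ p ρ (k + j) 1 x - l * ∫ x, ra μ p ρ r 1 x ∂μ =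
        ∑ j ∈ Finset.range l, (ra μ p ρ (k + j) 1 x - f (T^[k + j - r] x)) +
        l * (birkhoffSum T f l (T^[k - r] x) / l - m) := by
      rw [mul_sub, mul_div_cancel₀ _ hl0'.ne', Finset.sum_sub_distrib]
      unfold birkhoffSum
      have : ∀ j, f (T^[j] (T^[k - r] x)) = f (T^[k + j - r] x) := fun j => by
        rw [← Function.iterate_add_apply, show j + (k - r) = k + j - r by omega]
      simp_rw [this]
      ring
    rw [this]
    refine (abs_add_le _ _).trans ?_
    rw [abs_mul, Nat.abs_cast]
    gcongr
    exact Finset.abs_sum_le_sum_abs _ _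
  have hisum : Integrable (fun x => ∑ j ∈ Finset.range l,
      |ra μ p ρ (k + j) 1 x - f (T^[k + j - r] x)|) μ := integrable_finsetSum _ fun j _ => hi1 j
  have hadd : Integrable (fun x => ∑ j ∈ Finset.range l, |ra μ p ρ (k + j) 1 x - f (T^[k + j - r] x)|
      + l * |birkhoffSum T f l (T^[k - r] x) / l - m|) μ := hisum.add (hi3'.const_mul _)
  have hfin := integral_mono_ae (h.ra_int k l)
    (g := fun x => Real.exp (-(l * ((1 - q) / 2))) +
      2 / (l * (1 - q)) * (∑ j ∈ Finset.range l, |ra μ p ρ (k + j) 1 x - f (T^[k + j - r] x)| +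
        l * |birkhoffSum T f l (T^[k - r] x) / l - m|))
    ((integrable_const _).add (hadd.const_mul _)) hmain
  refine hfin.trans ?_
  rw [integral_add (integrable_const _) (hadd.const_mul _),
    integral_const_mul, integral_add hisum (hi3'.const_mul _), integral_const_mul,
    integral_finsetSum _ fun j _ => hi1 j]
  simp only [integral_const, probReal_univ, smul_eq_mul, one_mul]
  have hs : ∑ j ∈ Finset.range l, ∫ x, |ra μ p ρ (k + j) 1 x - f (T^[k + j - r] x)| ∂μ
      ≤ l * (2 * t) := by
    refine (Finset.sum_le_sum fun j _ => hE1 j).trans ?_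
    simp
  have : 2 / (l * (1 - q)) * (∑ j ∈ Finset.range l,
      ∫ x, |ra μ p ρ (k + j) 1 x - f (T^[k + j - r] x)| ∂μ +
      l * ∫ x, |birkhoffSum T f l (T^[k - r] x) / l - m| ∂μ) ≤
      2 / (l * (1 - q)) * (l * (2 * t) + l * (ε * (1 - q) / 8)) := by
    gcongr
  have h5 : 2 / (l * (1 - q)) * (l * (2 * t) + l * (ε * (1 - q) / 8)) = ε / 2 := by
    rw [ht]; field_simp; ring
  linarith

end Sys
end sys2
end TPE

namespace TPE

/-- `e(t) = exp(2πit)` -/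
noncomputable def ee (t : ℝ) : ℂ := Complex.exp (2 * Real.pi * t * Complex.I)

lemma norm_ee (t : ℝ) : ‖ee t‖ = 1 := by
  unfold ee
  have : (2 * Real.pi * t * Complex.I : ℂ) = ((2 * Real.pi * t : ℝ) : ℂ) * Complex.I := by push_cast; ring
  rw [this, Complex.norm_exp_ofReal_mul_I]

lemma ee_add (s t : ℝ) : ee (s + t) = ee s * ee t := by
  unfold ee; rw [← Complex.exp_add]; congr 1; push_cast; ring

lemma ee_neg (t : ℝ) : ee (-t) = (starRingEnd ℂ) (ee t) := by
  unfold ee; rw [← Complex.exp_conj]; congr 1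
  simp only [map_mul, Complex.conj_ofReal, Complex.conj_I, map_ofNat]
  push_cast; ring

lemma ee_nat (n : ℕ) : ee n = 1 := by
  unfold ee
  rw [show (2 * Real.pi * ((n : ℝ) : ℂ) * Complex.I : ℂ) = n * (2 * Real.pi * Complex.I) by push_cast; ring]
  exact Complex.exp_nat_mul_two_pi_mul_I n

lemma ee_int (n : ℤ) : ee n = 1 := by
  unfold ee
  rw [show (2 * Real.pi * ((n : ℝ) : ℂ) * Complex.I : ℂ) = n * (2 * Real.pi * Complex.I) by push_cast; ring]
  exact Complex.exp_int_mul_two_pi_mul_I n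

lemma ee_zero : ee 0 = 1 := by unfold ee; simp

lemma hasDerivAt_ee (t : ℝ) : HasDerivAt ee (2 * Real.pi * Complex.I * ee t) t := by
  unfold ee
  have h1 : HasDerivAt (fun t : ℝ => (2 * Real.pi * t * Complex.I : ℂ)) (2 * Real.pi * 1 * Complex.I) t :=
    ((Complex.ofRealCLM.hasDerivAt (x := t)).const_mul (2 * Real.pi : ℂ)).mul_const Complex.I
  convert h1.cexp using 1
  ring

lemma continuous_ee : Continuous ee := by unfold ee; fun_prop

lemma ee_lip (s t : ℝ) : ‖ee s - ee t‖ ≤ 2 * Real.pi * |s - t| := by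
  have := Convex.norm_image_sub_le_of_norm_hasDerivWithin_le (f := ee)
    (f' := fun t => 2 * Real.pi * Complex.I * ee t) (C := 2 * Real.pi) (s := univ) (x := t) (y := s)
    (fun x _ => (hasDerivAt_ee x).hasDerivWithinAt) (fun x _ => by
      rw [norm_mul, norm_ee]; simp [abs_of_pos Real.pi_pos]) convex_univ (mem_univ _) (mem_univ _)
  simpa using this

lemma osc {p : ℕ} (hp : 2 ≤ p) {B : ℝ} (hB : B ≠ 0) :
    ‖∫ τ in (0 : ℝ)..1, ee (B * (p : ℝ) ^ τ)‖ ≤ (2 / Real.log p + 1) / |B| := by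
  have hp0 : (0 : ℝ) < p := by positivity
  have hlog : 0 < Real.log p := Real.log_pos (by exact_mod_cast hp)
  set L := Real.log p with hL
  have hpow : ∀ τ : ℝ, HasDerivAt (fun τ : ℝ => (p : ℝ) ^ τ) (L * (p : ℝ) ^ τ) τ := fun τ => by
    have := (hasDerivAt_id τ).const_rpow hp0
    simpa [mul_comm, mul_assoc] using this
  have hpowc : Continuous fun τ : ℝ => (p : ℝ) ^ τ := 
    continuous_iff_continuousAt.2 fun τ => (hpow τ).continuousAt
  have hpne : ∀ τ : ℝ, ((p : ℝ) ^ τ) ≠ 0 := fun τ => (Real.rpow_pos_of_pos hp0 τ).ne'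
  set G : ℝ → ℂ := fun τ => ee (B * (p : ℝ) ^ τ) with hG
  have hGc : Continuous G := continuous_ee.comp (continuous_const.mul hpowc)
  set R : ℝ → ℝ := fun τ => ((p : ℝ) ^ τ)⁻¹ with hR
  have hRc : Continuous R := hpowc.inv₀ hpne
  have hGd : ∀ τ, HasDerivAt G ((B * (L * (p : ℝ) ^ τ)) • (2 * Real.pi * Complex.I * G τ)) τ := fun τ => by
    exact HasDerivAt.scomp τ (hasDerivAt_ee (B * (p : ℝ) ^ τ)) ((hpow τ).const_mul B)
  have hRd : ∀ τ, HasDerivAt R (-L * R τ) τ := fun τ => by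
    have : HasDerivAt R _ τ := (hpow τ).inv (hpne τ)
    refine this.congr_deriv ?_
    show _ = -L * ((p : ℝ) ^ τ)⁻¹
    have := hpne τ
    field_simp
  have hF : ∀ τ, HasDerivAt (fun τ => R τ • G τ)
      (-(L : ℂ) * (R τ • G τ) + (2 * Real.pi * Complex.I * B * L) * G τ) τ := fun τ => by
    have : HasDerivAt (fun τ => R τ • G τ) _ τ := (hRd τ).smul (hGd τ)
    refine this.congr_deriv (Eq.symm ?_)
    show -(L : ℂ) * (((p : ℝ) ^ τ)⁻¹ • G τ) + (2 * Real.pi * Complex.I * B * L) * G τ = ((p : ℝ) ^ τ)⁻¹ • ((B * (L * (p : ℝ) ^ τ)) • (2 * Real.pi * Complex.I * G τ)) + (-L * ((p : ℝ) ^ τ)⁻¹) • G τ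
    simp only [Complex.real_smul]
    have h1 : (((p : ℝ) ^ τ : ℝ) : ℂ) ≠ 0 := by exact_mod_cast hpne τ
    push_cast
    field_simp
    ring
  have hFc : Continuous fun τ => R τ • G τ := hRc.smul hGc
  have hintg := intervalIntegral.integral_eq_sub_of_hasDerivAt (a := 0) (b := 1)
    (fun τ _ => hF τ) (Continuous.intervalIntegrable (by fun_prop) _ _)
  rw [intervalIntegral.integral_add (Continuous.intervalIntegrable (by fun_prop) _ _)
    (Continuous.intervalIntegrable (by fun_prop) _ _), intervalIntegral.integral_const_mul,
    intervalIntegral.integral_const_mul] at hintg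
  have hRle : ∀ τ : ℝ, 0 ≤ τ → ‖R τ • G τ‖ ≤ 1 := fun τ hτ => by
    rw [norm_smul, hG, norm_ee, mul_one, hR, Real.norm_of_nonneg (by positivity)]
    refine inv_le_one_of_one_le₀ (Real.one_le_rpow (by exact_mod_cast (by omega : 1 ≤ p)) hτ)
  have hi : ‖∫ τ in (0 : ℝ)..1, R τ • G τ‖ ≤ 1 := by
    have := intervalIntegral.norm_integral_le_of_norm_le_const (a := 0) (b := 1) (C := 1)
      (f := fun τ => R τ • G τ) (fun τ hτ => hRle τ (by
        rw [uIoc_of_le zero_le_one] at hτ; exact hτ.1.le))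
    simpa using this
  have heq : (2 * Real.pi * Complex.I * B * L) * ∫ τ in (0 : ℝ)..1, G τ =
      R 1 • G 1 - R 0 • G 0 + L * ∫ τ in (0 : ℝ)..1, R τ • G τ := by
    linear_combination hintg
  have hn := congrArg norm heq
  have hle : ‖R 1 • G 1 - R 0 • G 0 + L * ∫ τ in (0 : ℝ)..1, R τ • G τ‖ ≤ 2 + L := by
    refine (norm_add_le _ _).trans ?_
    have h1 := norm_sub_le (R 1 • G 1) (R 0 • G 0)
    have h2 := hRle 1 zero_le_one
    have h3 := hRle 0 le_rfl
    rw [norm_mul, Complex.norm_real, Real.norm_of_nonneg hlog.le]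
    nlinarith
  rw [← heq] at hle
  simp only [norm_mul, Complex.norm_real, Complex.norm_I, mul_one, Real.norm_eq_abs,
    abs_of_pos Real.pi_pos, abs_of_pos hlog, Complex.norm_ofNat] at hle
  have hBp : 0 < |B| := abs_pos.2 hB
  rw [le_div_iff₀ hBp]
  set N := ‖∫ τ in (0 : ℝ)..1, G τ‖ with hN
  have hN0 : 0 ≤ N := norm_nonneg _
  have h6 : N * |B| * L ≤ 2 + L := by
    refine le_trans ?_ hle
    have h3 : (1 : ℝ) ≤ 2 * Real.pi := by linarith [Real.pi_gt_three]
    have : 0 ≤ N * |B| * L := by positivity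
    nlinarith
  have h7 : 2 / L + 1 = (2 + L) / L := by field_simp
  rw [h7, le_div_iff₀ hlog]
  exact h6

lemma osc_le_one {p : ℕ} (B : ℝ) :
    ‖∫ τ in (0 : ℝ)..1, ee (B * (p : ℝ) ^ τ)‖ ≤ 1 := by
  have := intervalIntegral.norm_integral_le_of_norm_le_const (a := 0) (b := 1) (C := 1)
      (f := fun τ : ℝ => ee (B * (p : ℝ) ^ τ)) (fun τ hτ => (norm_ee _).le)
  simpa using this

end TPE

namespace TPE

lemma measurable_ee : Measurable ee := continuous_ee.measurable

lemma measurable_prpow (p : ℕ) (hp : 2 ≤ p) : Measurable fun τ : ℝ => (p : ℝ) ^ τ := by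
  have hp0 : (0 : ℝ) < p := by positivity
  exact (Real.continuous_const_rpow hp0.ne').measurable

lemma four_meas {X : Type*} [MeasurableSpace X] (ν : Measure X) [IsFiniteMeasure ν] {g : X → ℝ}
    (hg : Measurable g) {p : ℕ} (hp : 2 ≤ p) {A δ : ℝ} (hA : A ≠ 0) (hδ : 0 < δ) :
    ∫ τ in (0 : ℝ)..1, ‖∫ y, ee (A * (p : ℝ) ^ τ * g y) ∂ν‖ ^ 2 ≤
      (2 / Real.log p + 1) / (|A| * δ) * ν.real univ ^ 2 +
        (ν.prod ν).real {z | |g z.1 - g z.2| < δ} := by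
  have hlog : 0 < Real.log p := Real.log_pos (by exact_mod_cast hp)
  have hpm := measurable_prpow p hp
  set C := (2 / Real.log p + 1) / (|A| * δ) with hC
  have hC0 : 0 ≤ C := by positivity
  have hsq : ∀ τ : ℝ, ((‖∫ y, ee (A * (p : ℝ) ^ τ * g y) ∂ν‖ ^ 2 : ℝ) : ℂ) =
      ∫ z, ee (A * (g z.1 - g z.2) * (p : ℝ) ^ τ) ∂(ν.prod ν) := by
    intro τ
    have h1 : ∀ z : X × X, ee (A * (g z.1 - g z.2) * (p : ℝ) ^ τ) =
        ee (A * (p : ℝ) ^ τ * g z.1) * (starRingEnd ℂ) (ee (A * (p : ℝ) ^ τ * g z.2)) := by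
      intro z
      rw [← ee_neg, ← ee_add]
      congr 1; ring
    simp_rw [h1]
    rw [integral_prod_mul (fun y => ee (A * (p : ℝ) ^ τ * g y))
      (fun y => (starRingEnd ℂ) (ee (A * (p : ℝ) ^ τ * g y))), integral_conj, Complex.mul_conj,
      Complex.normSq_eq_norm_sq]
  have hKm : Measurable fun q : ℝ × (X × X) => ee (A * (g q.2.1 - g q.2.2) * (p : ℝ) ^ q.1) := by
    refine measurable_ee.comp ?_
    refine Measurable.mul ?_ (hpm.comp measurable_fst)
    exact ((hg.comp (measurable_fst.comp measurable_snd)).sub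
      (hg.comp (measurable_snd.comp measurable_snd))).const_mul A
  have hswap : ((∫ τ in (0 : ℝ)..1, ‖∫ y, ee (A * (p : ℝ) ^ τ * g y) ∂ν‖ ^ 2 : ℝ) : ℂ) =
      ∫ z, (∫ τ in (0 : ℝ)..1, ee (A * (g z.1 - g z.2) * (p : ℝ) ^ τ)) ∂(ν.prod ν) := by
    rw [← intervalIntegral.integral_ofReal]
    simp_rw [hsq, intervalIntegral.integral_of_le zero_le_one]
    refine integral_integral_swap (f := fun (τ : ℝ) (z : X × X) => ee (A * (g z.1 - g z.2) * (p : ℝ) ^ τ)) ?_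
    exact integrable_of_bdd (C := 1) hKm.aestronglyMeasurable fun q => (norm_ee _).le
  have hreal : ∫ τ in (0 : ℝ)..1, ‖∫ y, ee (A * (p : ℝ) ^ τ * g y) ∂ν‖ ^ 2 =
      ‖((∫ τ in (0 : ℝ)..1, ‖∫ y, ee (A * (p : ℝ) ^ τ * g y) ∂ν‖ ^ 2 : ℝ) : ℂ)‖ := by
    rw [Complex.norm_real, Real.norm_of_nonneg]
    exact intervalIntegral.integral_nonneg zero_le_one fun τ _ => by positivity
  rw [hreal, hswap]
  have hS : MeasurableSet {z : X × X | |g z.1 - g z.2| < δ} :=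
    measurableSet_lt ((hg.comp measurable_fst).sub (hg.comp measurable_snd)).abs measurable_const
  refine (norm_integral_le_of_norm_le (g := fun z => C + {z : X × X | |g z.1 - g z.2| < δ}.indicator
    (fun _ => (1 : ℝ)) z) ((integrable_const _).add ((integrable_const _).indicator hS)) ?_).trans ?_
  · refine ae_of_all _ fun z => ?_
    by_cases hz : z ∈ {z : X × X | |g z.1 - g z.2| < δ}
    · rw [indicator_of_mem hz]
      have := osc_le_one (p := p) (A * (g z.1 - g z.2))
      linarith
    · rw [indicator_of_notMem hz, add_zero]
      have hz' : δ ≤ |g z.1 - g z.2| := not_lt.1 hz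
      have hne : g z.1 - g z.2 ≠ 0 := fun h0 => by rw [h0, abs_zero] at hz'; linarith
      refine (osc hp (mul_ne_zero hA hne)).trans ?_
      rw [hC, abs_mul]
      gcongr
  · rw [integral_add (integrable_const _) ((integrable_const _).indicator hS),
      integral_indicator_const _ hS, integral_const]
    have : (ν.prod ν).real univ = ν.real univ ^ 2 := by
      rw [← univ_prod_univ, measureReal_prod_prod, sq]
    rw [this]
    simp [mul_comm]

/-- near-diagonal estimate -/
lemma near_diag {X : Type*} [MeasurableSpace X] (ν : Measure X) [IsFiniteMeasure ν] {b : X → ℕ}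
    (P : ℕ) (hP : ∀ x, b x < P) :
    (ν.prod ν).real {z | b z.1 ≤ b z.2 + 1 ∧ b z.2 ≤ b z.1 + 1} ≤
      3 * ∑ d ∈ Finset.range P, ν.real (b ⁻¹' {d}) ^ 2 := by
  set v : ℕ → ℝ := fun d => ν.real (b ⁻¹' {d}) with hv
  have hv0 : ∀ d, 0 ≤ v d := fun d => measureReal_nonneg
  have hsub : {z : X × X | b z.1 ≤ b z.2 + 1 ∧ b z.2 ≤ b z.1 + 1} ⊆ ⋃ d ∈ Finset.range P,
      ((b ⁻¹' {d}) ×ˢ (b ⁻¹' {d}) ∪ (b ⁻¹' {d}) ×ˢ (b ⁻¹' {d + 1}) ∪ (b ⁻¹' {d + 1}) ×ˢ (b ⁻¹' {d})) := by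
    rintro ⟨y, z⟩ ⟨h1, h2⟩
    simp only at h1 h2
    simp only [mem_iUnion, Finset.mem_range, mem_union, mem_prod, mem_preimage, mem_singleton_iff, exists_prop]
    rcases lt_trichotomy (b y) (b z) with h3 | h3 | h3
    · exact ⟨b y, hP y, Or.inl (Or.inr ⟨rfl, by omega⟩)⟩
    · exact ⟨b y, hP y, Or.inl (Or.inl ⟨rfl, by omega⟩)⟩
    · exact ⟨b z, hP z, Or.inr ⟨by omega, rfl⟩⟩
  have hvP : v P = 0 := by
    have : b ⁻¹' {P} = ∅ := by
      ext x; simpa using (hP x).ne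
    simp only [hv]; rw [this]; simp
  have hshift : ∑ d ∈ Finset.range P, v (d + 1) ^ 2 ≤ ∑ d ∈ Finset.range P, v d ^ 2 := by
    have h1 := Finset.sum_range_succ (fun d => v d ^ 2) P
    have h2 := Finset.sum_range_succ' (fun d => v d ^ 2) P
    have := sq_nonneg (v 0)
    rw [hvP] at h1
    nlinarith
  calc (ν.prod ν).real {z | b z.1 ≤ b z.2 + 1 ∧ b z.2 ≤ b z.1 + 1}
      ≤ ∑ d ∈ Finset.range P, (v d * v d + v d * v (d + 1) + v (d + 1) * v d) := by
        refine (measureReal_mono hsub (measure_ne_top _ _)).trans ((measureReal_biUnion_finset_le _ _).trans ?_)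
        refine Finset.sum_le_sum fun d _ => ?_
        refine (measureReal_union_le _ _).trans ?_
        rw [measureReal_prod_prod]
        refine add_le_add ((measureReal_union_le _ _).trans ?_) le_rfl
        rw [measureReal_prod_prod, measureReal_prod_prod]
    _ ≤ ∑ d ∈ Finset.range P, (2 * v d ^ 2 + v (d + 1) ^ 2) := by
        refine Finset.sum_le_sum fun d _ => ?_
        nlinarith [sq_nonneg (v d - v (d + 1))]
    _ ≤ _ := by
        rw [Finset.sum_add_distrib, ← Finset.mul_sum]
        linarith

/-- Fourier transforms of cell measures. -/
noncomputable def cc {X : Type*} [MeasurableSpace X] (μ : Measure X) (p : ℕ) (T : X → X) (ρ : X → ℝ)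
    (k : ℕ) (s : ℝ) (x : X) : ℂ := avg μ (D p ρ k) (fun y => ee (s * ρ (T^[k] y))) x

section sys2
variable {X : Type*} [MeasurableSpace X] {μ : Measure X} [IsProbabilityMeasure μ]
  {p : ℕ} {T : X → X} {ρ : X → ℝ}

namespace Sys


lemma fourier_cell (h : Sys μ p T ρ) (k l : ℕ) {A : ℝ} (hA : A ≠ 0) (x : X) :
    ∫ τ in (0 : ℝ)..1, ‖cc μ p T ρ k (A * (p : ℝ) ^ τ) x‖ ^ 2 ≤
      (2 / Real.log p + 1) * (p : ℝ) ^ l / |A| +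
      3 * ∑ d ∈ Finset.range (p ^ l), ‖avg μ (D p ρ k) (fd p ρ T k l d) x‖ ^ 2 := by
  have hlog : 0 < Real.log p := Real.log_pos (by exact_mod_cast h.hp)
  have hp0 := h.pos
  set E := D p ρ k ⁻¹' {D p ρ k x} with hE
  set W := μ.real E with hW
  have hW0 : 0 ≤ W := measureReal_nonneg
  have hg : Measurable fun y => ρ (T^[k] y) := h.meas.comp (h.mpi k).measurable
  have hf := four_meas (μ.restrict E) hg h.hp hA (δ := ((p : ℝ) ^ l)⁻¹) (by positivity)
  have hn := near_diag (μ.restrict E) (b := fun y => D p ρ l (T^[k] y)) (p ^ l) (fun y => h.D_lt l _)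
  have hbv : ∀ d, (μ.restrict E).real ((fun y => D p ρ l (T^[k] y)) ⁻¹' {d}) =
      ∫ y in E, fd p ρ T k l d y ∂μ := by
    intro d
    have hm := h.DT_meas l k (measurableSet_singleton d)
    have h1 : ∀ y, fd p ρ T k l d y =
      ((fun y => D p ρ l (T^[k] y)) ⁻¹' {d}).indicator (fun _ => (1 : ℝ)) y := by
      intro y
      unfold fd indicator
      simp
    simp_rw [h1]
    rw [integral_indicator_const _ hm, smul_eq_mul, mul_one]
  simp_rw [hbv] at hn
  have hsub : {z : X × X | |ρ (T^[k] z.1) - ρ (T^[k] z.2)| < ((p : ℝ) ^ l)⁻¹} ⊆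
      {z | D p ρ l (T^[k] z.1) ≤ D p ρ l (T^[k] z.2) + 1 ∧
        D p ρ l (T^[k] z.2) ≤ D p ρ l (T^[k] z.1) + 1} := by
    rintro ⟨y, z⟩ hyz
    simp only [mem_setOf_eq] at hyz ⊢
    have hpl : (0 : ℝ) < (p : ℝ) ^ l := by positivity
    have key : ∀ u v : X, ρ u - ρ v < ((p : ℝ) ^ l)⁻¹ → D p ρ l u ≤ D p ρ l v + 1 := by
      intro u v huv
      have h1 := h.D_eq l u
      have h2 := h.D_eq l v
      have h3 := h.nonneg (T^[l] u)
      have h4 := h.lt_one (T^[l] v)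
      have h5 : (p : ℝ) ^ l * (ρ u - ρ v) < 1 := by
        calc (p : ℝ) ^ l * (ρ u - ρ v) < (p : ℝ) ^ l * ((p : ℝ) ^ l)⁻¹ := by gcongr
          _ = 1 := mul_inv_cancel₀ hpl.ne'
      have h6 : (D p ρ l u : ℝ) < D p ρ l v + 2 := by nlinarith
      have : D p ρ l u < D p ρ l v + 2 := by exact_mod_cast h6
      omega
    rw [abs_lt] at hyz
    exact ⟨key _ _ hyz.2, key _ _ (by linarith)⟩
  have hnear := (measureReal_mono (μ := (μ.restrict E).prod (μ.restrict E)) hsub).trans hn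
  have hWE : (μ.restrict E).real univ = W := by rw [measureReal_restrict_apply_univ]
  rw [hWE] at hf
  have hcc : ∀ τ : ℝ, ‖cc μ p T ρ k (A * (p : ℝ) ^ τ) x‖ ^ 2 =
      (W⁻¹) ^ 2 * ‖∫ y in E, ee (A * (p : ℝ) ^ τ * ρ (T^[k] y)) ∂μ‖ ^ 2 := by
    intro τ
    unfold cc avg
    rw [norm_smul, Real.norm_of_nonneg (inv_nonneg.2 measureReal_nonneg), mul_pow]
  simp_rw [hcc]
  rw [intervalIntegral.integral_const_mul]
  have havg : ∀ d, ‖avg μ (D p ρ k) (fd p ρ T k l d) x‖ ^ 2 =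
      (W⁻¹) ^ 2 * (∫ y in E, fd p ρ T k l d y ∂μ) ^ 2 := by
    intro d
    unfold avg
    rw [Real.norm_eq_abs, sq_abs, smul_eq_mul, mul_pow]
  simp_rw [havg]
  rw [← Finset.mul_sum]
  set C := (2 / Real.log p + 1) with hC
  have hC0 : 0 ≤ C := by positivity
  have h1 := mul_le_mul_of_nonneg_left (hf.trans (add_le_add le_rfl hnear)) (sq_nonneg W⁻¹)
  refine h1.trans ?_
  have h2 : C / (|A| * ((p : ℝ) ^ l)⁻¹) = C * (p : ℝ) ^ l / |A| := by
    have : |A| ≠ 0 := abs_ne_zero.2 hA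
    field_simp
  have h3 : (W⁻¹) ^ 2 * W ^ 2 ≤ 1 := by
    rcases hW0.lt_or_eq with h0 | h0
    · rw [← mul_pow, inv_mul_cancel₀ h0.ne']; simp
    · rw [← h0]; simp
  rw [h2]
  have h4 : 0 ≤ C * (p : ℝ) ^ l / |A| := by positivity
  nlinarith

end Sys
end sys2

end TPE

namespace TPE

set_option linter.unusedSectionVars false

/-- An abstract phase circle with rotation by `α`. -/
structure Ph {Θ : Type*} [MeasurableSpace Θ] (σ : Measure Θ) (rp : Θ → ℝ) (R : Θ → Θ) (α : ℝ) :
    Prop where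
  meas : Measurable rp
  nonneg : ∀ θ, 0 ≤ rp θ
  lt_one : ∀ θ, rp θ < 1
  erg : Ergodic R σ
  rot : ∀ θ, rp (R θ) = Int.fract (rp θ + α)
  map : ∀ F : ℝ → ℝ, ∫ θ, F (rp θ) ∂σ = ∫ τ in (0 : ℝ)..1, F τ

section sys3
variable {X : Type*} [MeasurableSpace X] {μ : Measure X} [IsProbabilityMeasure μ]
  {p : ℕ} {T : X → X} {ρ : X → ℝ} {Θ : Type*} [MeasurableSpace Θ] {σ : Measure Θ}
  [IsProbabilityMeasure σ] {rp : Θ → ℝ} {R : Θ → Θ} {α : ℝ}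

/-- averaged energy -/
noncomputable def qb {Θ : Type*} [MeasurableSpace Θ] (σ : Measure Θ) (rp : Θ → ℝ) {X : Type*} [MeasurableSpace X] (μ : Measure X) (p : ℕ) (T : X → X) (ρ : X → ℝ)
    (k : ℕ) (A : ℝ) : ℝ :=
  ∫ z : Θ × X, ‖cc μ p T ρ k (A * (p : ℝ) ^ (rp z.1)) z.2‖ ^ 2 ∂(σ.prod μ)

lemma cc_le (k : ℕ) (s : ℝ) (x : X) : ‖cc μ p T ρ k s x‖ ≤ 1 :=
  norm_avg_le _ zero_le_one (fun _ => (norm_ee _).le) x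

namespace Sys


lemma eer_meas (h : Sys μ p T ρ) (k : ℕ) (s : ℝ) : Measurable fun y => ee (s * ρ (T^[k] y)) :=
  measurable_ee.comp ((h.meas.comp (h.mpi k).measurable).const_mul s)

lemma cc_meas (h : Sys μ p T ρ) (k : ℕ) (s : ℝ) : Measurable (cc μ p T ρ k s) := measurable_avg (h.D_meas k) _

lemma cc_meas2 (h : Sys μ p T ρ) (k : ℕ) : Measurable fun q : ℝ × X => cc μ p T ρ k q.1 q.2 := by
  have h1 : ∀ j : ℕ, Measurable fun s : ℝ => ((μ.real (D p ρ k ⁻¹' {j}))⁻¹ : ℝ) •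
      ∫ y in D p ρ k ⁻¹' {j}, ee (s * ρ (T^[k] y)) ∂μ := by
    intro j
    have : Measurable fun q : ℝ × X => ee (q.1 * ρ (T^[k] q.2)) :=
      measurable_ee.comp (measurable_fst.mul ((h.meas.comp (h.mpi k).measurable).comp measurable_snd))
    have h3 : Measurable fun s : ℝ => ∫ y in D p ρ k ⁻¹' {j}, ee (s * ρ (T^[k] y)) ∂μ :=
      (this.stronglyMeasurable.integral_prod_right' (ν := μ.restrict (D p ρ k ⁻¹' {j}))).measurable
    exact h3.const_smul ((μ.real (D p ρ k ⁻¹' {j}))⁻¹ : ℝ)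
  have h2 : Measurable fun q : ℝ × ℕ => ((μ.real (D p ρ k ⁻¹' {q.2}))⁻¹ : ℝ) •
      ∫ y in D p ρ k ⁻¹' {q.2}, ee (q.1 * ρ (T^[k] y)) ∂μ :=
    measurable_from_prod_countable_left h1
  have h4 : Measurable fun q : ℝ × X => (q.1, D p ρ k q.2) :=
    measurable_fst.prodMk ((h.D_meas k).comp measurable_snd)
  have h5 := h2.comp h4
  have h6 : (fun q : ℝ × X => cc μ p T ρ k q.1 q.2) = ((fun q : ℝ × ℕ => ((μ.real (D p ρ k ⁻¹' {q.2}))⁻¹ : ℝ) •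
      ∫ y in D p ρ k ⁻¹' {q.2}, ee (q.1 * ρ (T^[k] y)) ∂μ) ∘ fun q : ℝ × X => (q.1, D p ρ k q.2)) := by
    funext q
    simp only [cc, avg, Function.comp_apply]
  rw [h6]
  exact h5

lemma sA_meas (h : Sys μ p T ρ) (H : Ph σ rp R α) (A : ℝ) : Measurable fun θ : Θ => A * (p : ℝ) ^ (rp θ) :=
  ((measurable_prpow p h.hp).comp H.meas).const_mul A

attribute [local irreducible] cc in
lemma ccA_meas (h : Sys μ p T ρ) (H : Ph σ rp R α) (k : ℕ) (A : ℝ) :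
    Measurable fun z : Θ × X => cc μ p T ρ k (A * (p : ℝ) ^ (rp z.1)) z.2 := by
  have h1 : Measurable fun z : Θ × X => A * (p : ℝ) ^ (rp z.1) :=
    (h.sA_meas H A).comp measurable_fst
  have h2 : Measurable fun z : Θ × X => (A * (p : ℝ) ^ (rp z.1), z.2) :=
    h1.prodMk measurable_snd
  exact Measurable.comp (g := fun q : ℝ × X => cc μ p T ρ k q.1 q.2) (h.cc_meas2 k) h2

lemma ccA_int (h : Sys μ p T ρ) (H : Ph σ rp R α) (k : ℕ) (A : ℝ) :
    Integrable (fun z : Θ × X => ‖cc μ p T ρ k (A * (p : ℝ) ^ (rp z.1)) z.2‖ ^ 2)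
      (σ.prod μ) := by
  refine integrable_of_bdd (C := 1) ((h.ccA_meas H k A).norm.pow_const 2).aestronglyMeasurable fun z => ?_
  rw [Real.norm_of_nonneg (by positivity)]
  exact pow_le_one₀ (norm_nonneg _) (cc_le _ _ _)

lemma qb_le_one (h : Sys μ p T ρ) (H : Ph σ rp R α) (k : ℕ) (A : ℝ) : qb σ rp μ p T ρ k A ≤ 1 := by
  have : qb σ rp μ p T ρ k A ≤ ∫ z : Θ × X, (1 : ℝ) ∂(σ.prod μ) :=
    integral_mono (h.ccA_int H k A) (integrable_const _) fun z => pow_le_one₀ (norm_nonneg _) (cc_le _ _ _)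
  rw [integral_const, probReal_univ] at this
  simpa using this

lemma qb_eq (h : Sys μ p T ρ) (H : Ph σ rp R α) (k : ℕ) (A : ℝ) : qb σ rp μ p T ρ k A =
    ∫ θ : Θ, ∫ x, ‖cc μ p T ρ k (A * (p : ℝ) ^ (rp θ)) x‖ ^ 2 ∂μ ∂σ :=
  integral_prod _ (h.ccA_int H k A)

lemma cc_shift (h : Sys μ p T ρ) {K l : ℕ} (hl : l ≤ K) (s : ℝ) (y : X) :
    cc μ p T ρ l s (T^[K - l] y) =
      avg μ (fun y => D p ρ l (T^[K - l] y)) (fun y => ee (s * ρ (T^[K] y))) y := by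
  unfold cc
  rw [← avg_comp (h.mpi (K - l)) (h.D_meas l) (h.eer_meas l s)]
  simp_rw [h.DT_comp K l hl]

/-- Maximal inequality. -/
lemma cc_max (h : Sys μ p T ρ) {K r : ℕ} (hr : r ≤ K) (s : ℝ) {c : ℝ} (hc : 0 ≤ c) :
    c ^ 2 * μ.real {y | ∃ l, r ≤ l ∧ l ≤ K ∧
        c ≤ ‖cc μ p T ρ l s (T^[K - l] y) - cc μ p T ρ r s (T^[K - r] y)‖}
      ≤ ∫ x, ‖cc μ p T ρ K s x‖ ^ 2 ∂μ - ∫ x, ‖cc μ p T ρ r s x‖ ^ 2 ∂μ := by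
  have key := kolmogorov (μ := μ) (d := fun l y => D p ρ l (T^[K - l] y)) (fun l => h.DT_meas l (K - l))
    (K := K) (fun j l hj hl => h.D_factor hj hl) (h.eer_meas K s) (fun y => (norm_ee _).le) hr hc
  have e1 : ∀ l ≤ K, ∀ y, avg μ (fun y => D p ρ l (T^[K - l] y)) (fun y => ee (s * ρ (T^[K] y))) y =
      cc μ p T ρ l s (T^[K - l] y) := fun l hl y => (h.cc_shift hl s y).symm
  have e2 : ∀ l ≤ K, ∫ y, ‖avg μ (fun y => D p ρ l (T^[K - l] y)) (fun y => ee (s * ρ (T^[K] y))) y‖ ^ 2 ∂μ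
      = ∫ x, ‖cc μ p T ρ l s x‖ ^ 2 ∂μ := by
    intro l hl
    simp_rw [e1 l hl]
    exact integral_comp_mp (h.mpi (K - l)) (F := fun x => ‖cc μ p T ρ l s x‖ ^ 2)
      ((h.cc_meas l s).norm.pow_const 2).aestronglyMeasurable
  rw [e2 K le_rfl, e2 r hr] at key
  refine le_trans (le_of_eq ?_) key
  congr 2
  ext y
  simp only [mem_setOf_eq]
  refine exists_congr fun l => and_congr_right fun h1 => and_congr_right fun h2 => ?_
  rw [e1 l h2, e1 r hr]

attribute [local irreducible] cc in
lemma BK_meas (h : Sys μ p T ρ) (H : Ph σ rp R α) (K r : ℕ) (A c : ℝ) : MeasurableSet {z : Θ × X | ∃ l, r ≤ l ∧ l ≤ K ∧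
      c ≤ ‖cc μ p T ρ l (A * (p : ℝ) ^ (rp z.1)) (T^[K - l] z.2)
        - cc μ p T ρ r (A * (p : ℝ) ^ (rp z.1)) (T^[K - r] z.2)‖} := by
  have hm : ∀ l, Measurable fun z : Θ × X =>
      cc μ p T ρ l (A * (p : ℝ) ^ (rp z.1)) (T^[K - l] z.2) := by
    intro l
    have h2 : Measurable fun z : Θ × X => (z.1, T^[K - l] z.2) :=
      measurable_fst.prodMk ((h.mpi (K - l)).measurable.comp measurable_snd)
    exact Measurable.comp (g := fun z : Θ × X => cc μ p T ρ l (A * (p : ℝ) ^ (rp z.1)) z.2)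
      (h.ccA_meas H l A) h2
  have : {z : Θ × X | ∃ l, r ≤ l ∧ l ≤ K ∧
      c ≤ ‖cc μ p T ρ l (A * (p : ℝ) ^ (rp z.1)) (T^[K - l] z.2)
        - cc μ p T ρ r (A * (p : ℝ) ^ (rp z.1)) (T^[K - r] z.2)‖} =
      ⋃ l ∈ {l | r ≤ l ∧ l ≤ K}, {z | c ≤ ‖cc μ p T ρ l (A * (p : ℝ) ^ (rp z.1)) (T^[K - l] z.2)
        - cc μ p T ρ r (A * (p : ℝ) ^ (rp z.1)) (T^[K - r] z.2)‖} := by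
    ext z; simp only [mem_setOf_eq, mem_iUnion, exists_prop, and_assoc]
  rw [this]
  exact MeasurableSet.biUnion (to_countable _) fun l _ =>
    measurableSet_le measurable_const ((hm l).sub (hm r)).norm

lemma BK_le (h : Sys μ p T ρ) (H : Ph σ rp R α) {K r : ℕ} (hr : r ≤ K) (A : ℝ) {c : ℝ} (hc : 0 ≤ c) :
    c ^ 2 * (σ.prod μ).real {z | ∃ l, r ≤ l ∧ l ≤ K ∧
      c ≤ ‖cc μ p T ρ l (A * (p : ℝ) ^ (rp z.1)) (T^[K - l] z.2)
        - cc μ p T ρ r (A * (p : ℝ) ^ (rp z.1)) (T^[K - r] z.2)‖}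
      ≤ qb σ rp μ p T ρ K A - qb σ rp μ p T ρ r A := by
  rw [h.qb_eq H, h.qb_eq H, ← integral_sub (h.ccA_int H K A).integral_prod_left
    (h.ccA_int H r A).integral_prod_left]
  have hB := h.BK_meas H K r A c
  rw [← integral_indicator_one hB]
  have hI : Integrable ({z : Θ × X | ∃ l, r ≤ l ∧ l ≤ K ∧
      c ≤ ‖cc μ p T ρ l (A * (p : ℝ) ^ (rp z.1)) (T^[K - l] z.2)
        - cc μ p T ρ r (A * (p : ℝ) ^ (rp z.1)) (T^[K - r] z.2)‖}.indicator (1 : Θ × X → ℝ))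
      (σ.prod μ) := (integrable_const (1:ℝ)).indicator hB
  rw [integral_prod _ hI, ← integral_const_mul]
  refine integral_mono (hI.integral_prod_left.const_mul _)
    ((h.ccA_int H K A).integral_prod_left.sub (h.ccA_int H r A).integral_prod_left) fun θ => ?_
  refine le_trans (le_of_eq ?_) (h.cc_max hr (A * (p : ℝ) ^ (rp θ)) hc)
  congr 1
  rw [← integral_indicator_one]
  · rfl
  · exact measurable_prodMk_left hB

lemma qb_mono (h : Sys μ p T ρ) (H : Ph σ rp R α) {r K : ℕ} (hr : r ≤ K) (A : ℝ) : qb σ rp μ p T ρ r A ≤ qb σ rp μ p T ρ K A := by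
  have := h.BK_le H hr A le_rfl
  simp at this
  linarith

lemma cc_lip (h : Sys μ p T ρ) (k : ℕ) (s s' : ℝ) (x : X) :
    ‖cc μ p T ρ k s x - cc μ p T ρ k s' x‖ ≤ 2 * Real.pi * |s - s'| := by
  have hi : ∀ s, Integrable (fun y => ee (s * ρ (T^[k] y))) (μ.restrict (D p ρ k ⁻¹' {D p ρ k x})) :=
    fun s => integrable_of_bdd (C := 1) (h.eer_meas k s).aestronglyMeasurable fun _ => (norm_ee _).le
  have : cc μ p T ρ k s x - cc μ p T ρ k s' x =
      avg μ (D p ρ k) (fun y => ee (s * ρ (T^[k] y)) - ee (s' * ρ (T^[k] y))) x := by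
    unfold cc avg
    rw [integral_sub (hi s) (hi s'), smul_sub]
  rw [this]
  refine norm_avg_le _ (by positivity) (fun y => (ee_lip _ _).trans ?_) x
  rw [← sub_mul, abs_mul]
  have h1 : |ρ (T^[k] y)| ≤ 1 := by
    rw [abs_of_nonneg (h.nonneg _)]; exact (h.lt_one _).le
  have := mul_le_mul_of_nonneg_left h1 (abs_nonneg (s - s'))
  have hpi := Real.pi_pos
  nlinarith

lemma qb_small (h : Sys μ p T ρ) (H : Ph σ rp R α) (herg : Ergodic T μ) {q : ℝ} (hq : q < 1) (hq' : ∀ k, ∫ x, ra μ p ρ k 1 x ∂μ ≤ q)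
    {ε : ℝ} (hε : 0 < ε) : ∃ A0 : ℝ, 0 < A0 ∧ ∀ A, A0 ≤ |A| → ∀ k, qb σ rp μ p T ρ k A ≤ ε := by
  obtain ⟨l, hl⟩ := h.coll herg hq hq' (ε := ε / 6) (by positivity)
  have hlog : 0 < Real.log p := Real.log_pos (by exact_mod_cast h.hp)
  have hp0 := h.pos
  set C := (2 / Real.log p + 1) * (p : ℝ) ^ l with hC
  have hC0 : 0 < C := by positivity
  refine ⟨2 * C / ε, by positivity, fun A hA k => ?_⟩
  have hA0 : 0 < |A| := lt_of_lt_of_le (by positivity) hA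
  have hAne : A ≠ 0 := abs_pos.1 hA0
  have hCA : C / |A| ≤ ε / 2 := by
    rw [div_le_iff₀ hε] at hA
    rw [div_le_div_iff₀ hA0 two_pos]; linarith
  have h1 : qb σ rp μ p T ρ k A = ∫ x, (∫ τ in (0:ℝ)..1, ‖cc μ p T ρ k (A * (p : ℝ) ^ τ) x‖ ^ 2) ∂μ := by
    unfold qb
    rw [integral_prod_symm _ (h.ccA_int H k A)]
    refine integral_congr_ae (ae_of_all _ fun x => ?_)
    exact H.map (fun τ => ‖cc μ p T ρ k (A * (p : ℝ) ^ τ) x‖ ^ 2)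
  rw [h1]
  have hI : ∀ d, Integrable (fun x => ‖avg μ (D p ρ k) (fd p ρ T k l d) x‖ ^ 2) μ := fun d => by
    refine integrable_of_bdd (C := 1) ((measurable_avg (h.D_meas k) _).norm.pow_const 2).aestronglyMeasurable fun z => ?_
    rw [Real.norm_of_nonneg (by positivity)]
    exact pow_le_one₀ (norm_nonneg _) (norm_avg_le _ zero_le_one (fd_bd k l d) _)
  have hIs := (integrable_finsetSum (Finset.range (p ^ l)) fun d _ => hI d).const_mul 3
  calc ∫ x, (∫ τ in (0:ℝ)..1, ‖cc μ p T ρ k (A * (p : ℝ) ^ τ) x‖ ^ 2) ∂μ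
      ≤ ∫ x, (C / |A| + 3 * ∑ d ∈ Finset.range (p ^ l), ‖avg μ (D p ρ k) (fd p ρ T k l d) x‖ ^ 2) ∂μ := by
        refine integral_mono_of_nonneg (ae_of_all _ fun x =>
          intervalIntegral.integral_nonneg zero_le_one fun τ _ => by positivity)
          ((integrable_const _).add hIs) (ae_of_all _ fun x => h.fourier_cell k l hAne x)
    _ = C / |A| + 3 * ∫ x, ra μ p ρ k l x ∂μ := by
        rw [integral_add (integrable_const _) hIs, integral_const_mul, integral_finsetSum _ fun d _ => hI d,
          h.integral_ra]
        simp
    _ ≤ ε := by linarith [hl k]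

end Sys
end sys3
end TPE

namespace TPE

set_option linter.unusedSectionVars false

/-- the skew product over the phase rotation -/
noncomputable def Sk {Θ X : Type*} (rp : Θ → ℝ) (R : Θ → Θ) (α : ℝ) (T : X → X) (z : Θ × X) : Θ × X :=
  (R z.1, T^[⌊rp z.1 + α⌋₊] z.2)

/-- the bad events -/
def Ev {Θ X : Type*} [MeasurableSpace X] (rp : Θ → ℝ) (R : Θ → Θ) (α : ℝ) (μ : Measure X) (p : ℕ)
    (T : X → X) (ρ : X → ℝ) (r : ℕ) (c A : ℝ) (i : ℕ) : Set (Θ × X) :=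
  {z | r ≤ ⌊rp z.1 + i * α⌋₊ ∧
    c ≤ ‖cc μ p T ρ ⌊rp z.1 + i * α⌋₊ (A * (p : ℝ) ^ (rp (R^[i] z.1))) z.2
      - cc μ p T ρ r (A * (p : ℝ) ^ (rp (R^[i] z.1))) (T^[⌊rp z.1 + i * α⌋₊ - r] z.2)‖}

section sys4
variable {X : Type*} [MeasurableSpace X] {μ : Measure X} [IsProbabilityMeasure μ]
  {p : ℕ} {T : X → X} {ρ : X → ℝ} {Θ : Type*} [MeasurableSpace Θ] {σ : Measure Θ}
  [IsProbabilityMeasure σ] {rp : Θ → ℝ} {R : Θ → Θ} {α : ℝ}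

attribute [local irreducible] cc

lemma Ph.iter (H : Ph σ rp R α) (hα : 0 < α) (i : ℕ) (θ : Θ) :
    rp θ + i * α = ⌊rp θ + i * α⌋₊ + rp (R^[i] θ) := by
  have h0 : 0 ≤ rp θ + i * α := by have := H.nonneg θ; positivity
  have key : ∃ n : ℕ, rp θ + i * α = n + rp (R^[i] θ) := by
    clear h0
    induction i with
    | zero => exact ⟨0, by simp⟩
    | succ i ih =>
      obtain ⟨n, hn⟩ := ih
      refine ⟨n + ⌊rp (R^[i] θ) + α⌋₊, ?_⟩
      have h1 : 0 ≤ rp (R^[i] θ) + α := by have := H.nonneg (R^[i] θ); positivity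
      have h2 := Int.floor_add_fract (rp (R^[i] θ) + α)
      rw [Function.iterate_succ_apply', H.rot]
      have h3 : ((⌊rp (R^[i] θ) + α⌋₊ : ℕ) : ℝ) = ((⌊rp (R^[i] θ) + α⌋ : ℤ) : ℝ) :=
        natCast_floor_eq_intCast_floor h1
      push_cast
      rw [h3]
      linarith
  obtain ⟨n, hn⟩ := key
  have : ⌊rp θ + i * α⌋₊ = n := by
    rw [Nat.floor_eq_iff h0]
    constructor <;> linarith [H.nonneg (R^[i] θ), H.lt_one (R^[i] θ)]
  rw [this]; exact hn

lemma Ph.rp_iter (H : Ph σ rp R α) (hα : 0 < α) (i : ℕ) (θ : Θ) :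
    rp (R^[i] θ) = Int.fract (rp θ + i * α) := by
  have h0 : 0 ≤ rp θ + i * α := by have := H.nonneg θ; positivity
  have h1 := H.iter hα i θ
  have h2 := Int.floor_add_fract (rp θ + i * α)
  rw [← natCast_floor_eq_intCast_floor h0] at h2
  linarith

lemma Sk_iter (H : Ph σ rp R α) (hα : 0 < α) (i : ℕ) (z : Θ × X) :
    (Sk rp R α T)^[i] z = (R^[i] z.1, T^[⌊rp z.1 + i * α⌋₊] z.2) := by
  induction i with
  | zero =>
    have : ⌊rp z.1⌋₊ = 0 := Nat.floor_eq_zero.2 (H.lt_one _)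
    simp [this]
  | succ i ih =>
    rw [Function.iterate_succ_apply', ih, Function.iterate_succ_apply']
    unfold Sk
    simp only
    congr 1
    rw [← Function.iterate_add_apply]
    congr 1
    have h1 := H.iter hα i z.1
    have h2 : rp z.1 + ((i + 1 : ℕ) : ℝ) * α = rp (R^[i] z.1) + α + (⌊rp z.1 + i * α⌋₊ : ℕ) := by
      push_cast; linarith
    rw [h2, Nat.floor_add_natCast]
    have := H.nonneg (R^[i] z.1); positivity

lemma measurable_iter {T : X → X} (hT : Measurable T) : Measurable fun q : ℕ × X => T^[q.1] q.2 :=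
  measurable_from_prod_countable_right fun n => hT.iterate n

namespace Sys


lemma Sk_mp (h : Sys μ p T ρ) (H : Ph σ rp R α) : MeasurePreserving (Sk rp R α T) (σ.prod μ) (σ.prod μ) := by
  refine MeasurePreserving.skew_product (g := fun θ x => T^[⌊rp θ + α⌋₊] x)
    H.erg.toMeasurePreserving ?_ (ae_of_all _ fun θ => (h.mpi _).map_eq)
  have h1 : Measurable fun z : Θ × X => (⌊rp z.1 + α⌋₊, z.2) :=
    (Nat.measurable_floor.comp ((H.meas.comp measurable_fst).add_const α)).prodMk measurable_snd
  exact (measurable_iter h.mp.measurable).comp h1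

lemma cc_meas3 (h : Sys μ p T ρ) : Measurable fun q : ℕ × (ℝ × X) => cc μ p T ρ q.1 q.2.1 q.2.2 :=
  measurable_from_prod_countable_right fun n => h.cc_meas2 n

lemma n_meas (h : Sys μ p T ρ) (H : Ph σ rp R α) (i : ℕ) : Measurable fun z : Θ × X => ⌊rp z.1 + i * α⌋₊ :=
  Nat.measurable_floor.comp ((H.meas.comp measurable_fst).add_const _)

lemma s_meas (h : Sys μ p T ρ) (H : Ph σ rp R α) (A : ℝ) (i : ℕ) :
    Measurable fun z : Θ × X => A * (p : ℝ) ^ (rp (R^[i] z.1)) :=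
  (h.sA_meas H A).comp ((H.erg.toMeasurePreserving.measurable.iterate i).comp measurable_fst)

lemma a_meas (h : Sys μ p T ρ) (H : Ph σ rp R α) (A : ℝ) (i : ℕ) : Measurable fun z : Θ × X =>
    cc μ p T ρ ⌊rp z.1 + i * α⌋₊ (A * (p : ℝ) ^ (rp (R^[i] z.1))) z.2 := by
  have h1 : Measurable fun z : Θ × X =>
    ((⌊rp z.1 + i * α⌋₊, ((A * (p : ℝ) ^ (rp (R^[i] z.1))), z.2)) : ℕ × (ℝ × X)) :=
    (h.n_meas H i).prodMk ((h.s_meas H A i).prodMk measurable_snd)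
  exact Measurable.comp (g := fun q : ℕ × (ℝ × X) => cc μ p T ρ q.1 q.2.1 q.2.2) h.cc_meas3 h1

lemma b_meas (h : Sys μ p T ρ) (H : Ph σ rp R α) (A : ℝ) (r i : ℕ) : Measurable fun z : Θ × X =>
    cc μ p T ρ r (A * (p : ℝ) ^ (rp (R^[i] z.1))) (T^[⌊rp z.1 + i * α⌋₊ - r] z.2) := by
  have h2 : Measurable fun z : Θ × X => T^[⌊rp z.1 + i * α⌋₊ - r] z.2 := by
    have h3 : Measurable fun z : Θ × X => (⌊rp z.1 + i * α⌋₊ - r, z.2) :=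
      ((measurable_of_countable fun n : ℕ => n - r).comp (h.n_meas H i)).prodMk measurable_snd
    exact Measurable.comp (g := fun q : ℕ × X => T^[q.1] q.2) (measurable_iter h.mp.measurable) h3
  have h1 : Measurable fun z : Θ × X =>
    ((A * (p : ℝ) ^ (rp (R^[i] z.1))), T^[⌊rp z.1 + i * α⌋₊ - r] z.2) :=
    (h.s_meas H A i).prodMk h2
  exact Measurable.comp (g := fun q : (ℝ × X) => cc μ p T ρ r q.1 q.2) (h.cc_meas2 r) h1

lemma Ev_meas (h : Sys μ p T ρ) (H : Ph σ rp R α) (r : ℕ) (c A : ℝ) (i : ℕ) :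
    MeasurableSet (Ev rp R α μ p T ρ r c A i) := by
  unfold Ev
  refine MeasurableSet.inter (s₁ := {z : Θ × X | r ≤ ⌊rp z.1 + i * α⌋₊})
    (measurableSet_le measurable_const (h.n_meas H i)) ?_
  exact measurableSet_le measurable_const ((h.a_meas H A i).sub (h.b_meas H A r i)).norm

lemma cnt_meas (h : Sys μ p T ρ) (H : Ph σ rp R α) (r : ℕ) (c A : ℝ) (N : ℕ) :
    Measurable fun z => ∑ i ∈ Finset.range N, (Ev rp R α μ p T ρ r c A i).indicator (1 : Θ × X → ℝ) z :=
  Finset.measurable_fun_sum _ fun i _ => measurable_one.indicator (h.Ev_meas H r c A i)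

lemma maker0 (h : Sys μ p T ρ) (H : Ph σ rp R α) (hα : 0 < α) (r : ℕ) {c lam : ℝ} (hc : 0 < c) (hl : 0 < lam) (A : ℝ) {Q : ℝ}
    (hQ : ∀ K, r ≤ K → qb σ rp μ p T ρ K A - qb σ rp μ p T ρ r A ≤ Q) (N0 : ℕ) :
    (σ.prod μ).real {z | ∃ N ≤ N0, lam * N <
      ∑ i ∈ Finset.range N, (Ev rp R α μ p T ρ r c A i).indicator (1 : Θ × X → ℝ) z} ≤ Q / (c ^ 2 * lam) := by
  set V : Set (Θ × X) := {z | ∃ N ≤ N0, lam * N <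
      ∑ i ∈ Finset.range N, (Ev rp R α μ p T ρ r c A i).indicator (1 : Θ × X → ℝ) z} with hV
  have hVm : MeasurableSet V := by
    have : V = ⋃ N ∈ {N | N ≤ N0}, {z | lam * N <
      ∑ i ∈ Finset.range N, (Ev rp R α μ p T ρ r c A i).indicator (1 : Θ × X → ℝ) z} := by
      ext z; simp [hV]
    rw [this]
    exact MeasurableSet.biUnion (to_countable _) fun N _ =>
      measurableSet_lt measurable_const (h.cnt_meas H r c A N)
  obtain ⟨K, hrK, hK⟩ : ∃ K : ℕ, r ≤ K ∧ 1 + N0 * α ≤ K := by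
    obtain ⟨K, hK⟩ := exists_nat_ge (1 + N0 * α)
    exact ⟨max r K, le_max_left _ _, hK.trans (by exact_mod_cast le_max_right _ _)⟩
  have hB := h.BK_meas H K r A c
  have hBle := h.BK_le H hrK A hc.le
  set B : Set (Θ × X) := {z | ∃ l, r ≤ l ∧ l ≤ K ∧
      c ≤ ‖cc μ p T ρ l (A * (p : ℝ) ^ (rp z.1)) (T^[K - l] z.2)
        - cc μ p T ρ r (A * (p : ℝ) ^ (rp z.1)) (T^[K - r] z.2)‖} with hBdef
  have hmp : MeasurePreserving (fun z : Θ × X => (z.1, T^[K] z.2)) (σ.prod μ) (σ.prod μ) :=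
    (MeasurePreserving.id σ).prod (h.mpi K)
  have h1 : (σ.prod μ).real V = (σ.prod μ).real ((fun z : Θ × X => (z.1, T^[K] z.2)) ⁻¹' V) := by
    rw [measureReal_def, measureReal_def, hmp.measure_preimage hVm.nullMeasurableSet]
  have h2 : ((fun z : Θ × X => (z.1, T^[K] z.2)) ⁻¹' V) ⊆
      {z | ∃ N ≤ N0, lam * N < birkhoffSum (Sk rp R α T) (B.indicator 1) N z} := by
    rintro z ⟨N, hN, hlt⟩
    refine ⟨N, hN, hlt.trans_le ?_⟩
    unfold birkhoffSum
    refine Finset.sum_le_sum fun i hi => ?_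
    rw [Finset.mem_range] at hi
    by_cases hE : ((z.1, T^[K] z.2) : Θ × X) ∈ Ev rp R α μ p T ρ r c A i
    · have hBz : (Sk rp R α T)^[i] z ∈ B := by
        rw [Sk_iter H hα]
        obtain ⟨hr, hcl⟩ := hE
        simp only at hr hcl
        have hnK : ⌊rp z.1 + i * α⌋₊ ≤ K := by
          have hiN : (i : ℝ) ≤ N0 := by exact_mod_cast (hi.trans_le hN).le
          have : rp z.1 + i * α ≤ K := by
            have := mul_le_mul_of_nonneg_right hiN hα.le
            linarith [H.lt_one z.1]
          exact Nat.floor_le_of_le this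
        refine ⟨⌊rp z.1 + i * α⌋₊, hr, hnK, ?_⟩
        simp only
        rw [← Function.iterate_add_apply, ← Function.iterate_add_apply, Nat.sub_add_cancel hnK]
        rw [← Function.iterate_add_apply] at hcl
        have e : ⌊rp z.1 + i * α⌋₊ - r + K = K - r + ⌊rp z.1 + i * α⌋₊ := by omega
        rw [e] at hcl
        exact hcl
      rw [indicator_of_mem hBz]
      rw [indicator_of_mem (show (fun z : Θ × X => (z.1, T^[K] z.2)) z ∈ _ from hE)]
      simp
    · rw [indicator_of_notMem (show (fun z : Θ × X => (z.1, T^[K] z.2)) z ∉ _ from hE)]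
      exact indicator_nonneg (fun _ _ => zero_le_one) _
  have h3 := maximal_weak (h.Sk_mp H) hB lam N0
  have h4 := measureReal_mono (μ := σ.prod μ) h2 (measure_ne_top _ _)
  rw [← h1] at h4
  rw [le_div_iff₀ (by positivity)]
  have h5 := hQ K hrK
  have h6 : (σ.prod μ).real V * lam ≤ (σ.prod μ).real B := by
    refine le_trans ?_ h3
    rw [mul_comm]
    gcongr
  have h7 : c ^ 2 * ((σ.prod μ).real V * lam) ≤ c ^ 2 * (σ.prod μ).real B := by gcongr
  nlinarith

lemma bad_meas (h : Sys μ p T ρ) (H : Ph σ rp R α) (r : ℕ) (c A lam : ℝ) :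
    MeasurableSet {z | ∃ N : ℕ, lam * N <
      ∑ i ∈ Finset.range N, (Ev rp R α μ p T ρ r c A i).indicator (1 : Θ × X → ℝ) z} := by
  have : {z | ∃ N : ℕ, lam * N <
      ∑ i ∈ Finset.range N, (Ev rp R α μ p T ρ r c A i).indicator (1 : Θ × X → ℝ) z} =
      ⋃ N : ℕ, {z | lam * N <
      ∑ i ∈ Finset.range N, (Ev rp R α μ p T ρ r c A i).indicator (1 : Θ × X → ℝ) z} := by
    ext z; simp
  rw [this]
  exact MeasurableSet.iUnion fun N => measurableSet_lt measurable_const (h.cnt_meas H r c A N)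

lemma maker (h : Sys μ p T ρ) (H : Ph σ rp R α) (hα : 0 < α) (r : ℕ) {c lam : ℝ} (hc : 0 < c) (hl : 0 < lam) (A : ℝ) {Q : ℝ}
    (hQ : ∀ K, r ≤ K → qb σ rp μ p T ρ K A - qb σ rp μ p T ρ r A ≤ Q) :
    (σ.prod μ).real {z | ∃ N : ℕ, lam * N <
      ∑ i ∈ Finset.range N, (Ev rp R α μ p T ρ r c A i).indicator (1 : Θ × X → ℝ) z} ≤ Q / (c ^ 2 * lam) := by
  set V : ℕ → Set (Θ × X) := fun N0 => {z | ∃ N ≤ N0, lam * N <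
      ∑ i ∈ Finset.range N, (Ev rp R α μ p T ρ r c A i).indicator (1 : Θ × X → ℝ) z} with hV
  have hU : {z | ∃ N : ℕ, lam * N <
      ∑ i ∈ Finset.range N, (Ev rp R α μ p T ρ r c A i).indicator (1 : Θ × X → ℝ) z} = ⋃ N0, V N0 := by
    ext z
    simp only [hV, mem_iUnion, mem_setOf_eq]
    exact ⟨fun ⟨N, hN⟩ => ⟨N, N, le_rfl, hN⟩, fun ⟨_, N, _, hN⟩ => ⟨N, hN⟩⟩
  have hmono : Monotone V := fun a b hab z ⟨N, hN, hz⟩ => ⟨N, hN.trans hab, hz⟩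
  rw [hU]
  have ht := tendsto_measure_iUnion_atTop (μ := σ.prod μ) hmono
  have ht2 := (ENNReal.tendsto_toReal (measure_ne_top (σ.prod μ) _)).comp ht
  exact le_of_tendsto' ht2 fun N0 => h.maker0 H hα r hc hl A hQ N0

end Sys
end sys4
end TPE

namespace TPE

set_option linter.unusedSectionVars false

section sys5
variable {X : Type*} [MeasurableSpace X] {μ : Measure X} [IsProbabilityMeasure μ]
  {p : ℕ} {T : X → X} {ρ : X → ℝ} {Θ : Type*} [MeasurableSpace Θ] {σ : Measure Θ}
  [IsProbabilityMeasure σ] {rp : Θ → ℝ} {R : Θ → Θ} {α : ℝ}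

attribute [local irreducible] cc

lemma Ph.interval (H : Ph σ rp R α) {κ : ℝ} (hκ : 0 < κ) (hκ1 : κ ≤ 1) :
    σ.real {θ | rp θ ∈ Ioo 0 κ} = κ := by
  have hm : MeasurableSet {θ | rp θ ∈ Ioo 0 κ} := H.meas measurableSet_Ioo
  rw [← integral_indicator_one hm]
  have h1 := H.map ((Ioo 0 κ).indicator 1)
  have h2 : (fun θ => (Ioo 0 κ).indicator (1 : ℝ → ℝ) (rp θ)) = {θ | rp θ ∈ Ioo 0 κ}.indicator 1 := by
    funext θ
    by_cases hθ : rp θ ∈ Ioo 0 κ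
    · rw [indicator_of_mem hθ, indicator_of_mem (show θ ∈ {θ | rp θ ∈ Ioo 0 κ} from hθ)]; rfl
    · rw [indicator_of_notMem hθ, indicator_of_notMem (show θ ∉ {θ | rp θ ∈ Ioo 0 κ} from hθ)]
  rw [h2] at h1
  rw [h1, intervalIntegral.integral_of_le zero_le_one, integral_indicator_one measurableSet_Ioo,
    measureReal_restrict_apply measurableSet_Ioo]
  have : Ioo 0 κ ∩ Ioc 0 1 = Ioo 0 κ := by
    refine inter_eq_left.2 fun x hx => ⟨hx.1, (hx.2.trans_le hκ1).le⟩
  rw [this, Real.volume_real_Ioo_of_le hκ.le, sub_zero]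

/-- pointwise estimate -/
lemma pointwise {N i0 : ℕ} {ε : ℝ} (hε : 0 < ε) {a Ψ e : ℕ → ℝ} (ha1 : ∀ i, a i ≤ 1)
    (he0 : ∀ i, 0 ≤ e i) (hΨ0 : ∀ i, 0 ≤ Ψ i)
    (h1 : ∀ i, i0 ≤ i → a i ≤ √(Ψ i) + ε + e i)
    (h2 : ∑ i ∈ Finset.range N, e i ≤ ε * N)
    (h3 : ∑ i ∈ Finset.range N, Ψ i ≤ ε ^ 2 * N) (h4 : (i0 : ℝ) ≤ ε * N) :
    ∑ i ∈ Finset.range N, a i ≤ 4 * ε * N := by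
  have key : ∀ i, a i ≤ (ε + Ψ i / ε) / 2 + ε + e i + (if i < i0 then 1 else 0) := by
    intro i
    have hs : √(Ψ i) ≤ (ε + Ψ i / ε) / 2 := by
      have h5 : Ψ i / ε = √(Ψ i) ^ 2 / ε := by rw [Real.sq_sqrt (hΨ0 i)]
      rw [h5, le_div_iff₀ two_pos, ← sub_nonneg]
      have : ε + √(Ψ i) ^ 2 / ε - √(Ψ i) * 2 = (ε - √(Ψ i)) ^ 2 / ε := by field_simp; ring
      rw [this]; positivity
    split_ifs with hi
    · have : 0 ≤ (ε + Ψ i / ε) / 2 := by have := hΨ0 i; positivity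
      linarith [ha1 i, he0 i]
    · linarith [h1 i (not_lt.1 hi)]
  have hcard : ∑ i ∈ Finset.range N, (if i < i0 then (1 : ℝ) else 0) ≤ i0 := by
    rw [Finset.sum_boole]
    have : (Finset.range N).filter (fun i => i < i0) ⊆ Finset.range i0 := by
      intro i hi; simp at hi ⊢; exact hi.2
    have := Finset.card_le_card this
    rw [Finset.card_range] at this
    exact_mod_cast this
  calc ∑ i ∈ Finset.range N, a i
      ≤ ∑ i ∈ Finset.range N, ((ε + Ψ i / ε) / 2 + ε + e i + (if i < i0 then 1 else 0)) :=
        Finset.sum_le_sum fun i _ => key i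
    _ = (N * ε + (∑ i ∈ Finset.range N, Ψ i) / ε) / 2 + N * ε + ∑ i ∈ Finset.range N, e i
        + ∑ i ∈ Finset.range N, (if i < i0 then (1 : ℝ) else 0) := by
        rw [Finset.sum_add_distrib, Finset.sum_add_distrib, Finset.sum_add_distrib, ← Finset.sum_div,
          Finset.sum_add_distrib, ← Finset.sum_div]
        simp
    _ ≤ 4 * ε * N := by
        have h5 : (∑ i ∈ Finset.range N, Ψ i) / ε ≤ ε * N := by
          rw [div_le_iff₀ hε]; linarith
        linarith

namespace Sys


lemma Q_small (h : Sys μ p T ρ) (H : Ph σ rp R α) (A : ℝ) {δ : ℝ} (hδ : 0 < δ) :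
    ∃ r, ∀ K, r ≤ K → qb σ rp μ p T ρ K A - qb σ rp μ p T ρ r A ≤ δ := by
  have hm : Monotone fun k => qb σ rp μ p T ρ k A := fun a b hab => h.qb_mono H hab A
  have hbd : BddAbove (range fun k => qb σ rp μ p T ρ k A) := ⟨1, by rintro _ ⟨k, rfl⟩; exact h.qb_le_one H k A⟩
  have ht := tendsto_atTop_ciSup hm hbd
  obtain ⟨r, hr⟩ := ((tendsto_order.1 ht).1 _ (sub_lt_self _ hδ)).exists
  refine ⟨r, fun K hK => ?_⟩
  have := le_ciSup hbd K
  linarith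

/-- Birkhoff slices. -/
lemma birk_slice (h : Sys μ p T ρ) (H : Ph σ rp R α) (hα : 0 < α) (A : ℝ) (r : ℕ) {η ε : ℝ} (hε : 0 < ε)
    (hq : qb σ rp μ p T ρ r A ≤ η * ε ^ 2) :
    ∀ᵐ θ ∂σ, μ.real {z | ¬ ∀ᶠ N : ℕ in atTop, birkhoffSum (Sk rp R α T)
      (fun z : Θ × X => ‖cc μ p T ρ r (A * (p : ℝ) ^ (rp z.1)) z.2‖ ^ 2) N (θ, z) ≤ ε ^ 2 * N} ≤ η := by
  set Ψ : Θ × X → ℝ := fun z => ‖cc μ p T ρ r (A * (p : ℝ) ^ (rp z.1)) z.2‖ ^ 2 with hΨ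
  obtain ⟨Γ, hΓm, hΓi, hΓinv, hΓint, hΓ⟩ := birkhoff (h.Sk_mp H) (f := Ψ)
    ((h.ccA_meas H r A).norm.pow_const 2) (h.ccA_int H r A)
  set γ : Θ → ℝ := fun θ => ∫ x, Γ (θ, x) ∂μ with hγ
  have hγm : Measurable γ := (hΓm.stronglyMeasurable.integral_prod_right' (ν := μ)).measurable
  have hγinv : ∀ θ, γ (R θ) = γ θ := by
    intro θ
    have h1 : ∀ x, Γ (θ, x) = Γ (R θ, T^[⌊rp θ + α⌋₊] x) := fun x => (hΓinv (θ, x)).symm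
    simp only [hγ]
    simp_rw [h1]
    have hs : Measurable fun x => Γ (R θ, x) := hΓm.comp measurable_prodMk_left
    exact (integral_comp_mp (h.mpi ⌊rp θ + α⌋₊) (F := fun x => Γ (R θ, x)) hs.aestronglyMeasurable).symm
  obtain ⟨c, hc⟩ := H.erg.ae_eq_const_of_ae_eq_comp_ae hγm.aestronglyMeasurable
    (ae_of_all _ hγinv)
  have hcq : c = qb σ rp μ p T ρ r A := by
    have h1 : ∫ θ, γ θ ∂σ = c := by rw [integral_congr_ae hc]; simp
    rw [← h1]
    unfold qb
    rw [← hΓint, integral_prod _ hΓi]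
  have hae := Measure.ae_ae_of_ae_prod hΓ
  have hsi := hΓi.prod_right_ae
  filter_upwards [hc, hae, hsi] with θ h1 h2 h3
  have hnn : 0 ≤ᵐ[μ] fun x => Γ (θ, x) := by
    filter_upwards [h2] with x hx
    refine ge_of_tendsto' hx fun N => ?_
    refine div_nonneg (Finset.sum_nonneg fun i _ => ?_) (Nat.cast_nonneg _)
    simp only [hΨ]; positivity
  have hMk := mul_meas_ge_le_integral_of_nonneg hnn h3 (ε ^ 2)
  have h4 : ∫ x, Γ (θ, x) ∂μ ≤ η * ε ^ 2 := by
    have : γ θ = c := h1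
    simp only [hγ] at this
    rw [this, hcq]; exact hq
  have h5 : μ.real {x | ε ^ 2 ≤ Γ (θ, x)} ≤ η := by
    have : 0 < ε ^ 2 := by positivity
    nlinarith
  refine le_trans ?_ h5
  rw [measureReal_def, measureReal_def]
  refine ENNReal.toReal_mono (measure_ne_top _ _) (measure_mono_ae ?_)
  filter_upwards [h2] with x hx hbad
  by_contra hcon
  apply hbad
  have hlt : Γ (θ, x) < ε ^ 2 := not_le.1 hcon
  filter_upwards [(tendsto_order.1 hx).2 _ hlt, eventually_gt_atTop 0] with N hN hN0
  rw [div_lt_iff₀ (by exact_mod_cast hN0)] at hN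
  exact hN.le

lemma key_phase (h : Sys μ p T ρ) (H : Ph σ rp R α) (hα : 0 < α) (A : ℝ) {ε κ η : ℝ} (hε : 0 < ε) (hκ : 0 < κ) (hη : 0 < η)
    (hq : ∀ k, qb σ rp μ p T ρ k A ≤ η * ε ^ 2) :
    ∃ t, 0 < t ∧ t < κ ∧ t < 1 ∧ μ.real {x | ¬ ∀ᶠ N : ℕ in atTop, ∑ i ∈ Finset.range N,
      ‖cc μ p T ρ ⌊t + i * α⌋₊ (A * (p : ℝ) ^ (Int.fract (t + i * α))) x‖ ≤ 4 * ε * N} ≤ 2 * η := by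
  set κ' := min κ 1 with hκ'
  have hκ'0 : 0 < κ' := lt_min hκ one_pos
  obtain ⟨r, hr⟩ := h.Q_small H A (δ := ε ^ 2 * ε * (η * (κ' / 2))) (by positivity)
  have hmk := h.maker H hα r hε hε A hr
  have hGm := h.bad_meas H r ε A ε
  have hbs := h.birk_slice H hα A r hε (hq r)
  set G : Set (Θ × X) := {z | ∃ N : ℕ, ε * N <
      ∑ i ∈ Finset.range N, (Ev rp R α μ p T ρ r ε A i).indicator (1 : Θ × X → ℝ) z} with hG
  have hmk' : (σ.prod μ).real G ≤ η * (κ' / 2) := by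
    refine hmk.trans (le_of_eq ?_)
    field_simp
  -- slices
  have hGi : Integrable (G.indicator (1 : Θ × X → ℝ)) (σ.prod μ) := (integrable_const (1:ℝ)).indicator hGm
  have hone : ∀ θ, ∫ x, G.indicator (1 : Θ × X → ℝ) (θ, x) ∂μ = μ.real {x | (θ, x) ∈ G} := by
    intro θ
    have hm : MeasurableSet {x | (θ, x) ∈ G} := measurable_prodMk_left hGm
    rw [← integral_indicator_one hm]
    rfl
  have hslice : ∫ θ, μ.real {x | (θ, x) ∈ G} ∂σ ≤ η * (κ' / 2) := by
    rw [← integral_indicator_one hGm, integral_prod _ hGi] at hmk'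
    refine le_trans (le_of_eq ?_) hmk'
    refine integral_congr_ae (ae_of_all _ fun θ => ?_)
    simp only
    exact (hone θ).symm
  have hsi : Integrable (fun θ => μ.real {x | (θ, x) ∈ G}) σ := by
    have := hGi.integral_prod_left
    refine this.congr (ae_of_all _ fun θ => ?_)
    simp only
    exact hone θ
  have hMk := mul_meas_ge_le_integral_of_nonneg (ae_of_all _ fun θ => measureReal_nonneg) hsi η
  have hbadθ : σ.real {θ | η ≤ μ.real {x | (θ, x) ∈ G}} ≤ κ' / 2 := by
    have := hMk.trans hslice
    exact le_of_mul_le_mul_left this hη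
  obtain ⟨θ, hθ1, hθ2, hθ3⟩ : ∃ θ, rp θ ∈ Ioo 0 κ' ∧ μ.real {x | (θ, x) ∈ G} < η ∧
      μ.real {z | ¬ ∀ᶠ N : ℕ in atTop, birkhoffSum (Sk rp R α T)
      (fun z : Θ × X => ‖cc μ p T ρ r (A * (p : ℝ) ^ (rp z.1)) z.2‖ ^ 2) N (θ, z) ≤ ε ^ 2 * N} ≤ η := by
    by_contra hcon
    have hintg := H.interval hκ'0 (min_le_right _ _)
    have hle : σ.real {θ | rp θ ∈ Ioo 0 κ'} ≤ σ.real {θ | η ≤ μ.real {x | (θ, x) ∈ G}} := by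
      rw [measureReal_def, measureReal_def]
      refine ENNReal.toReal_mono (measure_ne_top _ _) (measure_mono_ae ?_)
      filter_upwards [hbs] with θ hθ hin
      by_contra hc
      exact hcon ⟨θ, hin, not_le.1 hc, hθ⟩
    linarith
  refine ⟨rp θ, hθ1.1, hθ1.2.trans_le (min_le_left _ _), H.lt_one θ, ?_⟩
  have hrot : ∀ i : ℕ, Int.fract (rp θ + i * α) = rp (R^[i] θ) := fun i => (H.rp_iter hα i θ).symm
  simp_rw [hrot]
  set V : Set X := {x | ¬ ∀ᶠ N : ℕ in atTop, ∑ i ∈ Finset.range N,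
      ‖cc μ p T ρ ⌊rp θ + i * α⌋₊ (A * (p : ℝ) ^ (rp (R^[i] θ))) x‖ ≤ 4 * ε * N} with hV
  have hVm : MeasurableSet V := by
    have hVc : V = {x | ∀ᶠ N : ℕ in atTop, ∑ i ∈ Finset.range N,
      ‖cc μ p T ρ ⌊rp θ + i * α⌋₊ (A * (p : ℝ) ^ (rp (R^[i] θ))) x‖ ≤ 4 * ε * N}ᶜ := rfl
    rw [hVc]
    refine MeasurableSet.compl ?_
    have e : {x | ∀ᶠ N : ℕ in atTop, ∑ i ∈ Finset.range N,
      ‖cc μ p T ρ ⌊rp θ + i * α⌋₊ (A * (p : ℝ) ^ (rp (R^[i] θ))) x‖ ≤ 4 * ε * N} =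
      ⋃ N0 : ℕ, ⋂ N : ℕ, ⋂ _ : N0 ≤ N, {x | ∑ i ∈ Finset.range N,
      ‖cc μ p T ρ ⌊rp θ + i * α⌋₊ (A * (p : ℝ) ^ (rp (R^[i] θ))) x‖ ≤ 4 * ε * N} := by
      ext x
      simp only [mem_iUnion, mem_iInter, mem_setOf_eq, eventually_atTop]
    rw [e]
    exact MeasurableSet.iUnion fun N0 => MeasurableSet.iInter fun N => MeasurableSet.iInter fun _ =>
      measurableSet_le (Finset.measurable_fun_sum _ fun i _ => (h.cc_meas _ _).norm) measurable_const
  set Z2 : Set X := {z | ¬ ∀ᶠ N : ℕ in atTop, birkhoffSum (Sk rp R α T)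
      (fun z : Θ × X => ‖cc μ p T ρ r (A * (p : ℝ) ^ (rp z.1)) z.2‖ ^ 2) N (θ, z) ≤ ε ^ 2 * N} with hZ2
  have hZ1m : MeasurableSet {x | (θ, x) ∈ G} := measurable_prodMk_left hGm
  obtain ⟨i0, hi0⟩ := exists_nat_ge (((r : ℝ) + 1) / α)
  have hsub : T^[r] ⁻¹' V ⊆ T^[r] ⁻¹' {x | (θ, x) ∈ G} ∪ Z2 := by
    intro z hz
    by_contra hcon
    rw [mem_union, not_or] at hcon
    obtain ⟨hc1, hc2⟩ := hcon
    apply hz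
    have hc2' : ∀ᶠ N : ℕ in atTop, birkhoffSum (Sk rp R α T)
      (fun z : Θ × X => ‖cc μ p T ρ r (A * (p : ℝ) ^ (rp z.1)) z.2‖ ^ 2) N (θ, z) ≤ ε ^ 2 * N := not_not.1 hc2
    have hc1' : ∀ N : ℕ, ∑ i ∈ Finset.range N,
        (Ev rp R α μ p T ρ r ε A i).indicator (1 : Θ × X → ℝ) (θ, T^[r] z) ≤ ε * N := by
      intro N
      by_contra hN
      exact hc1 ⟨N, not_le.1 hN⟩
    obtain ⟨N1, hN1⟩ := exists_nat_ge ((i0 : ℝ) / ε)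
    filter_upwards [hc2', eventually_ge_atTop N1] with N hN hNN
    refine pointwise (i0 := i0) (e := fun i => (Ev rp R α μ p T ρ r ε A i).indicator (1 : Θ × X → ℝ) (θ, T^[r] z))
      (Ψ := fun i => ‖cc μ p T ρ r (A * (p : ℝ) ^ (rp (R^[i] θ))) (T^[⌊rp θ + i * α⌋₊] z)‖ ^ 2)
      hε (fun i => cc_le _ _ _) (fun i => indicator_nonneg (fun _ _ => zero_le_one) _)
      (fun i => by positivity) ?_ (hc1' N) ?_ ?_
    · intro i hi
      rw [Real.sqrt_sq (norm_nonneg _)]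
      have hrn : r ≤ ⌊rp θ + i * α⌋₊ := by
        refine Nat.le_floor ?_
        have h1 : (i0 : ℝ) ≤ i := by exact_mod_cast hi
        have h2 := hi0.trans h1
        rw [div_le_iff₀ hα] at h2
        linarith [H.nonneg θ]
      have hit : T^[⌊rp θ + i * α⌋₊ - r] (T^[r] z) = T^[⌊rp θ + i * α⌋₊] z := by
        rw [← Function.iterate_add_apply, Nat.sub_add_cancel hrn]
      by_cases hE : ((θ, T^[r] z) : Θ × X) ∈ Ev rp R α μ p T ρ r ε A i
      · rw [indicator_of_mem hE]
        have := cc_le (μ := μ) (p := p) (T := T) (ρ := ρ) ⌊rp θ + i * α⌋₊ (A * (p : ℝ) ^ (rp (R^[i] θ))) (T^[r] z)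
        have h0 := norm_nonneg (cc μ p T ρ r (A * (p : ℝ) ^ (rp (R^[i] θ))) (T^[⌊rp θ + i * α⌋₊] z))
        simp only [Pi.one_apply]
        linarith
      · rw [indicator_of_notMem hE, add_zero]
        have hlt : ‖cc μ p T ρ ⌊rp θ + i * α⌋₊ (A * (p : ℝ) ^ (rp (R^[i] θ))) (T^[r] z)
            - cc μ p T ρ r (A * (p : ℝ) ^ (rp (R^[i] θ))) (T^[⌊rp θ + i * α⌋₊] z)‖ < ε := by
          by_contra hge
          refine hE ⟨hrn, ?_⟩
          simp only
          rw [hit]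
          exact not_lt.1 hge
        have := norm_sub_norm_le (cc μ p T ρ ⌊rp θ + i * α⌋₊ (A * (p : ℝ) ^ (rp (R^[i] θ))) (T^[r] z))
          (cc μ p T ρ r (A * (p : ℝ) ^ (rp (R^[i] θ))) (T^[⌊rp θ + i * α⌋₊] z))
        linarith
    · refine le_trans (le_of_eq ?_) hN
      unfold birkhoffSum
      refine Finset.sum_congr rfl fun i _ => ?_
      rw [Sk_iter H hα]
    · have h1 : (N1 : ℝ) ≤ N := by exact_mod_cast hNN
      have h2 := hN1.trans h1
      rw [div_le_iff₀ hε] at h2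
      linarith
  have e1 : μ.real V = μ.real (T^[r] ⁻¹' V) := by
    rw [measureReal_def, measureReal_def, (h.mpi r).measure_preimage hVm.nullMeasurableSet]
  have e2 : μ.real (T^[r] ⁻¹' {x | (θ, x) ∈ G}) = μ.real {x | (θ, x) ∈ G} := by
    rw [measureReal_def, measureReal_def, (h.mpi r).measure_preimage hZ1m.nullMeasurableSet]
  rw [e1]
  have h6 := measureReal_mono (μ := μ) hsub (measure_ne_top _ _)
  have h7 := measureReal_union_le (μ := μ) (T^[r] ⁻¹' {x | (θ, x) ∈ G}) Z2
  linarith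

end Sys
end sys5
end TPE

open scoped ComplexConjugate

namespace TPE

set_option linter.unusedSectionVars false

lemma half_sum (N : ℕ) : ∑ i ∈ Finset.range N, (1 / 2 : ℝ) ^ (N - i) ≤ 1 := by
  induction N with
  | zero => simp
  | succ N ih =>
    rw [Finset.sum_range_succ]
    have : ∀ i ∈ Finset.range N, (1 / 2 : ℝ) ^ (N + 1 - i) = (1 / 2 : ℝ) ^ (N - i) * (1 / 2) := by
      intro i hi
      rw [Finset.mem_range] at hi
      rw [← pow_succ]; congr 1; omega
    rw [Finset.sum_congr rfl this, ← Finset.sum_mul]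
    have e : N + 1 - N = 1 := by omega
    rw [e, pow_one]; linarith

section lln
variable {X : Type*} [MeasurableSpace X] {μ : Measure X} [IsProbabilityMeasure μ]

lemma second_moment {h : ℕ → X → ℂ} (hm : ∀ i, Measurable (h i)) (hb : ∀ i x, ‖h i x‖ ≤ 2) {C : ℝ}
    (hC : 0 ≤ C)
    (hcor : ∀ i N, i < N → ‖∫ x, h N x * conj (h i x) ∂μ‖ ≤ C * (1 / 2) ^ (N - i)) (N : ℕ) :
    ∫ x, ‖∑ i ∈ Finset.range N, h i x‖ ^ 2 ∂μ ≤ (2 * C + 4) * N := by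
  have hSm : ∀ N, Measurable fun x => ∑ i ∈ Finset.range N, h i x := fun N =>
    Finset.measurable_fun_sum _ fun i _ => hm i
  have hSb : ∀ N x, ‖∑ i ∈ Finset.range N, h i x‖ ≤ N * 2 := fun N x =>
    (norm_sum_le_of_le _ fun i _ => hb i x).trans (by simp)
  have hcm : ∀ i, Measurable fun x => conj (h i x) := fun i =>
    Complex.continuous_conj.measurable.comp (hm i)
  induction N with
  | zero => simp
  | succ N ih =>
    have hpt : ∀ x, ‖∑ i ∈ Finset.range (N + 1), h i x‖ ^ 2 =
        ‖∑ i ∈ Finset.range N, h i x‖ ^ 2 + 2 * (∑ i ∈ Finset.range N, h N x * conj (h i x)).re +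
        ‖h N x‖ ^ 2 := by
      intro x
      rw [Finset.sum_range_succ, ← Finset.mul_sum, ← map_sum, ← Complex.normSq_eq_norm_sq,
        ← Complex.normSq_eq_norm_sq, ← Complex.normSq_eq_norm_sq, Complex.normSq_add]
      have : (h N x * conj (∑ i ∈ Finset.range N, h i x)).re =
        ((∑ i ∈ Finset.range N, h i x) * conj (h N x)).re := by
        rw [← Complex.conj_re]; congr 1; simp [mul_comm]
      rw [this]; ring
    have i1 : Integrable (fun x => ‖∑ i ∈ Finset.range N, h i x‖ ^ 2) μ := by
      refine integrable_of_bdd (C := (N * 2) ^ 2) ((hSm N).norm.pow_const 2).aestronglyMeasurable fun x => ?_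
      rw [Real.norm_of_nonneg (by positivity)]
      exact pow_le_pow_left₀ (norm_nonneg _) (hSb N x) 2
    have i2 : ∀ i, Integrable (fun x => h N x * conj (h i x)) μ := by
      intro i
      refine integrable_of_bdd (C := 2 * 2) ((hm N).mul (hcm i)).aestronglyMeasurable fun x => ?_
      rw [norm_mul, RCLike.norm_conj]
      exact mul_le_mul (hb N x) (hb i x) (norm_nonneg _) zero_le_two
    have i2' : Integrable (fun x => ∑ i ∈ Finset.range N, h N x * conj (h i x)) μ :=
      integrable_finsetSum _ fun i _ => i2 i
    have i2'' : Integrable (fun x => 2 * (∑ i ∈ Finset.range N, h N x * conj (h i x)).re) μ :=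
      i2'.re.const_mul 2
    have i3 : Integrable (fun x => ‖h N x‖ ^ 2) μ := by
      refine integrable_of_bdd (C := 2 ^ 2) ((hm N).norm.pow_const 2).aestronglyMeasurable fun x => ?_
      rw [Real.norm_of_nonneg (by positivity)]
      exact pow_le_pow_left₀ (norm_nonneg _) (hb N x) 2
    have i12 : Integrable (fun x => ‖∑ i ∈ Finset.range N, h i x‖ ^ 2 +
        2 * (∑ i ∈ Finset.range N, h N x * conj (h i x)).re) μ := i1.add i2''
    simp_rw [hpt]
    rw [integral_add i12 i3, integral_add i1 i2'', integral_const_mul]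
    have e1 : ∫ x, (∑ i ∈ Finset.range N, h N x * conj (h i x)).re ∂μ ≤ C := by
      have e2 : ∫ x, (∑ i ∈ Finset.range N, h N x * conj (h i x)).re ∂μ =
          (∫ x, ∑ i ∈ Finset.range N, h N x * conj (h i x) ∂μ).re := integral_re i2'
      rw [e2, integral_finsetSum _ fun i _ => i2 i]
      refine (Complex.re_le_norm _).trans ?_
      refine (norm_sum_le_of_le _ fun i hi => hcor i N (Finset.mem_range.1 hi)).trans ?_
      rw [← Finset.mul_sum]
      calc C * _ ≤ C * 1 := mul_le_mul_of_nonneg_left (half_sum N) hC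
        _ = C := mul_one C
    have e3 : ∫ x, ‖h N x‖ ^ 2 ∂μ ≤ 4 := by
      have : ∫ x, ‖h N x‖ ^ 2 ∂μ ≤ ∫ x, (4 : ℝ) ∂μ := by
        refine integral_mono i3 (integrable_const _) fun x => ?_
        have := pow_le_pow_left₀ (norm_nonneg _) (hb N x) 2
        norm_num at this ⊢; exact this
      simpa using this
    push_cast
    linarith

lemma det_lln {a : ℕ → ℂ} (ha : ∀ i, ‖a i‖ ≤ 2)
    (hsq : Tendsto (fun n : ℕ => ‖∑ i ∈ Finset.range (n ^ 2), a i‖ ^ 2 / (n : ℝ) ^ 4) atTop (𝓝 0)) :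
    Tendsto (fun N : ℕ => ‖∑ i ∈ Finset.range N, a i‖ / N) atTop (𝓝 0) := by
  have h1 : Tendsto (fun n : ℕ => ‖∑ i ∈ Finset.range (n ^ 2), a i‖ / (n : ℝ) ^ 2) atTop (𝓝 0) := by
    have := (Real.continuous_sqrt.tendsto 0).comp hsq
    rw [Real.sqrt_zero] at this
    refine this.congr fun n => ?_
    simp only [Function.comp_apply]
    have e : ‖∑ i ∈ Finset.range (n ^ 2), a i‖ ^ 2 / (n : ℝ) ^ 4 =
      (‖∑ i ∈ Finset.range (n ^ 2), a i‖ / (n : ℝ) ^ 2) ^ 2 := by rw [div_pow]; ring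
    rw [e, Real.sqrt_sq (by positivity)]
  have h2 : Tendsto (fun n : ℕ => 4 / (n : ℝ)) atTop (𝓝 0) := tendsto_const_div_atTop_nhds_zero_nat 4
  have h3 : Tendsto (fun N : ℕ => Nat.sqrt N) atTop atTop := by
    refine tendsto_atTop.2 fun b => ?_
    filter_upwards [eventually_ge_atTop (b ^ 2)] with N hN
    exact Nat.le_sqrt'.2 hN
  have h4 := (h1.add h2).comp h3
  rw [add_zero] at h4
  refine squeeze_zero' (Eventually.of_forall fun N => by positivity) ?_ h4
  filter_upwards [eventually_gt_atTop 0] with N hN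
  simp only [Function.comp_apply]
  set n := Nat.sqrt N with hn
  have hn0 : 0 < n := Nat.sqrt_pos.2 hN
  have hle : n ^ 2 ≤ N := Nat.sqrt_le' N
  have hlt : N ≤ n ^ 2 + 2 * n := by
    have := Nat.sqrt_le_add N
    rw [← hn] at this
    nlinarith
  have hsplit : ‖∑ i ∈ Finset.range N, a i‖ ≤ ‖∑ i ∈ Finset.range (n ^ 2), a i‖ + 4 * n := by
    rw [← Finset.sum_range_add_sum_Ico _ hle]
    refine (norm_add_le _ _).trans ?_
    gcongr
    refine (norm_sum_le_of_le _ fun i _ => ha i).trans ?_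
    simp only [Finset.sum_const, Nat.card_Ico, nsmul_eq_mul]
    have : ((N - n ^ 2 : ℕ) : ℝ) ≤ 2 * n := by
      have : N - n ^ 2 ≤ 2 * n := by omega
      exact_mod_cast this
    linarith
  have hnr : (0 : ℝ) < n := by exact_mod_cast hn0
  have hNr : (n : ℝ) ^ 2 ≤ N := by exact_mod_cast hle
  calc ‖∑ i ∈ Finset.range N, a i‖ / N
      ≤ (‖∑ i ∈ Finset.range (n ^ 2), a i‖ + 4 * n) / (n : ℝ) ^ 2 := by gcongr
    _ = ‖∑ i ∈ Finset.range (n ^ 2), a i‖ / (n : ℝ) ^ 2 + 4 / n := by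
        field_simp

lemma lln {h : ℕ → X → ℂ} (hm : ∀ i, Measurable (h i)) (hb : ∀ i x, ‖h i x‖ ≤ 2) {C : ℝ}
    (hC : 0 ≤ C)
    (hcor : ∀ i N, i < N → ‖∫ x, h N x * conj (h i x) ∂μ‖ ≤ C * (1 / 2) ^ (N - i)) :
    ∀ᵐ x ∂μ, Tendsto (fun N : ℕ => ‖∑ i ∈ Finset.range N, h i x‖ / N) atTop (𝓝 0) := by
  have hSm : ∀ N, Measurable fun x => ∑ i ∈ Finset.range N, h i x := fun N =>
    Finset.measurable_fun_sum _ fun i _ => hm i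
  have hSb : ∀ N x, ‖∑ i ∈ Finset.range N, h i x‖ ≤ N * 2 := fun N x =>
    (norm_sum_le_of_le _ fun i _ => hb i x).trans (by simp)
  set F : ℕ → X → ℝ := fun n x => ‖∑ i ∈ Finset.range (n ^ 2), h i x‖ ^ 2 / (n : ℝ) ^ 4 with hF
  have hFm : ∀ n, Measurable (F n) := fun n => ((hSm _).norm.pow_const 2).div_const _
  have hF0 : ∀ n x, 0 ≤ F n x := fun n x => by simp only [hF]; positivity
  have hFi : ∀ n, Integrable (F n) μ := by
    intro n
    refine integrable_of_bdd (C := ((n ^ 2 : ℕ) * 2) ^ 2 / (n : ℝ) ^ 4) (hFm n).aestronglyMeasurable fun x => ?_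
    rw [Real.norm_of_nonneg (hF0 n x)]
    simp only [hF]
    have := hSb (n ^ 2) x
    gcongr
  have hFint : ∀ n, ∫ x, F n x ∂μ ≤ (2 * C + 4) * (1 / (n : ℝ) ^ 2) := by
    intro n
    simp only [hF]
    rw [integral_div]
    rcases Nat.eq_zero_or_pos n with rfl | hn
    · simp
    · have := second_moment (μ := μ) hm hb hC hcor (n ^ 2)
      have hnr : (0 : ℝ) < n := by exact_mod_cast hn
      rw [div_le_iff₀ (by positivity)]
      refine this.trans (le_of_eq ?_)
      push_cast
      field_simp
  have hsum : Summable fun n : ℕ => ∫ x, F n x ∂μ := by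
    refine Summable.of_nonneg_of_le (fun n => integral_nonneg (hF0 n)) hFint ?_
    exact (Real.summable_one_div_nat_pow.2 one_lt_two).mul_left _
  have hfin : ∫⁻ x, ∑' n, ENNReal.ofReal (F n x) ∂μ ≠ ⊤ := by
    rw [lintegral_tsum fun n => (hFm n).ennreal_ofReal.aemeasurable]
    have : ∀ n, ∫⁻ x, ENNReal.ofReal (F n x) ∂μ = ENNReal.ofReal (∫ x, F n x ∂μ) := fun n =>
      (ofReal_integral_eq_lintegral_ofReal (hFi n) (ae_of_all _ (hF0 n))).symm
    simp_rw [this]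
    exact hsum.tsum_ofReal_ne_top
  have hae := ae_lt_top (Measurable.ennreal_tsum fun n => (hFm n).ennreal_ofReal) hfin
  filter_upwards [hae] with x hx
  refine det_lln (fun i => hb i x) ?_
  have h1 := ENNReal.tendsto_atTop_zero_of_tsum_ne_top hx.ne
  have h2 := (ENNReal.tendsto_toReal ENNReal.zero_ne_top).comp h1
  simp only [ENNReal.toReal_zero] at h2
  refine h2.congr fun n => ?_
  simp only [Function.comp_apply]
  rw [ENNReal.toReal_ofReal (hF0 n x)]

end lln
end TPE

open scoped ComplexConjugate

namespace TPE

set_option linter.unusedSectionVars false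

section sys6
variable {X : Type*} [MeasurableSpace X] {μ : Measure X} [IsProbabilityMeasure μ]
  {p : ℕ} {T : X → X} {ρ : X → ℝ} {Θ : Type*} [MeasurableSpace Θ] {σ : Measure Θ}
  [IsProbabilityMeasure σ] {rp : Θ → ℝ} {R : Θ → Θ} {α : ℝ}

namespace Sys


lemma eer0_meas (h : Sys μ p T ρ) (s : ℝ) : Measurable fun y => ee (s * ρ y) :=
  measurable_ee.comp (h.meas.const_mul s)

lemma norm_avg_ee (h : Sys μ p T ρ) (k : ℕ) (ξ : ℝ) (x : X) :
    ‖avg μ (D p ρ k) (fun y => ee (ξ * ρ y)) x‖ = ‖cc μ p T ρ k (ξ / (p : ℝ) ^ k) x‖ := by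
  have hpk : (0 : ℝ) < (p : ℝ) ^ k := pow_pos h.pos k
  have e : avg μ (D p ρ k) (fun y => ee (ξ * ρ y)) x =
      ee (ξ / (p : ℝ) ^ k * D p ρ k x) * cc μ p T ρ k (ξ / (p : ℝ) ^ k) x := by
    unfold cc avg
    rw [mul_smul_comm, ← integral_const_mul]
    congr 1
    refine setIntegral_congr_fun (h.D_meas k (measurableSet_singleton _)) fun y hy => ?_
    have hy' : D p ρ k y = D p ρ k x := hy
    rw [← ee_add, ← hy', ← mul_add, ← h.D_eq k y]
    congr 1
    field_simp
  rw [e, norm_mul, norm_ee, one_mul]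

lemma mart (h : Sys μ p T ρ) {k : ℕ → ℕ} (hk : Monotone k) {ξ : ℕ → ℝ} {C : ℝ} (hC : 0 ≤ C)
    (hξ : ∀ i j, i < j → |ξ i| / (p : ℝ) ^ (k j) ≤ C * (1 / 2) ^ (j - i)) :
    ∀ᵐ x ∂μ, Tendsto (fun N : ℕ => ‖∑ i ∈ Finset.range N, (ee (ξ i * ρ x) -
      avg μ (D p ρ (k i)) (fun y => ee (ξ i * ρ y)) x)‖ / N) atTop (𝓝 0) := by
  have hgm : ∀ i, Measurable (avg μ (D p ρ (k i)) (fun y => ee (ξ i * ρ y))) := fun i =>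
    measurable_avg (h.D_meas _) _
  have hg1 : ∀ i x, ‖avg μ (D p ρ (k i)) (fun y => ee (ξ i * ρ y)) x‖ ≤ 1 := fun i x =>
    norm_avg_le _ zero_le_one (fun _ => (norm_ee _).le) x
  have hh2 : ∀ i x, ‖ee (ξ i * ρ x) - avg μ (D p ρ (k i)) (fun y => ee (ξ i * ρ y)) x‖ ≤ 2 := by
    intro i x
    refine (norm_sub_le _ _).trans ?_
    have := hg1 i x
    rw [norm_ee]; linarith
  refine lln (C := 4 * Real.pi * C) (fun i => (h.eer0_meas _).sub (hgm i)) hh2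
    (by positivity) ?_
  intro i j hij
  have hpk : (0 : ℝ) < (p : ℝ) ^ (k j) := pow_pos h.pos _
  obtain ⟨v0, hv0⟩ := avg_factor (μ := μ) (D p ρ (k i)) (fun y => ee (ξ i * ρ y))
  set v : ℕ → ℂ := fun n => if ‖v0 n‖ ≤ 1 then v0 n else 0 with hv
  have hv1 : ∀ n, ‖v n‖ ≤ 1 := by
    intro n; simp only [hv]; split_ifs with h1
    · exact h1
    · simp
  have hvx : ∀ x, avg μ (D p ρ (k i)) (fun y => ee (ξ i * ρ y)) x = v (D p ρ (k i) x) := by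
    intro x
    simp only [hv]
    rw [if_pos (by rw [← hv0]; exact hg1 i x), hv0]
  set u : ℕ → ℂ := fun n => ee (ξ i / (p : ℝ) ^ (k j) * n) - v (n / p ^ (k j - k i)) with hu
  have hu2 : ∀ n, ‖u n‖ ≤ 2 := by
    intro n
    refine (norm_sub_le _ _).trans ?_
    have := hv1 (n / p ^ (k j - k i))
    rw [norm_ee]; linarith
  have hDD : ∀ x, D p ρ (k i) x = D p ρ (k j) x / p ^ (k j - k i) := by
    intro x
    have := h.D_div (k i) (k j - k i) x
    rwa [show k i + (k j - k i) = k j by have := hk hij.le; omega] at this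
  have herr : ∀ x, ‖(ee (ξ i * ρ x) - avg μ (D p ρ (k i)) (fun y => ee (ξ i * ρ y)) x) -
      u (D p ρ (k j) x)‖ ≤ 2 * Real.pi * (|ξ i| / (p : ℝ) ^ (k j)) := by
    intro x
    simp only [hu]
    rw [hvx, hDD x, sub_sub_sub_cancel_right]
    refine (ee_lip _ _).trans ?_
    have e : ξ i * ρ x - ξ i / (p : ℝ) ^ (k j) * (D p ρ (k j) x : ℝ) =
        ξ i / (p : ℝ) ^ (k j) * ρ (T^[k j] x) := by
      have := h.D_eq (k j) x
      have e2 : ρ (T^[k j] x) = (p : ℝ) ^ (k j) * ρ x - D p ρ (k j) x := by linarith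
      rw [e2]; field_simp
    rw [e, abs_mul, abs_div, abs_of_pos hpk, abs_of_nonneg (h.nonneg _)]
    have h1 := (h.lt_one (T^[k j] x)).le
    have h2 : 0 ≤ |ξ i| / (p : ℝ) ^ (k j) := by positivity
    have := mul_le_mul_of_nonneg_left h1 h2
    have := Real.pi_pos
    nlinarith
  set H : ℕ → X → ℂ := fun i x => ee (ξ i * ρ x) - avg μ (D p ρ (k i)) (fun y => ee (ξ i * ρ y)) x
    with hH
  have hHm : ∀ i, Measurable (H i) := fun i => (h.eer0_meas _).sub (hgm i)
  have hum : Measurable fun x => conj (u (D p ρ (k j) x)) :=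
    Complex.continuous_conj.measurable.comp ((measurable_of_countable u).comp (h.D_meas _))
  have hcm : Measurable fun x => conj (H i x - u (D p ρ (k j) x)) :=
    Complex.continuous_conj.measurable.comp
      ((hHm i).sub ((measurable_of_countable u).comp (h.D_meas _)))
  set E := 2 * Real.pi * (|ξ i| / (p : ℝ) ^ (k j)) with hE
  have z : ∫ x, H j x * conj (u (D p ρ (k j) x)) ∂μ = 0 := by
    have := integral_avg_mul (μ := μ) (h.D_meas (k j)) (h.eer0_meas (ξ j)) (C := 1)
      (fun x => (norm_ee _).le) (g := fun n => conj (u n)) (C' := 2)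
      (fun n => by rw [RCLike.norm_conj]; exact hu2 n)
    have i1 : Integrable (fun x => ee (ξ j * ρ x) * conj (u (D p ρ (k j) x))) μ := by
      refine integrable_of_bdd (C := 1 * 2) ((h.eer0_meas _).mul hum).aestronglyMeasurable fun x => ?_
      rw [norm_mul, norm_ee, RCLike.norm_conj]; linarith [hu2 (D p ρ (k j) x)]
    have i2 : Integrable (fun x => avg μ (D p ρ (k j)) (fun y => ee (ξ j * ρ y)) x *
        conj (u (D p ρ (k j) x))) μ := by
      refine integrable_of_bdd (C := 1 * 2) ((hgm j).mul hum).aestronglyMeasurable fun x => ?_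
      rw [norm_mul, RCLike.norm_conj]
      exact mul_le_mul (hg1 j x) (hu2 _) (norm_nonneg _) zero_le_one
    have e : (fun x => H j x * conj (u (D p ρ (k j) x))) = fun x =>
        ee (ξ j * ρ x) * conj (u (D p ρ (k j) x)) - avg μ (D p ρ (k j)) (fun y => ee (ξ j * ρ y)) x *
        conj (u (D p ρ (k j) x)) := by
      funext x; simp only [hH]; rw [sub_mul]
    rw [e, integral_sub i1 i2, this, sub_self]
  have j1 : Integrable (fun x => H j x * conj (u (D p ρ (k j) x))) μ := by
    refine integrable_of_bdd (C := 2 * 2) ((hHm j).mul hum).aestronglyMeasurable fun x => ?_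
    rw [norm_mul, RCLike.norm_conj]
    exact mul_le_mul (hh2 j x) (hu2 _) (norm_nonneg _) zero_le_two
  have jb : ∀ x, ‖H j x * conj (H i x - u (D p ρ (k j) x))‖ ≤ 2 * E := by
    intro x
    rw [norm_mul, RCLike.norm_conj]
    exact mul_le_mul (hh2 j x) (herr x) (norm_nonneg _) zero_le_two
  have j2 : Integrable (fun x => H j x * conj (H i x - u (D p ρ (k j) x))) μ :=
    integrable_of_bdd (C := 2 * E) ((hHm j).mul hcm).aestronglyMeasurable jb
  have e : (fun x => H j x * conj (H i x)) = fun x =>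
      H j x * conj (u (D p ρ (k j) x)) + H j x * conj (H i x - u (D p ρ (k j) x)) := by
    funext x; rw [← mul_add, ← map_add]; congr 2; ring
  change ‖∫ x, H j x * conj (H i x) ∂μ‖ ≤ _
  rw [e, integral_add j1 j2, z, zero_add]
  have := norm_integral_le_of_norm_le_const (μ := μ) (ae_of_all _ jb)
  rw [probReal_univ, mul_one] at this
  refine this.trans ?_
  have h3 := hξ i j hij
  have := Real.pi_pos
  have := mul_le_mul_of_nonneg_left h3 (by positivity : 0 ≤ 4 * Real.pi)
  rw [hE]; nlinarith

attribute [local irreducible] cc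

lemma general_aux (h : Sys μ p T ρ) (H : Ph σ rp R α) (herg : Ergodic T μ) {q : ℝ} (hq : q < 1)
    (hq' : ∀ k, ∫ x, ra μ p ρ k 1 x ∂μ ≤ q) {M : ℕ} (hM : 2 ≤ M)
    (hα : α = Real.log M / Real.log p) {ξ : ℕ → ℝ} {a : ℝ} (ha : a ≠ 0)
    (hξ : Tendsto (fun i => ξ i / (M : ℝ) ^ i) atTop (𝓝 a)) {ε η : ℝ} (hε : 0 < ε) (hη : 0 < η) :
    μ.real {x | ¬ ∀ᶠ N : ℕ in atTop, ‖∑ i ∈ Finset.range N, ee (ξ i * ρ x)‖ ≤ 8 * ε * N} ≤ 2 * η := by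
  have hp0 := h.pos
  have hp1 : (1 : ℝ) < p := by exact_mod_cast h.hp
  have hM1 : (1 : ℝ) < M := by exact_mod_cast hM
  have hM0 : (0 : ℝ) < M := by linarith
  have hlp := Real.log_pos hp1
  have hlM := Real.log_pos hM1
  have hα0 : 0 < α := by rw [hα]; positivity
  have hpα : (p : ℝ) ^ α = M := by
    rw [Real.rpow_def_of_pos hp0, hα, mul_div_cancel₀ _ hlp.ne', Real.exp_log hM0]
  obtain ⟨A0, hA0, hqb⟩ := h.qb_small H herg hq hq' (ε := η * ε ^ 2) (by positivity)
  obtain ⟨i0, hi0⟩ : ∃ i0 : ℕ, A0 ≤ |a * (M : ℝ) ^ i0| := by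
    obtain ⟨i0, hi⟩ := pow_unbounded_of_one_lt (A0 / |a|) hM1
    refine ⟨i0, ?_⟩
    have ha' := abs_pos.2 ha
    rw [div_lt_iff₀ ha'] at hi
    rw [abs_mul, abs_of_pos (pow_pos hM0 i0)]; linarith
  set A := a * (M : ℝ) ^ i0 with hA
  have hc : Tendsto (fun i => ξ (i + i0) / (M : ℝ) ^ i) atTop (𝓝 A) := by
    have := ((tendsto_add_atTop_iff_nat i0).2 hξ).mul_const ((M : ℝ) ^ i0)
    refine this.congr fun i => ?_
    rw [pow_add]; field_simp
  -- choice of κ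
  set δ := ε / (2 * Real.pi) with hδ
  have hpi := Real.pi_pos
  have hδ0 : 0 < δ := by positivity
  obtain ⟨κ, hκ, hκt⟩ : ∃ κ : ℝ, 0 < κ ∧ ∀ t, 0 < t → t < κ →
      p * (|A| * |(p : ℝ) ^ (-t) - 1|) < δ / 2 := by
    have hcont : ContinuousAt (fun t : ℝ => p * (|A| * |(p : ℝ) ^ (-t) - 1|)) 0 := by
      have : ContinuousAt (fun t : ℝ => (p : ℝ) ^ (-t)) 0 :=
        ContinuousAt.rpow continuousAt_const continuousAt_neg (Or.inl hp0.ne')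
      exact ((this.sub continuousAt_const).abs.const_mul _).const_mul _
    have h0 := hcont.tendsto.eventually (eventually_lt_nhds (b := δ / 2) (by simpa using hδ0))
    obtain ⟨κ, hκ, hb⟩ := Metric.eventually_nhds_iff.1 h0
    refine ⟨κ, hκ, fun t ht htκ => hb ?_⟩
    rw [Real.dist_eq, sub_zero, abs_of_pos ht]; exact htκ
  obtain ⟨t, ht0, htκ, ht1, hbad⟩ := h.key_phase H hα0 A hε hκ hη (hqb A hi0)
  set k : ℕ → ℕ := fun i => ⌊t + i * α⌋₊ with hk
  have hti : ∀ i : ℕ, 0 ≤ t + i * α := fun i => by positivity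
  have hkm : Monotone k := by
    intro i j hij
    refine Nat.floor_mono ?_
    have : (i : ℝ) ≤ j := by exact_mod_cast hij
    have := mul_le_mul_of_nonneg_right this hα0.le
    linarith
  have hsplit : ∀ i : ℕ, (p : ℝ) ^ (k i) * (p : ℝ) ^ (Int.fract (t + i * α)) =
      (p : ℝ) ^ t * (M : ℝ) ^ i := by
    intro i
    have e : (k i : ℝ) + Int.fract (t + i * α) = t + α * i := by
      simp only [hk]
      rw [natCast_floor_eq_intCast_floor (hti i), Int.floor_add_fract, mul_comm α]
    rw [← Real.rpow_natCast, ← Real.rpow_add hp0, e, Real.rpow_add hp0, Real.rpow_mul hp0.le, hpα,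
      Real.rpow_natCast]
  have hfr1 : ∀ i : ℕ, (p : ℝ) ^ (Int.fract (t + i * α)) ≤ p := by
    intro i
    have := Real.rpow_le_rpow_of_exponent_le hp1.le (Int.fract_lt_one (t + i * α)).le
    rwa [Real.rpow_one] at this
  have hfr0 : ∀ i : ℕ, 0 < (p : ℝ) ^ (Int.fract (t + i * α)) := fun i => Real.rpow_pos_of_pos hp0 _
  have hpt : 1 ≤ (p : ℝ) ^ t := Real.one_le_rpow hp1.le ht0.le
  have hpkM : ∀ i, (M : ℝ) ^ i ≤ p * (p : ℝ) ^ (k i) := by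
    intro i
    have h1 : (M : ℝ) ^ i ≤ (p : ℝ) ^ t * (M : ℝ) ^ i := le_mul_of_one_le_left (by positivity) hpt
    rw [← hsplit i, mul_comm] at h1
    exact h1.trans (mul_le_mul_of_nonneg_right (hfr1 i) (by positivity))
  -- martingale part
  obtain ⟨B, hB⟩ : ∃ B, ∀ i, |ξ (i + i0) / (M : ℝ) ^ i| ≤ B := by
    obtain ⟨B, hB⟩ := (hc.abs).bddAbove_range
    exact ⟨B, fun i => hB ⟨i, rfl⟩⟩
  have hB0 : 0 ≤ B := (abs_nonneg _).trans (hB 0)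
  have hmart := h.mart hkm (ξ := fun i => ξ (i + i0)) (C := B * p) (by positivity) (by
    intro i j hij
    have h1 : |ξ (i + i0)| ≤ B * (M : ℝ) ^ i := by
      have := hB i
      rwa [abs_div, abs_of_pos (pow_pos hM0 i), div_le_iff₀ (pow_pos hM0 i)] at this
    rw [div_le_iff₀ (pow_pos hp0 _)]
    refine h1.trans ?_
    have h2 : (M : ℝ) ^ i = (M : ℝ) ^ j * (1 / M) ^ (j - i) := by
      have : (M : ℝ) ^ j = (M : ℝ) ^ i * (M : ℝ) ^ (j - i) := by rw [← pow_add]; congr 1; omega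
      rw [this, div_pow, one_pow]; field_simp
    have h3 : (1 / M : ℝ) ^ (j - i) ≤ (1 / 2) ^ (j - i) := by
      refine pow_le_pow_left₀ (by positivity) ?_ _
      exact one_div_le_one_div_of_le two_pos (by exact_mod_cast hM)
    have h4 : (M : ℝ) ^ i ≤ (p * (p : ℝ) ^ (k j)) * (1 / 2) ^ (j - i) := by
      rw [h2]
      exact mul_le_mul (hpkM j) h3 (by positivity) (by positivity)
    calc B * (M : ℝ) ^ i ≤ B * ((p * (p : ℝ) ^ (k j)) * (1 / 2) ^ (j - i)) :=
          mul_le_mul_of_nonneg_left h4 hB0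
      _ = _ := by ring)
  -- comparison
  have hcmp : ∀ᶠ i : ℕ in atTop, |ξ (i + i0) / (p : ℝ) ^ (k i) -
      A * (p : ℝ) ^ (Int.fract (t + i * α))| ≤ δ := by
    have h1 : ∀ᶠ i : ℕ in atTop, |ξ (i + i0) / (M : ℝ) ^ i - A| < δ / 2 / p := by
      have := hc.eventually (Metric.ball_mem_nhds A (ε := δ / 2 / p) (by positivity))
      simpa [Real.dist_eq] using this
    filter_upwards [h1] with i hi
    set F := (p : ℝ) ^ (Int.fract (t + i * α)) with hF
    have e1 : ξ (i + i0) / (p : ℝ) ^ (k i) = ξ (i + i0) / (M : ℝ) ^ i * (p : ℝ) ^ (-t) * F := by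
      have := hsplit i
      rw [← hF] at this
      have hF0 : 0 < F := hfr0 i
      have e2 : (p : ℝ) ^ (k i) = (p : ℝ) ^ t * (M : ℝ) ^ i / F := by
        rw [eq_div_iff hF0.ne']; exact this
      rw [e2, Real.rpow_neg hp0.le]
      have : 0 < (p : ℝ) ^ t := by linarith
      field_simp
    set c := ξ (i + i0) / (M : ℝ) ^ i with hcdef
    set P := (p : ℝ) ^ (-t) with hP
    have hP0 : 0 < P := Real.rpow_pos_of_pos hp0 _
    have hP1 : P ≤ 1 := Real.rpow_le_one_of_one_le_of_nonpos hp1.le (by linarith)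
    have e3 : c * P * F - A * F = F * ((c - A) * P + A * (P - 1)) := by ring
    rw [e1, e3, abs_mul, abs_of_pos (hfr0 i)]
    have h2 : |(c - A) * P + A * (P - 1)| ≤ |c - A| + |A| * |P - 1| := by
      refine (abs_add_le _ _).trans ?_
      rw [abs_mul, abs_mul, abs_of_pos hP0]
      have := mul_le_mul_of_nonneg_left hP1 (abs_nonneg (c - A))
      linarith
    have h3 : F * |(c - A) * P + A * (P - 1)| ≤ p * (|c - A| + |A| * |P - 1|) :=
      mul_le_mul (hfr1 i) h2 (abs_nonneg _) hp0.le
    have h4 := hκt t ht0 htκ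
    have h5 : p * |c - A| < δ / 2 := by
      rw [lt_div_iff₀ hp0] at hi; linarith
    linarith
  obtain ⟨i1, hi1⟩ := eventually_atTop.1 hcmp
  refine le_trans ?_ hbad
  have hle : μ {x | ¬ ∀ᶠ N : ℕ in atTop, ‖∑ i ∈ Finset.range N, ee (ξ i * ρ x)‖ ≤ 8 * ε * N} ≤
      μ {x | ¬ ∀ᶠ N : ℕ in atTop, ∑ i ∈ Finset.range N,
      ‖cc μ p T ρ ⌊t + i * α⌋₊ (A * (p : ℝ) ^ (Int.fract (t + i * α))) x‖ ≤ 4 * ε * N} := by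
    refine measure_mono_ae ?_
    filter_upwards [hmart] with x hx hnot hgood
    refine hnot ?_
    have hx1 : ∀ᶠ N : ℕ in atTop, ‖∑ i ∈ Finset.range N, (ee (ξ (i + i0) * ρ x) -
      avg μ (D p ρ (k i)) (fun y => ee (ξ (i + i0) * ρ y)) x)‖ / N < ε :=
      hx.eventually (eventually_lt_nhds hε)
    have hbig : ∀ᶠ N : ℕ in atTop, ((i1 + 2 * i0 : ℕ) : ℝ) ≤ ε * N := by
      have : Tendsto (fun N : ℕ => ε * (N : ℝ)) atTop atTop :=
        tendsto_natCast_atTop_atTop.const_mul_atTop hε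
      exact this.eventually_ge_atTop _
    filter_upwards [hx1, hbig, hgood, eventually_gt_atTop 0] with N h1 h2 h3 hN
    have hN0 : (0 : ℝ) < N := by exact_mod_cast hN
    rw [div_lt_iff₀ hN0] at h1
    have h4 : ∀ i ∈ Finset.range N, ‖avg μ (D p ρ (k i)) (fun y => ee (ξ (i + i0) * ρ y)) x‖ ≤
        ‖cc μ p T ρ ⌊t + i * α⌋₊ (A * (p : ℝ) ^ (Int.fract (t + i * α))) x‖ + ε +
        (if i < i1 then 1 else 0) := by
      intro i _
      rw [h.norm_avg_ee]
      by_cases hii : i < i1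
      · rw [if_pos hii]
        have := cc_le (μ := μ) (p := p) (T := T) (ρ := ρ) (k i) (ξ (i + i0) / (p : ℝ) ^ k i) x
        have := norm_nonneg (cc μ p T ρ ⌊t + i * α⌋₊ (A * (p : ℝ) ^ (Int.fract (t + i * α))) x)
        linarith
      · rw [if_neg hii, add_zero]
        have h5 := h.cc_lip (k i) (ξ (i + i0) / (p : ℝ) ^ k i) (A * (p : ℝ) ^ (Int.fract (t + i * α))) x
        have h6 := hi1 i (not_lt.1 hii)
        have h7 : 2 * Real.pi * |ξ (i + i0) / (p : ℝ) ^ k i - A * (p : ℝ) ^ (Int.fract (t + i * α))|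
            ≤ ε := by
          refine (mul_le_mul_of_nonneg_left h6 (by positivity)).trans (le_of_eq ?_)
          rw [hδ]; field_simp
        have h8 := norm_sub_norm_le (cc μ p T ρ (k i) (ξ (i + i0) / (p : ℝ) ^ k i) x)
          (cc μ p T ρ (k i) (A * (p : ℝ) ^ (Int.fract (t + i * α))) x)
        have h9 : ‖cc μ p T ρ (k i) (A * (p : ℝ) ^ (Int.fract (t + i * α))) x‖ =
          ‖cc μ p T ρ ⌊t + i * α⌋₊ (A * (p : ℝ) ^ (Int.fract (t + i * α))) x‖ := rfl
        linarith
    have h5 : ∑ i ∈ Finset.range N, (if i < i1 then (1 : ℝ) else 0) ≤ i1 := by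
      rw [← Finset.sum_filter]
      simp only [Finset.sum_const, nsmul_eq_mul, mul_one]
      have : (Finset.filter (fun i => i < i1) (Finset.range N)).card ≤ (Finset.range i1).card :=
        Finset.card_le_card fun i hi => by
          simp only [Finset.mem_filter] at hi; exact Finset.mem_range.2 hi.2
      rw [Finset.card_range] at this
      exact_mod_cast this
    have h6 : ‖∑ i ∈ Finset.range N, avg μ (D p ρ (k i)) (fun y => ee (ξ (i + i0) * ρ y)) x‖ ≤
        5 * ε * N + i1 := by
      refine (norm_sum_le _ _).trans ((Finset.sum_le_sum h4).trans ?_)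
      rw [Finset.sum_add_distrib, Finset.sum_add_distrib]
      simp only [Finset.sum_const, Finset.card_range, nsmul_eq_mul]
      linarith
    have h7 : ‖∑ i ∈ Finset.range N, ee (ξ (i + i0) * ρ x)‖ ≤ 6 * ε * N + i1 := by
      rw [Finset.sum_sub_distrib] at h1
      have := norm_sub_norm_le (∑ i ∈ Finset.range N, ee (ξ (i + i0) * ρ x))
        (∑ i ∈ Finset.range N, avg μ (D p ρ (k i)) (fun y => ee (ξ (i + i0) * ρ y)) x)
      linarith
    have h8 : ∑ i ∈ Finset.range N, ee (ξ i * ρ x) = ∑ i ∈ Finset.range i0, ee (ξ i * ρ x) +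
        ∑ i ∈ Finset.range N, ee (ξ (i + i0) * ρ x) -
        ∑ i ∈ Finset.range i0, ee (ξ (N + i) * ρ x) := by
      have e1 := Finset.sum_range_add (fun i => ee (ξ i * ρ x)) i0 N
      have e2 := Finset.sum_range_add (fun i => ee (ξ i * ρ x)) N i0
      rw [add_comm i0 N, e2] at e1
      have e3 : ∑ i ∈ Finset.range N, ee (ξ (i0 + i) * ρ x) =
        ∑ i ∈ Finset.range N, ee (ξ (i + i0) * ρ x) :=
        Finset.sum_congr rfl fun i _ => by rw [add_comm]
      rw [← e3]
      linear_combination e1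
    have h9 : ∀ g : ℕ → ℝ, ‖∑ i ∈ Finset.range i0, ee (g i)‖ ≤ i0 := by
      intro g
      refine (norm_sum_le _ _).trans ?_
      simp [norm_ee]
    rw [h8]
    have e1 := h9 fun i => ξ i * ρ x
    have e2 := h9 fun i => ξ (N + i) * ρ x
    have e3 := norm_sub_le (∑ i ∈ Finset.range i0, ee (ξ i * ρ x) +
        ∑ i ∈ Finset.range N, ee (ξ (i + i0) * ρ x)) (∑ i ∈ Finset.range i0, ee (ξ (N + i) * ρ x))
    have e4 := norm_add_le (∑ i ∈ Finset.range i0, ee (ξ i * ρ x))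
      (∑ i ∈ Finset.range N, ee (ξ (i + i0) * ρ x))
    push_cast at h2
    have : 0 < ε * N := by positivity
    linarith
  exact ENNReal.toReal_mono (measure_ne_top _ _) hle

lemma general (h : Sys μ p T ρ) (H : Ph σ rp R α) (herg : Ergodic T μ) {q : ℝ} (hq : q < 1)
    (hq' : ∀ k, ∫ x, ra μ p ρ k 1 x ∂μ ≤ q) {M : ℕ} (hM : 2 ≤ M)
    (hα : α = Real.log M / Real.log p) {ξ : ℕ → ℝ} {a : ℝ} (ha : a ≠ 0)
    (hξ : Tendsto (fun i => ξ i / (M : ℝ) ^ i) atTop (𝓝 a)) :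
    ∀ᵐ x ∂μ, Tendsto (fun N : ℕ => (1 / N : ℂ) * ∑ i ∈ Finset.range N, ee (ξ i * ρ x)) atTop (𝓝 0) := by
  have h1 : ∀ r : ℕ, ∀ᵐ x ∂μ, ∀ᶠ N : ℕ in atTop,
      ‖∑ i ∈ Finset.range N, ee (ξ i * ρ x)‖ ≤ 8 * (1 / (r + 1 : ℝ)) * N := by
    intro r
    rw [ae_iff, ← measureReal_eq_zero_iff]
    refine le_antisymm (le_of_forall_pos_le_add fun η hη => ?_) measureReal_nonneg
    have := h.general_aux H herg hq hq' hM hα ha hξ (ε := 1 / (r + 1 : ℝ)) (η := η / 2)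
      (by positivity) (by positivity)
    linarith
  filter_upwards [ae_all_iff.2 h1] with x hx
  rw [Metric.tendsto_atTop']
  intro ε hε
  obtain ⟨r, hr⟩ := exists_nat_one_div_lt (show 0 < ε / 8 by positivity)
  obtain ⟨N0, hN0⟩ := eventually_atTop.1 (hx r)
  refine ⟨N0, fun N hN => ?_⟩
  have hN1 : (0 : ℝ) < N := by
    have : 0 < N := by omega
    exact_mod_cast this
  rw [dist_zero_right, norm_mul, norm_div, norm_one, Complex.norm_natCast, one_div,
    inv_mul_lt_iff₀ hN1]
  have := hN0 N hN.le
  have h2 : 8 * (1 / (r + 1 : ℝ)) * N < ε * N := mul_lt_mul_of_pos_right (by linarith) hN1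
  linarith

end Sys

end sys6

end TPE

namespace TPE

set_option linter.unusedSectionVars false

/-- representative in `[0,1)` -/
noncomputable def rp (θ : UnitAddCircle) : ℝ := (AddCircle.equivIco 1 0 θ : ℝ)

lemma measurable_rp : Measurable rp :=
  measurable_subtype_coe.comp (AddCircle.measurableEquivIco (1 : ℝ) 0).measurable

lemma rp_nonneg (θ : UnitAddCircle) : 0 ≤ rp θ := (AddCircle.equivIco 1 0 θ).2.1

lemma rp_lt_one (θ : UnitAddCircle) : rp θ < 1 := by
  have := (AddCircle.equivIco (1 : ℝ) 0 θ).2.2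
  simpa [rp] using this

lemma coe_rp (θ : UnitAddCircle) : ((rp θ : ℝ) : UnitAddCircle) = θ := AddCircle.coe_equivIco

lemma rp_coe (t : ℝ) : rp (t : UnitAddCircle) = Int.fract t := by
  have := AddCircle.coe_equivIco_mk_apply (p := (1 : ℝ)) t
  simpa [rp] using this

lemma rp_add (θ : UnitAddCircle) (a : ℝ) : rp (θ + (a : UnitAddCircle)) = Int.fract (rp θ + a) := by
  rw [← rp_coe, AddCircle.coe_add, coe_rp]

lemma integral_rp {E : Type*} [NormedAddCommGroup E] [NormedSpace ℝ E] (F : ℝ → E) :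
    ∫ θ : UnitAddCircle, F (rp θ) = ∫ τ in (0 : ℝ)..1, F τ := by
  rw [← UnitAddCircle.intervalIntegral_preimage 0, zero_add]
  refine intervalIntegral.integral_congr_ae ?_
  have : ∀ᵐ x : ℝ, x ≠ 1 := by simp [ae_iff]
  filter_upwards [this] with x hx1 hx
  rw [uIoc_of_le zero_le_one] at hx
  rw [rp_coe, Int.fract_eq_self.2 ⟨hx.1.le, lt_of_le_of_ne hx.2 hx1⟩]


lemma edist_le_rp (x y : UnitAddCircle) : edist x y ≤ ENNReal.ofReal |rp x - rp y| := by
  rw [edist_dist, dist_eq_norm]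
  refine ENNReal.ofReal_le_ofReal ?_
  have e : x - y = ((rp x - rp y : ℝ) : UnitAddCircle) := by
    rw [AddCircle.coe_sub, coe_rp, coe_rp]
  rw [e, UnitAddCircle.norm_eq]
  have := round_le (rp x - rp y) 0
  rw [Int.cast_zero, sub_zero] at this
  exact this

lemma circle_sys {p : ℕ} (hp : 2 ≤ p) {μ : Measure UnitAddCircle}
    (hμ : MeasurePreserving (fun x : UnitAddCircle => p • x) μ μ) :
    Sys μ p (fun x : UnitAddCircle => p • x) rp where
  hp := hp
  mp := hμ
  meas := measurable_rp
  nonneg := rp_nonneg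
  lt_one := rp_lt_one
  step := by
    intro x
    have e : p • x = (((p : ℝ) * rp x : ℝ) : UnitAddCircle) := by
      conv_lhs => rw [← coe_rp x]
      rw [← AddCircle.coe_nsmul, nsmul_eq_mul]
    have h0 : 0 ≤ (p : ℝ) * rp x := mul_nonneg (Nat.cast_nonneg _) (rp_nonneg x)
    refine ⟨⌊(p : ℝ) * rp x⌋₊, ?_⟩
    simp only [e]
    rw [rp_coe, natCast_floor_eq_intCast_floor h0, Int.floor_add_fract]

lemma dim_decay {p : ℕ} {μ : Measure UnitAddCircle} [IsProbabilityMeasure μ]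
    {T : UnitAddCircle → UnitAddCircle} (h : Sys μ p T rp) (hdim : 0 < measureDim μ) :
    ∃ c : ℝ, 0 < c ∧ ∀ᵐ x ∂μ, ∀ᶠ n : ℕ in atTop, w μ p rp n (D p rp n x) ≤ Real.exp (-c * n) := by
  obtain ⟨c', hc'0, hc'⟩ := ENNReal.lt_iff_exists_nnreal_btwn.1 hdim
  have hd0 : (0 : ℝ) < c' := by exact_mod_cast hc'0
  have hp1 : (1 : ℝ) < p := by exact_mod_cast h.hp
  have hp0 := h.pos
  have hlp := Real.log_pos hp1
  set c : ℝ := c' / 2 * Real.log p with hc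
  have hc0 : 0 < c := by positivity
  refine ⟨c, hc0, ?_⟩
  set S : Set UnitAddCircle := {x | ∃ᶠ n : ℕ in atTop, Real.exp (-c * n) < w μ p rp n (D p rp n x)}
    with hS
  have hSm : MeasurableSet S := by
    have e : S = ⋂ N : ℕ, ⋃ n : ℕ, ⋃ _ : N ≤ n,
        {x | Real.exp (-c * n) < w μ p rp n (D p rp n x)} := by
      ext x
      simp only [hS, mem_setOf_eq, frequently_atTop, mem_iInter, mem_iUnion, exists_prop]
    rw [e]
    refine MeasurableSet.iInter fun N => MeasurableSet.iUnion fun n => MeasurableSet.iUnion fun _ => ?_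
    exact measurableSet_lt measurable_const ((measurable_of_countable (w μ p rp n)).comp (h.D_meas n))
  -- Hausdorff measure
  set θ : ℝ≥0∞ := ENNReal.ofReal (Real.exp (-c)) with hθ
  have hθ1 : θ < 1 := by
    rw [hθ, ← ENNReal.ofReal_one]
    exact ENNReal.ofReal_lt_ofReal_iff one_pos |>.2 (by rw [Real.exp_lt_one_iff]; linarith)
  have hH : Measure.hausdorffMeasure (c' : ℝ) S = 0 := by
    set t : ℕ → ℕ × ℕ → Set UnitAddCircle := fun N nj =>
      {x | Real.exp (-c * (N + nj.1 : ℕ)) < w μ p rp (N + nj.1) nj.2 ∧ D p rp (N + nj.1) x = nj.2}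
      with ht
    have hdiam : ∀ N nj, Metric.ediam (t N nj) ≤ ENNReal.ofReal (((p : ℝ) ^ (N + nj.1))⁻¹) := by
      intro N nj
      refine Metric.ediam_le fun x hx y hy => (edist_le_rp x y).trans (ENNReal.ofReal_le_ofReal ?_)
      exact h.rho_close (hx.2.trans hy.2.symm)
    have hle := Measure.hausdorffMeasure_le_liminf_tsum (ι := fun _ : ℕ => ℕ × ℕ) (c' : ℝ) S (l := atTop)
      (fun N : ℕ => ENNReal.ofReal (((p : ℝ) ^ N)⁻¹)) (by
        rw [← ENNReal.ofReal_zero]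
        refine ENNReal.tendsto_ofReal ?_
        exact (tendsto_pow_atTop_atTop_of_one_lt hp1).inv_tendsto_atTop) t
      (Eventually.of_forall fun N nj => (hdiam N nj).trans (ENNReal.ofReal_le_ofReal
        (inv_anti₀ (pow_pos hp0 _) (pow_le_pow_right₀ hp1.le (by omega)))))
      (Eventually.of_forall fun N x hx => by
        obtain ⟨n, hn, hxn⟩ := frequently_atTop.1 hx N
        refine mem_iUnion.2 ⟨(n - N, D p rp n x), ?_⟩
        have e : N + (n - N) = n := by omega
        simp only [ht, mem_setOf_eq, e]
        exact ⟨hxn, trivial⟩)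
    refine le_antisymm (hle.trans ?_) zero_le
    have hbound : ∀ N, ∑' nj, Metric.ediam (t N nj) ^ (c' : ℝ) ≤ θ ^ N * (1 - θ)⁻¹ := by
      intro N
      have hterm : ∀ nj : ℕ × ℕ, Metric.ediam (t N nj) ^ (c' : ℝ) ≤
          θ ^ (N + nj.1) * μ (D p rp (N + nj.1) ⁻¹' {nj.2}) := by
        intro nj
        by_cases hw : Real.exp (-c * (N + nj.1 : ℕ)) < w μ p rp (N + nj.1) nj.2
        · have h1 : Metric.ediam (t N nj) ^ (c' : ℝ) ≤ θ ^ (N + nj.1) * θ ^ (N + nj.1) := by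
            refine (ENNReal.rpow_le_rpow (hdiam N nj) hd0.le).trans (le_of_eq ?_)
            rw [ENNReal.ofReal_rpow_of_pos (by positivity), hθ, ← mul_pow,
              ← ENNReal.ofReal_mul (Real.exp_pos _).le, ← ENNReal.ofReal_pow (by positivity)]
            congr 1
            rw [← Real.exp_add, ← Real.exp_nat_mul, ← Real.rpow_natCast, ← Real.rpow_neg hp0.le,
              ← Real.rpow_mul hp0.le, Real.rpow_def_of_pos hp0]
            congr 1
            rw [hc]; ring
          refine h1.trans ?_
          gcongr
          rw [hθ, ← ENNReal.ofReal_pow (Real.exp_pos _).le, ← Real.exp_nat_mul]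
          refine ENNReal.ofReal_le_of_le_toReal ?_
          have : w μ p rp (N + nj.1) nj.2 = (μ (D p rp (N + nj.1) ⁻¹' {nj.2})).toReal := rfl
          rw [← this]
          rw [mul_comm]; exact hw.le
        · have : t N nj = ∅ := by
            ext x; simp only [ht, mem_setOf_eq, mem_empty_iff_false, iff_false]; exact fun hx => hw hx.1
          rw [this, Metric.ediam_empty, ENNReal.zero_rpow_of_pos hd0]
          exact zero_le
      refine (ENNReal.tsum_le_tsum hterm).trans ?_
      rw [ENNReal.tsum_prod']
      have hone : ∀ n, ∑' j, μ (D p rp n ⁻¹' {j}) = 1 := by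
        intro n
        rw [← measure_iUnion _ fun j => h.D_meas n (measurableSet_singleton j)]
        · have : ⋃ j, D p rp n ⁻¹' {j} = univ := by ext x; simp
          rw [this, measure_univ]
        · intro i j hij
          refine Set.disjoint_left.2 fun x hx hx' => hij ?_
          have h1 : D p rp n x = i := hx
          have h2 : D p rp n x = j := hx'
          exact h1.symm.trans h2
      simp only [ENNReal.tsum_mul_left, hone, mul_one, pow_add]
      rw [ENNReal.tsum_geometric]
    refine (liminf_le_liminf (Eventually.of_forall hbound)).trans (le_of_eq ?_)
    have : Tendsto (fun N : ℕ => θ ^ N * (1 - θ)⁻¹) atTop (𝓝 0) := by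
      have h1 := ENNReal.Tendsto.mul_const (b := (1 - θ)⁻¹)
        (ENNReal.tendsto_pow_atTop_nhds_zero_of_lt_one hθ1)
        (Or.inr (ENNReal.inv_ne_top.2 (tsub_pos_of_lt hθ1).ne'))
      rwa [zero_mul] at h1
    exact this.liminf_eq
  have hdS : dimH S ≤ c' := dimH_le_of_hausdorffMeasure_ne_top (by rw [hH]; exact ENNReal.zero_ne_top)
  have hS0 : μ S = 0 := by
    by_contra hne
    have : measureDim μ ≤ dimH S :=
      iInf_le_of_le S (iInf_le_of_le hSm (iInf_le _ (pos_iff_ne_zero.2 hne)))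
    exact absurd (this.trans hdS) (not_le.2 hc')
  rw [ae_iff]
  refine measure_mono_null (fun x hx => ?_) hS0
  simp only [hS, mem_setOf_eq] at hx ⊢
  rw [not_eventually] at hx
  exact hx.mono fun n hn => not_le.1 hn

end TPE

namespace TPE

lemma vol_prob : IsProbabilityMeasure (volume : Measure UnitAddCircle) :=
  ⟨UnitAddCircle.measure_univ⟩

lemma integral_fourier_ne {n : ℤ} (hn : n ≠ 0) :
    ∫ x : UnitAddCircle, (fourier n x : ℂ) = 0 := by
  have h := fourier_add_half_inv_index (T := (1 : ℝ)) hn one_pos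
  exact integral_eq_zero_of_add_right_eq_neg (μ := (volume : Measure UnitAddCircle)) h

lemma weyl {z : ℕ → UnitAddCircle × UnitAddCircle}
    (hz : ∀ a b : ℤ, (a ≠ 0 ∨ b ≠ 0) → Tendsto (fun N : ℕ => (1 / N : ℂ) * ∑ i ∈ Finset.range N,
      ((fourier a (z i).1 : ℂ) * fourier b (z i).2)) atTop (𝓝 0))
    (f : C(UnitAddCircle × UnitAddCircle, ℝ)) :
    Tendsto (fun N : ℕ => (1 / N : ℝ) * ∑ i ∈ Finset.range N, f (z i)) atTop
      (𝓝 (∫ q, f q ∂((volume : Measure UnitAddCircle).prod (volume : Measure UnitAddCircle)))) := by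
  have := vol_prob
  set ν := (volume : Measure UnitAddCircle).prod (volume : Measure UnitAddCircle) with hν
  let j : UnitAddCircle × UnitAddCircle → UnitAddTorus (Fin 2) := fun q => ![q.1, q.2]
  have hj : Continuous j := by
    refine continuous_pi fun i => ?_
    fin_cases i
    · exact continuous_fst
    · exact continuous_snd
  have hintg : ∀ g : C(UnitAddTorus (Fin 2), ℂ), Integrable (fun q => g (j q)) ν := fun g =>
    integrable_of_bdd (C := ‖g‖) (g.continuous.comp hj).aestronglyMeasurable
      fun q => g.norm_coe_le_norm _
  let P : C(UnitAddTorus (Fin 2), ℂ) → Prop := fun g =>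
    Tendsto (fun N : ℕ => (1 / N : ℂ) * ∑ i ∈ Finset.range N, g (j (z i))) atTop
      (𝓝 (∫ q, g (j q) ∂ν))
  have hspan : ∀ g ∈ Submodule.span ℂ (range (UnitAddTorus.mFourier (d := Fin 2))), P g := by
    intro g hg
    induction hg using Submodule.span_induction with
    | mem g hg =>
      obtain ⟨v, rfl⟩ := hg
      have e : ∀ q, UnitAddTorus.mFourier v (j q) = (fourier (v 0) q.1 : ℂ) * fourier (v 1) q.2 := by
        intro q
        simp [UnitAddTorus.mFourier, j, Fin.prod_univ_two]
      simp only [P, e]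
      by_cases hv : v 0 ≠ 0 ∨ v 1 ≠ 0
      · have h0 : ∫ q, (fourier (v 0) q.1 : ℂ) * fourier (v 1) q.2 ∂ν = 0 := by
          rw [hν, integral_prod_mul (fun x : UnitAddCircle => (fourier (v 0) x : ℂ))
            (fun x : UnitAddCircle => (fourier (v 1) x : ℂ))]
          rcases hv with hv | hv
          · rw [integral_fourier_ne hv, zero_mul]
          · rw [integral_fourier_ne hv, mul_zero]
        rw [h0]
        exact hz _ _ hv
      · push Not at hv
        simp only [hv.1, hv.2, fourier_zero, mul_one]
        rw [integral_const, probReal_univ, one_smul]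
        refine tendsto_const_nhds.congr' ?_
        filter_upwards [eventually_gt_atTop 0] with N hN
        have : (N : ℂ) ≠ 0 := by exact_mod_cast hN.ne'
        simp [this]
    | zero => simp [P]
    | add g g' _ _ h1 h2 =>
      have := h1.add h2
      simp only [P, ContinuousMap.add_apply]
      rw [integral_add (hintg g) (hintg g')]
      refine this.congr fun N => ?_
      rw [Finset.sum_add_distrib, mul_add]
    | smul c g _ h1 =>
      have := h1.const_mul c
      simp only [P, ContinuousMap.smul_apply, smul_eq_mul]
      rw [integral_const_mul]
      refine this.congr fun N => ?_
      rw [← Finset.mul_sum]; ring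
  have hall : ∀ g : C(UnitAddTorus (Fin 2), ℂ), P g := by
    intro g
    have hg : g ∈ closure ((Submodule.span ℂ (range (UnitAddTorus.mFourier (d := Fin 2))) :
        Submodule ℂ C(UnitAddTorus (Fin 2), ℂ)) : Set C(UnitAddTorus (Fin 2), ℂ)) := by
      rw [← Submodule.topologicalClosure_coe, UnitAddTorus.span_mFourier_closure_eq_top]
      trivial
    simp only [P]
    rw [Metric.tendsto_atTop]
    intro ε hε
    obtain ⟨g', hg', hd⟩ := Metric.mem_closure_iff.1 hg (ε / 3) (by positivity)
    have hclose : ∀ y, ‖g y - g' y‖ ≤ ε / 3 := fun y => by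
      rw [← dist_eq_norm]
      exact (ContinuousMap.dist_apply_le_dist y).trans hd.le
    obtain ⟨N0, hN0⟩ := (Metric.tendsto_atTop.1 (hspan g' hg')) (ε / 3) (by positivity)
    refine ⟨N0, fun N hN => ?_⟩
    have h1 := hN0 N hN
    rw [dist_eq_norm] at h1 ⊢
    have h2 : ‖∫ q, g (j q) ∂ν - ∫ q, g' (j q) ∂ν‖ ≤ ε / 3 := by
      rw [← integral_sub (hintg g) (hintg g')]
      have := norm_integral_le_of_norm_le_const (μ := ν) (ae_of_all _ fun q => hclose (j q))
      rwa [probReal_univ, mul_one] at this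
    have h3 : ‖(1 / N : ℂ) * ∑ i ∈ Finset.range N, g (j (z i)) -
        (1 / N : ℂ) * ∑ i ∈ Finset.range N, g' (j (z i))‖ ≤ ε / 3 := by
      rw [← mul_sub, ← Finset.sum_sub_distrib, norm_mul]
      have h4 : ‖∑ i ∈ Finset.range N, (g (j (z i)) - g' (j (z i)))‖ ≤ N * (ε / 3) :=
        (norm_sum_le_of_le _ fun i _ => hclose (j (z i))).trans (by simp)
      rw [norm_div, norm_one, Complex.norm_natCast]
      rcases Nat.eq_zero_or_pos N with rfl | hN1
      · simp; positivity
      · have : (0 : ℝ) < N := by exact_mod_cast hN1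
        rw [one_div, inv_mul_le_iff₀ this]; exact h4
    set u := (1 / N : ℂ) * ∑ i ∈ Finset.range N, g (j (z i))
    set u' := (1 / N : ℂ) * ∑ i ∈ Finset.range N, g' (j (z i))
    set w := ∫ q, g (j q) ∂ν
    set w' := ∫ q, g' (j q) ∂ν
    have e : u - w = (u - u') + (u' - w') - (w - w') := by ring
    rw [e]
    have e1 := norm_sub_le ((u - u') + (u' - w')) (w - w')
    have e2 := norm_add_le (u - u') (u' - w')
    linarith
  let g : C(UnitAddTorus (Fin 2), ℂ) :=
    ⟨fun v => (f (v 0, v 1) : ℂ), by fun_prop⟩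
  have hg : ∀ q, g (j q) = (f q : ℂ) := fun q => rfl
  have h1 := hall g
  simp only [P, hg] at h1
  rw [integral_complex_ofReal] at h1
  have h2 := (Complex.continuous_re.tendsto _).comp h1
  rw [Complex.ofReal_re] at h2
  refine h2.congr fun N => ?_
  simp only [Function.comp_apply]
  have : (1 / N : ℂ) * ∑ i ∈ Finset.range N, (f (z i) : ℂ) =
      ((1 / N * ∑ i ∈ Finset.range N, f (z i) : ℝ) : ℂ) := by push_cast; rfl
  rw [this, Complex.ofReal_re]

lemma circle_ph {α : ℝ} (hα : Irrational α) :
    Ph (volume : Measure UnitAddCircle) rp (fun θ => θ + (α : UnitAddCircle)) α where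
  meas := measurable_rp
  nonneg := rp_nonneg
  lt_one := rp_lt_one
  erg := by
    rw [AddCircle.ergodic_add_right]
    by_contra hne
    obtain ⟨k, _, _, hk⟩ := (AddCircle.addOrderOf_eq_pos_iff (p := (1 : ℝ))
      (Nat.pos_of_ne_zero hne)).1 rfl
    set n := addOrderOf (α : UnitAddCircle)
    have h1 := congrArg rp hk
    rw [rp_coe, rp_coe, Int.fract, Int.fract, mul_one] at h1
    refine hα ⟨(k : ℚ) / n - ⌊(k : ℝ) / n⌋ + ⌊α⌋, ?_⟩
    push_cast
    linarith
  rot := fun θ => rp_add θ α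
  map := fun F => integral_rp F

lemma fourier_iter (a : ℤ) (m i : ℕ) (x : UnitAddCircle) :
    (fourier a ((fun y : UnitAddCircle => m • y)^[i] x) : ℂ) = ee ((a * (m : ℝ) ^ i) * rp x) := by
  have e : (fun y : UnitAddCircle => m • y)^[i] x = (((m : ℝ) ^ i * rp x : ℝ) : UnitAddCircle) := by
    rw [smul_iterate_apply]
    conv_lhs => rw [← coe_rp x]
    rw [← AddCircle.coe_nsmul, nsmul_eq_mul]
    push_cast; rfl
  rw [e, fourier_coe_apply]
  unfold ee
  congr 1
  push_cast
  ring

end TPE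

open TPE

/-- Let `p ≥ 2` and let `μ` be a Borel probability measure on the circle
`𝕋 = ℝ/ℤ` invariant and ergodic under `T_p` with `dim μ > 0`.  Let `m > n > 1` with
`m ≁ p` and `n ≁ p`.  Then for `μ`-a.e. `x`, the empirical measures
`(1/N) ∑_{i<N} δ_{(T_m^i x, T_n^i x)}` converge weak-* to `λ × λ` on `𝕋²`. -/
theorem simultaneous_equidistribution_times_m_times_n
    (p m n : ℕ) (hp : 2 ≤ p) (hn : 1 < n) (hnm : n < m)
    (hindm : Irrational (Real.log p / Real.log m))
    (hindn : Irrational (Real.log p / Real.log n))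
    (μ : Measure UnitAddCircle) [IsProbabilityMeasure μ]
    (herg : Ergodic (fun x : UnitAddCircle => p • x) μ)
    (hdim : 0 < measureDim μ) :
    ∀ᵐ x ∂μ, ∀ f : C(UnitAddCircle × UnitAddCircle, ℝ),
      Tendsto (fun N : ℕ => (1 / N : ℝ) * ∑ i ∈ Finset.range N,
          f ((fun y : UnitAddCircle => m • y)^[i] x, (fun y : UnitAddCircle => n • y)^[i] x))
        atTop
        (𝓝 (∫ q, f q ∂((volume : Measure UnitAddCircle).prod
            (volume : Measure UnitAddCircle)))) := by
  have := vol_prob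
  have h := circle_sys hp herg.toMeasurePreserving
  obtain ⟨c, hc, hdec⟩ := dim_decay h hdim
  obtain ⟨q, hq, hq'⟩ := h.exists_q hc hdec
  have hm' : Irrational (Real.log m / Real.log p) := by
    rw [← inv_div]; exact irrational_inv_iff.2 hindm
  have hn' : Irrational (Real.log n / Real.log p) := by
    rw [← inv_div]; exact irrational_inv_iff.2 hindn
  have hn0 : (0 : ℝ) < n := by exact_mod_cast (by omega : 0 < n)
  have hm0 : (0 : ℝ) < m := by exact_mod_cast (by omega : 0 < m)
  have key : ∀ a b : ℤ, (a ≠ 0 ∨ b ≠ 0) → ∀ᵐ x ∂μ, Tendsto (fun N : ℕ => (1 / N : ℂ) *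
      ∑ i ∈ Finset.range N, ee ((a * (m : ℝ) ^ i + b * (n : ℝ) ^ i) * rp x)) atTop (𝓝 0) := by
    intro a b hab
    by_cases ha : a = 0
    · have hb : b ≠ 0 := by tauto
      subst ha
      refine h.general (circle_ph hn') herg hq hq' (M := n) hn rfl (a := b)
        (by exact_mod_cast hb) ?_
      refine tendsto_const_nhds.congr fun i => ?_
      have : (n : ℝ) ^ i ≠ 0 := by positivity
      field_simp
      simp
    · refine h.general (circle_ph hm') herg hq hq' (M := m) (by omega) rfl (a := a)
        (by exact_mod_cast ha) ?_
      have h1 : Tendsto (fun i : ℕ => ((n : ℝ) / m) ^ i) atTop (𝓝 0) :=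
        tendsto_pow_atTop_nhds_zero_of_lt_one (by positivity)
          ((div_lt_one hm0).2 (by exact_mod_cast hnm))
      have h2 := (h1.const_mul (b : ℝ)).const_add (a : ℝ)
      rw [mul_zero, add_zero] at h2
      refine h2.congr fun i => ?_
      rw [div_pow]
      have : (m : ℝ) ^ i ≠ 0 := by positivity
      field_simp
  have key' : ∀ᵐ x ∂μ, ∀ a b : ℤ, (a ≠ 0 ∨ b ≠ 0) → Tendsto (fun N : ℕ => (1 / N : ℂ) *
      ∑ i ∈ Finset.range N, ee ((a * (m : ℝ) ^ i + b * (n : ℝ) ^ i) * rp x)) atTop (𝓝 0) := by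
    rw [ae_all_iff]; intro a
    rw [ae_all_iff]; intro b
    by_cases hab : a ≠ 0 ∨ b ≠ 0
    · filter_upwards [key a b hab] with x hx _ using hx
    · exact ae_of_all _ fun x hx => absurd hx hab
  filter_upwards [key'] with x hx f
  refine weyl (z := fun i => ((fun y : UnitAddCircle => m • y)^[i] x,
    (fun y : UnitAddCircle => n • y)^[i] x)) ?_ f
  intro a b hab
  refine (hx a b hab).congr fun N => ?_
  congr 1
  refine Finset.sum_congr rfl fun i _ => ?_
  rw [fourier_iter, fourier_iter, ← ee_add, add_mul]
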